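/- arXiv:1501.00445 — 2 statements merged into one kernel-verified Lean document; each statement's English description precedes it below -/
import Mathlib

section
/- Let R = R_{n,e,P} := k[X,Y,Z]/⟨X^nY − P(X, Y^m − X^eZ)⟩ where P(X,S) = S^d + f_{d−2}(X)S^{d−2} + ⋯ + f_1(X)S + f_0(X). Then every k-algebra automorphism of R maps each of the subalgebras k[x,s,y] (≅ B_{n,P}), k[x,s] (= AL(R)) and k[x] (= ML(R)) onto itself; i.e. it restricts to k-automorphisms of these three subalgebras. -/
open MvPolynomial

/-- A locally nilpotent `k`-derivation. -/
def IsLND {k B : Type*} [CommRing k] [CommRing B] [Algebra k B]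
    (D : Derivation k B B) : Prop :=
  ∀ a : B, ∃ n : ℕ, ((D.toLinearMap : Module.End k B) ^ n) a = 0

noncomputable section

variable (k : Type*) [Field k] [CharZero k]

/-- `P(X,T) = T^d + f_{d-1}(X) T^{d-1} + ⋯ + f_0(X)` evaluated at `T`, inside `k[X,Y,Z]`
(the variable `X` has index 0). -/
def Pat (d : ℕ) (f : ℕ → Polynomial k) (T : MvPolynomial (Fin 3) k) :
    MvPolynomial (Fin 3) k :=
  T ^ d + ∑ i ∈ Finset.range d, Polynomial.aeval (X 0) (f i) * T ^ i

/-- `Q(X,Y) = Y^m + g_{m-1}(X) Y^{m-1} + ⋯ + g_0(X)` in `k[X,Y,Z]`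
(variables `X = 0`, `Y = 1`, `Z = 2`). -/
def Qpoly (m : ℕ) (g : ℕ → Polynomial k) : MvPolynomial (Fin 3) k :=
  X 1 ^ m + ∑ j ∈ Finset.range m, Polynomial.aeval (X 0) (g j) * X 1 ^ j

/-- The ideal `⟨XⁿY - P(X, Q(X,Y) - XᵉZ)⟩` of `k[X,Y,Z]` (variables `X = 0`, `Y = 1`, `Z = 2`). -/
def RIdeal (n e d m : ℕ) (f g : ℕ → Polynomial k) : Ideal (MvPolynomial (Fin 3) k) :=
  Ideal.span {X 0 ^ n * X 1 - Pat k d f (Qpoly k m g - X 0 ^ e * X 2)}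

/-- `R_{n,e,P,Q} = k[X,Y,Z]/⟨XⁿY - P(X, Q(X,Y) - XᵉZ)⟩`. -/
def RRing (n e d m : ℕ) (f g : ℕ → Polynomial k) : Type _ :=
  MvPolynomial (Fin 3) k ⧸ RIdeal k n e d m f g

instance (n e d m : ℕ) (f g : ℕ → Polynomial k) : CommRing (RRing k n e d m f g) :=
  Ideal.Quotient.commRing _

instance (n e d m : ℕ) (f g : ℕ → Polynomial k) : Algebra k (RRing k n e d m f g) :=
  Ideal.Quotient.algebra k

variable (n e d m : ℕ) (f g : ℕ → Polynomial k)

/-- The class `x` of `X` in `R_{n,e,P,Q}`. -/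
def xel : RRing k n e d m f g := Ideal.Quotient.mk _ (X 0)

/-- The class `y` of `Y` in `R_{n,e,P,Q}`. -/
def yel : RRing k n e d m f g := Ideal.Quotient.mk _ (X 1)

/-- The class `z` of `Z` in `R_{n,e,P,Q}`. -/
def zel : RRing k n e d m f g := Ideal.Quotient.mk _ (X 2)

/-- The element `s = Q(x,y) - xᵉz` of `R_{n,e,P,Q}`. -/
def sel : RRing k n e d m f g := Ideal.Quotient.mk _ (Qpoly k m g - X 0 ^ e * X 2)

/-- `(∂P/∂S)(x,s)` in `R_{n,e,P,Q}`. -/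
def PSel : RRing k n e d m f g :=
  (d : RRing k n e d m f g) * sel k n e d m f g ^ (d - 1) +
    ∑ i ∈ Finset.range d, (i : RRing k n e d m f g) *
      Polynomial.aeval (xel k n e d m f g) (f i) * sel k n e d m f g ^ (i - 1)

/-- `(∂Q/∂Y)(x,y)` in `R_{n,e,P,Q}`. -/
def QYel : RRing k n e d m f g :=
  (m : RRing k n e d m f g) * yel k n e d m f g ^ (m - 1) +
    ∑ j ∈ Finset.range m, (j : RRing k n e d m f g) *
      Polynomial.aeval (xel k n e d m f g) (g j) * yel k n e d m f g ^ (j - 1)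

end

/-- Makar-Limanov invariant. -/
def ML (k B : Type*) [CommRing k] [CommRing B] [Algebra k B] : Set B :=
  {b : B | ∀ D : Derivation k B B, IsLND D → D b = 0}

/-- The `AL`-invariant: the `k`-subalgebra generated by `ker ∂²` for all nonzero
locally nilpotent derivations `∂`. -/
def ALinv (k B : Type*) [CommRing k] [CommRing B] [Algebra k B] : Subalgebra k B :=
  Algebra.adjoin k {b : B | ∃ D : Derivation k B B, IsLND D ∧ D ≠ 0 ∧
    ((D.toLinearMap : Module.End k B) ^ 2) b = 0}

noncomputable section

variable (k : Type*) [Field k] [CharZero k]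

/-- The ideal `⟨XⁿY - P(X,S)⟩` of `k[X,S,Y]` (variables `X = 0`, `S = 1`, `Y = 2`). -/
def DanIdeal (n d : ℕ) (f : ℕ → Polynomial k) : Ideal (MvPolynomial (Fin 3) k) :=
  Ideal.span {X 0 ^ n * X 2 - Pat k d f (X 1)}

/-- The Danielewski domain `B_{n,P} = k[X,S,Y]/⟨XⁿY - P(X,S)⟩`. -/
def DanRing (n d : ℕ) (f : ℕ → Polynomial k) : Type _ :=
  MvPolynomial (Fin 3) k ⧸ DanIdeal k n d f

instance (n d : ℕ) (f : ℕ → Polynomial k) : CommRing (DanRing k n d f) :=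
  Ideal.Quotient.commRing _

instance (n d : ℕ) (f : ℕ → Polynomial k) : Algebra k (DanRing k n d f) :=
  Ideal.Quotient.algebra k

end

/-- The ring of Laurent polynomials in `s` and `x`; the exponent `(q, p)` stands for `s^q x^p`. -/
abbrev Laurent2 (k : Type*) [Field k] : Type _ := AddMonoidAlgebra k (ℤ × ℤ)

namespace Laurent2

variable {k : Type*} [Field k]

/-- `r` has coefficient `c` at `v` and vanishing coefficients at all exponents that are
lexicographically larger than `v`. -/
def IsTop (v : ℤ × ℤ) (c : k) (r : Laurent2 k) : Prop :=
  r.coeff v = c ∧ ∀ u : ℤ × ℤ, (v.1 < u.1 ∨ (v.1 = u.1 ∧ v.2 < u.2)) → r.coeff u = 0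

/-- All exponents of `s` in `r` are smaller than `N`. -/
def DegLT (N : ℤ) (r : Laurent2 k) : Prop := ∀ u : ℤ × ℤ, N ≤ u.1 → r.coeff u = 0

theorem coeff_mul_eq_zero {r t : Laurent2 k} {u : ℤ × ℤ}
    (h : ∀ a b, r.coeff a ≠ 0 → t.coeff b ≠ 0 → a + b ≠ u) : (r * t).coeff u = 0 := by
  rw [AddMonoidAlgebra.coeff_mul]
  refine Finset.sum_eq_zero fun a ha => Finset.sum_eq_zero fun b hb => if_neg ?_
  exact h a b (Finsupp.mem_support_iff.1 ha) (Finsupp.mem_support_iff.1 hb)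

theorem IsTop.le {v : ℤ × ℤ} {c : k} {r : Laurent2 k} (h : IsTop v c r) {u : ℤ × ℤ}
    (hu : r.coeff u ≠ 0) : u.1 < v.1 ∨ (u.1 = v.1 ∧ u.2 ≤ v.2) := by
  by_contra hc
  exact hu (h.2 u (by omega))

theorem IsTop.mul {v w : ℤ × ℤ} {c c' : k} {r t : Laurent2 k} (hr : IsTop v c r)
    (ht : IsTop w c' t) : IsTop (v + w) (c * c') (r * t) := by
  refine ⟨?_, fun u hu => coeff_mul_eq_zero fun a b ha hb hab => ?_⟩
  · rw [AddMonoidAlgebra.coeff_mul_add_of_uniqueAdd, hr.1, ht.1]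
    intro a b ha hb hab
    have h1 := hr.le (Finsupp.mem_support_iff.1 ha)
    have h2 := ht.le (Finsupp.mem_support_iff.1 hb)
    have h3 := congrArg Prod.fst hab
    have h4 := congrArg Prod.snd hab
    simp only [Prod.fst_add, Prod.snd_add] at h3 h4
    constructor <;> ext <;> omega
  · have h1 := hr.le ha
    have h2 := ht.le hb
    subst hab
    simp only [Prod.fst_add, Prod.snd_add] at hu
    omega

theorem isTop_single (v : ℤ × ℤ) (c : k) : IsTop v c (AddMonoidAlgebra.single v c) := by
  refine ⟨by simp, fun u hu => ?_⟩
  rw [AddMonoidAlgebra.coeff_single, Finsupp.single_apply, if_neg]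
  rintro rfl
  omega

theorem isTop_one : IsTop (0 : ℤ × ℤ) (1 : k) 1 := isTop_single 0 1

theorem IsTop.pow {v : ℤ × ℤ} {r : Laurent2 k} (hr : IsTop v 1 r) (n : ℕ) :
    IsTop (n • v) 1 (r ^ n) := by
  induction n with
  | zero => simpa using isTop_one
  | succ n ih => rw [pow_succ, succ_nsmul]; simpa only [one_mul] using ih.mul hr

theorem IsTop.add {v : ℤ × ℤ} {c c' : k} {r t : Laurent2 k} (hr : IsTop v c r)
    (ht : IsTop v c' t) : IsTop v (c + c') (r + t) :=
  ⟨by simp [hr.1, ht.1], fun u hu => by simp [hr.2 u hu, ht.2 u hu]⟩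

theorem IsTop.sum {ι : Type*} {v : ℤ × ℤ} {S : Finset ι} {c : ι → k} {r : ι → Laurent2 k}
    (h : ∀ i ∈ S, IsTop v (c i) (r i)) : IsTop v (∑ i ∈ S, c i) (∑ i ∈ S, r i) := by
  classical
  induction S using Finset.induction_on with
  | empty => exact ⟨by simp, by simp⟩
  | insert a S ha ih =>
    rw [Finset.sum_insert ha, Finset.sum_insert ha]
    exact (h a (Finset.mem_insert_self a S)).add
      (ih fun i hi => h i (Finset.mem_insert_of_mem hi))

theorem IsTop.of_lt {v w : ℤ × ℤ} {c : k} {r : Laurent2 k} (h : IsTop v c r)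
    (hw : v.1 < w.1 ∨ (v.1 = w.1 ∧ v.2 < w.2)) : IsTop w 0 r :=
  ⟨h.2 w hw, fun u hu => h.2 u (by omega)⟩

theorem IsTop.degLT {v : ℤ × ℤ} {c : k} {r : Laurent2 k} (h : IsTop v c r) {N : ℤ}
    (hv : v.1 < N) : DegLT N r := fun u hu => h.2 u (Or.inl (lt_of_lt_of_le hv hu))

theorem IsTop.ne_zero {v : ℤ × ℤ} {c : k} {r : Laurent2 k} (h : IsTop v c r) (hc : c ≠ 0) :
    r ≠ 0 := by
  rintro rfl
  exact hc (by simpa using h.1.symm)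

theorem IsTop.unique {v w : ℤ × ℤ} {c c' : k} {r : Laurent2 k} (h : IsTop v c r)
    (h' : IsTop w c' r) (hc : c ≠ 0) (hc' : c' ≠ 0) : v = w := by
  have h1 := h.le (u := w) (by rwa [h'.1])
  have h2 := h'.le (u := v) (by rwa [h.1])
  ext <;> omega

theorem IsTop.exists_common {v w : ℤ × ℤ} {a b : k} {r t : Laurent2 k} (hr : IsTop v a r)
    (ht : IsTop w b t) (ha : a ≠ 0) (hb : b ≠ 0) :
    ∃ u a' b', (a' ≠ 0 ∨ b' ≠ 0) ∧ v.1 ≤ u.1 ∧ IsTop u a' r ∧ IsTop u b' t := by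
  by_cases h : w.1 < v.1 ∨ (w.1 = v.1 ∧ w.2 < v.2)
  · exact ⟨v, a, 0, Or.inl ha, le_rfl, hr, ht.of_lt h⟩
  by_cases h' : v.1 < w.1 ∨ (v.1 = w.1 ∧ v.2 < w.2)
  · exact ⟨w, 0, b, Or.inr hb, by omega, hr.of_lt h', ht⟩
  obtain rfl : v = w := by ext <;> omega
  exact ⟨v, a, b, Or.inl ha, le_rfl, hr, ht⟩

/-- The derivation multiplying each monomial by the value of an additive character at its
exponent. -/
noncomputable def weightDerivation (χ : ℤ × ℤ →+ k) : Derivation k (Laurent2 k) (Laurent2 k) :=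
  Derivation.mk'
    { toFun := fun r => .ofCoeff
        (Finsupp.onFinset r.coeff.support (fun v => χ v * r.coeff v)
          fun v hv => Finsupp.mem_support_iff.2 (right_ne_zero_of_mul hv))
      map_add' := fun r t => by ext v; simp [mul_add]
      map_smul' := fun c r => by ext v; simp [mul_left_comm] }
    (by
      intro a b
      induction a using AddMonoidAlgebra.induction_linear with
      | zero => simp only [zero_mul, map_zero, smul_zero, zero_smul, add_zero]
      | add f g hf hg =>
        rw [add_mul, map_add, hf, hg, map_add, add_smul, smul_add]; abel
      | single u c =>
        induction b using AddMonoidAlgebra.induction_linear with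
        | zero => simp only [mul_zero, map_zero, smul_zero, zero_smul, add_zero]
        | add f g hf hg =>
          rw [mul_add, map_add, hf, hg, map_add, add_smul, smul_add]; abel
        | single w c' =>
          have key : ∀ (u : ℤ × ℤ) (c : k), AddMonoidAlgebra.ofCoeff
              (Finsupp.onFinset (AddMonoidAlgebra.single u c : Laurent2 k).coeff.support
                (fun v => χ v * (AddMonoidAlgebra.single u c : Laurent2 k).coeff v)
                fun v hv => Finsupp.mem_support_iff.2 (right_ne_zero_of_mul hv)) =
              AddMonoidAlgebra.single u (χ u * c) := by
            intro u c
            ext v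
            by_cases h : u = v
            · subst h; simp
            · simp [Finsupp.single_apply, h]
          simp only [LinearMap.coe_mk, AddHom.coe_mk, smul_eq_mul,
            AddMonoidAlgebra.single_mul_single]
          rw [key, key, key, AddMonoidAlgebra.single_mul_single,
            AddMonoidAlgebra.single_mul_single, map_add, add_comm w u,
            ← AddMonoidAlgebra.single_add]
          congr 1
          ring)

theorem coeff_weightDerivation (χ : ℤ × ℤ →+ k) (r : Laurent2 k) (v : ℤ × ℤ) :
    (weightDerivation χ r).coeff v = χ v * r.coeff v := rfl

theorem IsTop.weightDerivation {v : ℤ × ℤ} {c : k} {r : Laurent2 k} (h : IsTop v c r)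
    (χ : ℤ × ℤ →+ k) : IsTop v (χ v * c) (weightDerivation χ r) :=
  ⟨by rw [coeff_weightDerivation, h.1], fun u hu => by
    rw [coeff_weightDerivation, h.2 u hu, mul_zero]⟩

theorem weightDerivation_single (χ : ℤ × ℤ →+ k) (v : ℤ × ℤ) (c : k) :
    weightDerivation χ (AddMonoidAlgebra.single v c) = AddMonoidAlgebra.single v (χ v * c) := by
  ext u
  rw [coeff_weightDerivation]
  by_cases h : v = u
  · subst h; simp
  · simp [h]

variable (k) in
/-- The exponent of `s` as an additive character. -/
def sExp : ℤ × ℤ →+ k := (Int.castAddHom k).comp (AddMonoidHom.fst ℤ ℤ)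

variable (k) in
/-- The exponent of `x` as an additive character. -/
def xExp : ℤ × ℤ →+ k := (Int.castAddHom k).comp (AddMonoidHom.snd ℤ ℤ)

@[simp] theorem sExp_apply (v : ℤ × ℤ) : sExp k v = (v.1 : k) := rfl

@[simp] theorem xExp_apply (v : ℤ × ℤ) : xExp k v = (v.2 : k) := rfl

/-- The derivation `a · x ∂/∂x + b · s ∂/∂s`. -/
noncomputable def vectorField (a b : Laurent2 k) : Derivation k (Laurent2 k) (Laurent2 k) :=
  a • weightDerivation (xExp k) + b • weightDerivation (sExp k)

theorem vectorField_apply (a b r : Laurent2 k) : vectorField a b r =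
    a * weightDerivation (xExp k) r + b * weightDerivation (sExp k) r := rfl

theorem IsTop.vectorField {a b r : Laurent2 k} {w v : ℤ × ℤ} {α β c : k} (ha : IsTop w α a)
    (hb : IsTop w β b) (hr : IsTop v c r) :
    IsTop (v + w) ((α * v.2 + β * v.1) * c) (vectorField a b r) := by
  have h := (ha.mul (hr.weightDerivation (xExp k))).add (hb.mul (hr.weightDerivation (sExp k)))
  rw [vectorField_apply, add_comm v w]
  convert h using 1
  simp only [xExp_apply, sExp_apply]
  ring

theorem DegLT.vectorField {b r : Laurent2 k} {N : ℤ} (hb : DegLT 0 b) (hr : DegLT N r) :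
    DegLT (N - 1) (vectorField 0 b r) := by
  intro u hu
  rw [vectorField_apply, zero_mul, zero_add]
  refine coeff_mul_eq_zero fun a c ha hc hac => ?_
  have h1 : a.1 < 0 := by
    by_contra h
    exact ha (hb a (by omega))
  have h2 : c.1 < N := by
    by_contra h
    rw [coeff_weightDerivation] at hc
    exact right_ne_zero_of_mul hc (hr c (by omega))
  subst hac
  simp only [Prod.fst_add] at hu
  omega

end Laurent2

/-- `-leadBound n e d m q` is the least power of `x` occurring in the leading coefficient of an
element of degree `q` in `s`. -/
def leadBound (n e d m : ℕ) (q : ℤ) : ℤ := n * (q / d) + e * (q / d / m)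

theorem leadBound_of_lt {n e d m : ℕ} {q : ℤ} (h0 : 0 ≤ q) (h : q < d) :
    leadBound n e d m q = 0 := by
  simp [leadBound, Int.ediv_eq_zero_of_lt h0 h]

theorem leadBound_eq {n e d m : ℕ} (b c l : ℤ) (hb : 0 ≤ b) (hbd : b < d) (hc : 0 ≤ c)
    (hcm : c < m) : leadBound n e d m (b + d * (c + m * l)) = n * (c + m * l) + e * l := by
  have h1 : (b + d * (c + m * l)) / d = c + m * l := by
    rw [Int.add_mul_ediv_left _ _ (by omega), Int.ediv_eq_zero_of_lt hb hbd, zero_add]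
  have h2 : (c + m * l) / m = l := by
    rw [Int.add_mul_ediv_left _ _ (by omega), Int.ediv_eq_zero_of_lt hc hcm, zero_add]
  rw [leadBound, h1, h2]

theorem leadBound_add_one_of_dvd {n e d m : ℕ} (hd : 2 ≤ d) {q : ℤ} (h : (d : ℤ) ∣ q) :
    leadBound n e d m (q + 1) = leadBound n e d m q := by
  obtain ⟨u, rfl⟩ := h
  have h1 : ((d : ℤ) * u + 1) / d = u := by
    rw [add_comm, Int.add_mul_ediv_left _ _ (by omega),
      Int.ediv_eq_zero_of_lt (by omega) (by omega), zero_add]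
  have h2 : ((d : ℤ) * u) / d = u := Int.mul_ediv_cancel_left _ (by omega)
  rw [leadBound, leadBound, h1, h2]

section Combinatorics

variable {n e d m : ℕ} {α β : ℤ}

theorem weight_eq_sum (hd : 2 ≤ d) (hm : 2 ≤ m) (q p : ℤ) (hq : 0 ≤ q) :
    ∃ b c l : ℤ, 0 ≤ b ∧ b < d ∧ 0 ≤ c ∧ c < m ∧ 0 ≤ l ∧ q = b + d * (c + m * l) ∧
      α * p + β * q = α * (p + leadBound n e d m q) + b * β + c * (d * β - n * α) +
        l * (d * m * β - (n * m + e) * α) := by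
  have hd0 : (0 : ℤ) < d := by omega
  have hm0 : (0 : ℤ) < m := by omega
  have hq' : q = q % d + d * (q / d % m + m * (q / d / m)) := by
    rw [Int.emod_add_mul_ediv, Int.emod_add_mul_ediv]
  have hb := Int.emod_nonneg q hd0.ne'
  have hb' := Int.emod_lt_of_pos q hd0
  have hc := Int.emod_nonneg (q / d) hm0.ne'
  have hc' := Int.emod_lt_of_pos (q / d) hm0
  refine ⟨q % d, q / d % m, q / d / m, hb, hb', hc, hc',
    Int.ediv_nonneg (Int.ediv_nonneg hq hd0.le) hm0.le, hq', ?_⟩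
  generalize q % d = b at *
  generalize q / d % m = c at *
  generalize q / d / m = l at *
  subst hq'
  rw [leadBound_eq b c l hb hb' hc hc']
  ring

theorem weight_eq_zero (hd : 2 ≤ d) (hm : 2 ≤ m) (hα : 1 ≤ α) (hβ : 1 ≤ β)
    (hy : 0 ≤ d * β - n * α) (hz : 0 ≤ d * m * β - (n * m + e) * α) {q p : ℤ} (hq : 0 ≤ q)
    (hp : 0 ≤ p + leadBound n e d m q) (h0 : α * p + β * q = 0) :
    (d : ℤ) ∣ q ∧ p + leadBound n e d m q = 0 ∧ (0 < q → d * m * β - (n * m + e) * α = 0) ∧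
      (1 ≤ e → (d * m : ℤ) ∣ q) := by
  obtain ⟨b, c, l, hb, -, hc, -, hl, hq', hw⟩ := weight_eq_sum (n := n) (e := e) (α := α) (β := β)
    hd hm q p hq
  have t1 : 0 ≤ α * (p + leadBound n e d m q) := mul_nonneg (by omega) hp
  have t2 : 0 ≤ b * β := mul_nonneg hb (by omega)
  have t3 := mul_nonneg hc hy
  have t4 := mul_nonneg hl hz
  have z1 : p + leadBound n e d m q = 0 :=
    (mul_eq_zero.1 (by omega : α * (p + leadBound n e d m q) = 0)).resolve_left (by omega)
  have z2 : b = 0 := (mul_eq_zero.1 (by omega : b * β = 0)).resolve_right (by omega)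
  have z3 : c = 0 ∨ d * β - n * α = 0 := mul_eq_zero.1 (by omega)
  have z4 : l = 0 ∨ d * m * β - (n * m + e) * α = 0 := mul_eq_zero.1 (by omega)
  have heα : 0 ≤ (e : ℤ) * α := mul_nonneg (by omega) (by omega)
  have key : d * m * β - (n * m + e) * α = m * (d * β - n * α) - e * α := by ring
  have hcy : 1 ≤ e → c = 0 := by
    intro he
    refine z3.resolve_right fun h => ?_
    rw [key, h, mul_zero] at hz
    have : 0 < (e : ℤ) * α := mul_pos (by omega) (by omega)
    omega
  subst z2
  refine ⟨⟨_, by rw [hq', zero_add]⟩, z1, fun hpos => ?_, fun he => ⟨l, by rw [hq', hcy he]; ring⟩⟩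
  rcases z4 with rfl | h
  · rcases z3 with rfl | h
    · simp at hq'
      omega
    · rw [key, h, mul_zero] at hz ⊢
      omega
  · exact h

theorem no_negative_weight (hn : 1 ≤ n) (hne : ¬(n = 1 ∧ e = 0)) (hd : 2 ≤ d) (hm : 2 ≤ m)
    {i j : ℤ} (hj : 0 ≤ j) (hw : α * i + β * j = -1)
    (H : ∀ q p : ℤ, 0 ≤ q → 0 ≤ p + leadBound n e d m q → 0 ≤ α * p + β * q ∧
      (0 < α * p + β * q → 0 ≤ (p + i) + leadBound n e d m (q + j))) : False := by
  have hα0 : 0 ≤ α := by simpa [leadBound] using (H 0 1 le_rfl (by simp [leadBound])).1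
  have hβ0 : 0 ≤ β := by
    simpa using (H 1 0 zero_le_one (by rw [leadBound_of_lt (by omega) (by omega)]; simp)).1
  have hα : 1 ≤ α := by
    by_contra h
    obtain rfl : α = 0 := by omega
    have := mul_nonneg hβ0 hj
    omega
  have hy : 0 ≤ d * β - n * α := by
    have h := leadBound_eq (n := n) (e := e) (d := d) (m := m) 0 1 0 le_rfl (by omega)
      (by omega) (by omega)
    simp only [mul_zero, add_zero, mul_one, zero_add] at h
    have := (H d (-n) (by omega) (by rw [h]; omega)).1
    linarith
  have hz : 0 ≤ d * m * β - (n * m + e) * α := by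
    have h := leadBound_eq (n := n) (e := e) (d := d) (m := m) 0 0 1 le_rfl (by omega)
      le_rfl (by omega)
    simp only [mul_one, zero_add] at h
    have := (H (d * m) (-(n * m + e)) (by positivity) (by rw [h]; omega)).1
    linarith
  have hβ : 1 ≤ β := by
    by_contra h
    obtain rfl : β = 0 := by omega
    have h1 : 0 < ((n : ℤ) * m + e) * α := by
      have : 0 < (n : ℤ) * m := by positivity
      positivity
    simp only [mul_zero] at hz
    omega
  have hj1 : 1 ≤ j := by
    by_contra h
    obtain rfl : j = 0 := by omega
    have h1 : α * (-i) = 1 := by linarith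
    have h2 : -i = 1 := by
      rcases Int.eq_one_or_neg_one_of_mul_eq_one' h1 with h | h <;> omega
    have := (H 1 0 zero_le_one (by rw [leadBound_of_lt (by omega) (by omega)]; simp)).2 (by omega)
    rw [add_zero, leadBound_of_lt (by omega) (by omega)] at this
    omega
  have chain : ∀ l : ℕ, (l : ℤ) ≤ α → 0 ≤ (1 + l * i) + leadBound n e d m (l * j) := by
    intro l
    induction l with
    | zero => intro _; simp [leadBound]
    | succ l ih =>
      intro hl
      push_cast at hl ⊢
      have h := (H (l * j) (1 + l * i) (by positivity) (ih (by omega))).2 (by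
        have : α * (1 + l * i) + β * (l * j) = α + l * (α * i + β * j) := by ring
        rw [this, hw]
        omega)
      convert h using 2 <;> ring_nf
  obtain ⟨a, rfl⟩ : ∃ a : ℕ, α = a + 1 := ⟨(α - 1).toNat, by omega⟩
  have hker : d * m * β - (n * m + e) * ((a : ℤ) + 1) = 0 := by
    have h := chain (a + 1) (by push_cast; omega)
    have hpos : 0 < ((a + 1 : ℕ) : ℤ) * j := by positivity
    refine (weight_eq_zero hd hm hα hβ hy hz hpos.le h ?_).2.2.1 hpos
    push_cast
    linear_combination ((a : ℤ) + 1) * hw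
  have hS := chain a (by omega)
  have hq0 : 0 ≤ (a : ℤ) * j := by positivity
  obtain ⟨q, hq⟩ : ∃ q, q = (a : ℤ) * j := ⟨_, rfl⟩
  obtain ⟨p, hp⟩ : ∃ p, p = 1 + (a : ℤ) * i := ⟨_, rfl⟩
  rw [← hq, ← hp] at hS
  rw [← hq] at hq0
  have hone : ((a : ℤ) + 1) * p + β * q = 1 := by
    rw [hp, hq]
    linear_combination (a : ℤ) * hw
  have hdq : (d : ℤ) ∣ q + j := by
    refine (weight_eq_zero hd hm hα hβ hy hz (by omega) ((H q p hq0 hS).2 (by omega)) ?_).1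
    linear_combination hone + hw
  obtain ⟨b, c, l, hb, -, hc, -, hl, hq', hsum⟩ := weight_eq_sum (n := n) (e := e)
    (α := (a : ℤ) + 1) (β := β) hd hm q p hq0
  rw [hone, hker, mul_zero] at hsum
  have hs := (H 1 0 zero_le_one (by rw [leadBound_of_lt (by omega) (by omega)]; simp)).2 (by omega)
  rw [zero_add, add_comm 1 j] at hs
  by_cases hb0 : b = 0
  · have hdj : (d : ℤ) ∣ j := by
      have : (d : ℤ) ∣ q := ⟨c + m * l, by rw [hq', hb0, zero_add]⟩
      exact (dvd_add_right this).1 hdq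
    rw [leadBound_add_one_of_dvd hd hdj] at hs
    have := (H j i hj hs).1
    omega
  · have t1 : 0 ≤ ((a : ℤ) + 1) * (p + leadBound n e d m q) := by positivity
    have t3 := mul_nonneg hc hy
    have hβ1 : β = 1 := by
      have : β ≤ b * β := le_mul_of_one_le_left (by omega) (by omega)
      omega
    subst hβ1
    obtain ⟨⟨u, hu⟩, hi, -, hdm⟩ := weight_eq_zero hd hm hα hβ hy hz (by omega : 0 ≤ j + 1) hs
      (by linarith)
    have hx := (H 0 1 le_rfl (by simp [leadBound])).2 (by omega)
    rw [zero_add] at hx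
    have hjd : j / d = u - 1 := by
      have : j = (d - 1) + d * (u - 1) := by linear_combination hu
      rw [this, Int.add_mul_ediv_left _ _ (by omega), Int.ediv_eq_zero_of_lt (by omega) (by omega),
        zero_add]
    have hj1d : (j + 1) / d = u := by rw [hu, Int.mul_ediv_cancel_left _ (by omega)]
    rw [leadBound, hjd] at hx
    rw [leadBound, hj1d] at hi
    rcases Nat.eq_zero_or_pos e with rfl | he
    · simp only [Nat.cast_zero, zero_mul, add_zero] at hx hi
      have hn1 : n ≠ 1 := fun h => hne ⟨h, rfl⟩
      have : (2 : ℤ) ≤ n := by omega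
      linarith
    · obtain ⟨v, hv⟩ := hdm he
      obtain rfl : u = m * v := by
        have hd0 : (d : ℤ) ≠ 0 := by omega
        exact mul_left_cancel₀ hd0 (by rw [← hu, hv, mul_assoc])
      have h1 : (m * v - 1 : ℤ) / m = v - 1 := by
        have : (m * v - 1 : ℤ) = (m - 1) + m * (v - 1) := by ring
        rw [this, Int.add_mul_ediv_left _ _ (by omega),
          Int.ediv_eq_zero_of_lt (by omega) (by omega), zero_add]
      have h2 : (m * v : ℤ) / m = v := Int.mul_ediv_cancel_left _ (by omega)
      rw [h1] at hx
      rw [h2] at hi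
      have : (1 : ℤ) ≤ n := by omega
      have : (1 : ℤ) ≤ e := by omega
      linarith

end Combinatorics

open Laurent2

/-- The algebra `A` is generated by `x, s, y, z` subject to the two defining relations of the double
Danielewski surface, and `ρ` maps it to Laurent polynomials in `s` and `x`. -/
structure IsDanielewski {k A : Type*} [Field k] [CommRing A] [Algebra k A] (n e d m : ℕ)
    (f : ℕ → Polynomial k) (x s y z : A) (ρ : A →ₐ[k] Laurent2 k) : Prop where
  adjoin_eq_top : Algebra.adjoin k {x, s, y, z} = ⊤
  rel_y : x ^ n * y = s ^ d + ∑ i ∈ Finset.range d, Polynomial.aeval x (f i) * s ^ i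
  rel_z : y ^ m = x ^ e * z + s
  map_x : ρ x = AddMonoidAlgebra.single (0, 1) 1
  map_s : ρ s = AddMonoidAlgebra.single (1, 0) 1

namespace IsDanielewski

variable {k A : Type*} [Field k] [CommRing A] [Algebra k A] {n e d m : ℕ}
  {f : ℕ → Polynomial k} {x s y z : A} {ρ : A →ₐ[k] Laurent2 k}

/-- The `k[x]`-basis of normal form monomials, indexed by the degree in `s`. -/
def normalMonomial (d m : ℕ) (s y z : A) (q : ℕ) : A :=
  s ^ (q % d) * y ^ (q / d % m) * z ^ (q / d / m)

theorem normalMonomial_of_lt {q : ℕ} (h : q < d) : normalMonomial d m s y z q = s ^ q := by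
  simp [normalMonomial, Nat.mod_eq_of_lt h, Nat.div_eq_of_lt h]

theorem normalMonomial_self (hd : 0 < d) (hm : 2 ≤ m) : normalMonomial d m s y z d = y := by
  have h : 1 % m = 1 := Nat.mod_eq_of_lt hm
  have h' : 1 / m = 0 := Nat.div_eq_of_lt hm
  simp [normalMonomial, Nat.div_self hd, h, h']

section Span

variable (k d m x s y z) in
/-- The `k[x]`-span of the normal form monomials. -/
abbrev normalForms : Submodule (Algebra.adjoin k {x}) A :=
  Submodule.span _ (Set.range (normalMonomial d m s y z))

theorem aeval_mul_mem {M : Submodule (Algebra.adjoin k {x}) A} (F : Polynomial k) {r : A}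
    (hr : r ∈ M) : Polynomial.aeval x F * r ∈ M :=
  M.smul_mem (⟨Polynomial.aeval x F, Polynomial.aeval_mem_adjoin_singleton k x⟩ :
    Algebra.adjoin k {x}) hr

theorem pow_mul_mem {M : Submodule (Algebra.adjoin k {x}) A} (l : ℕ) {r : A}
    (hr : r ∈ M) : x ^ l * r ∈ M := by
  simpa using aeval_mul_mem (Polynomial.X ^ l) hr

theorem monomial_mem {b c l : ℕ} (hb : b < d) (hc : c < m) :
    s ^ b * y ^ c * z ^ l ∈ normalForms k d m x s y z := by
  refine Submodule.subset_span ⟨b + d * (c + m * l), ?_⟩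
  have h1 : (b + d * (c + m * l)) % d = b := by
    rw [Nat.add_mul_mod_self_left, Nat.mod_eq_of_lt hb]
  have h2 : (b + d * (c + m * l)) / d = c + m * l := by
    rw [Nat.add_mul_div_left _ _ (by omega), Nat.div_eq_of_lt hb, zero_add]
  have h3 : (c + m * l) % m = c := by rw [Nat.add_mul_mod_self_left, Nat.mod_eq_of_lt hc]
  have h4 : (c + m * l) / m = l := by
    rw [Nat.add_mul_div_left _ _ (by omega), Nat.div_eq_of_lt hc, zero_add]
  rw [normalMonomial, h1, h2, h3, h4]

theorem y_pow_mem (h : IsDanielewski n e d m f x s y z ρ) (hd : 2 ≤ d) (hm : 1 ≤ m) {c l : ℕ}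
    (hc : c ≤ m) : y ^ c * z ^ l ∈ normalForms k d m x s y z := by
  rcases hc.lt_or_eq with hc | rfl
  · simpa using monomial_mem (x := x) (s := s) (y := y) (z := z) (l := l) (by omega : 0 < d) hc
  · have e1 : y ^ c * z ^ l = x ^ e * (s ^ 0 * y ^ 0 * z ^ (l + 1)) + s ^ 1 * y ^ 0 * z ^ l := by
      rw [h.rel_z]; ring
    rw [e1]
    exact add_mem (pow_mul_mem _ (monomial_mem (by omega) hm)) (monomial_mem (by omega) hm)

theorem s_pow_mem (h : IsDanielewski n e d m f x s y z ρ) (hd : 2 ≤ d) {b c l : ℕ}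
    (hb : b ≤ d) (hc : c < m) : s ^ b * y ^ c * z ^ l ∈ normalForms k d m x s y z := by
  rcases hb.lt_or_eq with hb | rfl
  · exact monomial_mem hb hc
  · have e1 : s ^ b * y ^ c * z ^ l = x ^ n * (y ^ (c + 1) * z ^ l) -
        ∑ i ∈ Finset.range b, Polynomial.aeval x (f i) * (s ^ i * y ^ c * z ^ l) := by
      have e2 : ∑ i ∈ Finset.range b, Polynomial.aeval x (f i) * (s ^ i * y ^ c * z ^ l) =
          (∑ i ∈ Finset.range b, Polynomial.aeval x (f i) * s ^ i) * (y ^ c * z ^ l) := by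
        rw [Finset.sum_mul]
        exact Finset.sum_congr rfl fun i _ => by ring
      rw [e2]
      linear_combination (-(y ^ c * z ^ l)) * h.rel_y
    rw [e1]
    exact sub_mem (pow_mul_mem _ (h.y_pow_mem hd (by omega) hc))
      (sum_mem fun i hi => aeval_mul_mem _ (monomial_mem (Finset.mem_range.1 hi) hc))

theorem span_normalMonomial (h : IsDanielewski n e d m f x s y z ρ) (hd : 2 ≤ d) (hm : 1 ≤ m) :
    normalForms k d m x s y z = ⊤ := by
  have hstep : ∀ t : A, (∀ q, t * normalMonomial d m s y z q ∈ normalForms k d m x s y z) →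
      ∀ r ∈ normalForms k d m x s y z, t * r ∈ normalForms k d m x s y z := by
    intro t ht r hr
    induction hr using Submodule.span_induction with
    | mem r hr =>
      obtain ⟨q, rfl⟩ := hr
      exact ht q
    | zero => rw [mul_zero]; exact zero_mem _
    | add a b _ _ ha hb => rw [mul_add]; exact add_mem ha hb
    | smul c a _ ha => rw [mul_smul_comm]; exact Submodule.smul_mem _ _ ha
  have hall : ∀ t : A, ∀ r ∈ normalForms k d m x s y z, t * r ∈ normalForms k d m x s y z := by
    intro t
    have ht : t ∈ Algebra.adjoin k {x, s, y, z} := h.adjoin_eq_top ▸ Algebra.mem_top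
    induction ht using Algebra.adjoin_induction with
    | mem t ht =>
      intro r hr
      rcases ht with rfl | rfl | rfl | rfl
      · simpa using pow_mul_mem 1 hr
      · refine hstep _ (fun q => ?_) r hr
        rw [normalMonomial, ← mul_assoc, ← mul_assoc, ← pow_succ']
        exact h.s_pow_mem hd (Nat.mod_lt _ (by omega)) (Nat.mod_lt _ hm)
      · refine hstep _ (fun q => ?_) r hr
        have hb : q % d < d := Nat.mod_lt _ (by omega)
        rw [normalMonomial]
        rcases (Nat.succ_le_of_lt (Nat.mod_lt (q / d) hm)).lt_or_eq with hc | hc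
        · convert monomial_mem (x := x) (s := s) (y := t) (z := z) (l := q / d / m) hb hc using 1
          rw [Nat.succ_eq_add_one]
          ring
        · have e1 : t * (s ^ (q % d) * t ^ (q / d % m) * z ^ (q / d / m)) =
              x ^ e * (s ^ (q % d) * t ^ 0 * z ^ (q / d / m + 1)) +
                s ^ (q % d + 1) * t ^ 0 * z ^ (q / d / m) := by
            have hz := h.rel_z
            rw [← hc, Nat.succ_eq_add_one] at hz
            linear_combination s ^ (q % d) * z ^ (q / d / m) * hz
          rw [e1]
          exact add_mem (pow_mul_mem _ (monomial_mem hb hm)) (h.s_pow_mem hd hb hm)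
      · refine hstep _ (fun q => ?_) r hr
        convert monomial_mem (x := x) (s := s) (y := y) (z := t) (l := q / d / m + 1)
          (Nat.mod_lt q (by omega : 0 < d)) (Nat.mod_lt (q / d) hm) using 1
        rw [normalMonomial]
        ring
    | algebraMap c =>
      intro r hr
      simpa using aeval_mul_mem (Polynomial.C c) hr
    | add a b _ _ ha hb => intro r hr; rw [add_mul]; exact add_mem (ha r hr) (hb r hr)
    | mul a b _ _ ha hb => intro r hr; rw [mul_assoc]; exact ha _ (hb r hr)
  refine eq_top_iff.2 fun r _ => ?_
  rw [← mul_one r]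
  refine hall r 1 ?_
  simpa using monomial_mem (x := x) (s := s) (y := y) (z := z) (b := 0) (c := 0) (l := 0)
    (by omega : 0 < d) hm

end Span

theorem map_aeval (h : IsDanielewski n e d m f x s y z ρ) (F : Polynomial k) :
    ρ (Polynomial.aeval x F) = ∑ i ∈ Finset.range (F.natDegree + 1),
      AddMonoidAlgebra.single (0, (i : ℤ)) (F.coeff i) := by
  rw [← Polynomial.aeval_algHom_apply, h.map_x, Polynomial.aeval_eq_sum_range]
  refine Finset.sum_congr rfl fun i _ => ?_
  rw [AddMonoidAlgebra.single_pow, AddMonoidAlgebra.smul_single, one_pow, smul_eq_mul, mul_one,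
    Prod.smul_mk, smul_zero, nsmul_eq_mul, mul_one]

theorem isTop_aeval (h : IsDanielewski n e d m f x s y z ρ) (F : Polynomial k) :
    IsTop (0, (F.natDegree : ℤ)) F.leadingCoeff (ρ (Polynomial.aeval x F)) := by
  have hs : F.leadingCoeff = ∑ i ∈ Finset.range (F.natDegree + 1),
      if i = F.natDegree then F.leadingCoeff else 0 := by simp
  rw [h.map_aeval, hs]
  refine IsTop.sum fun i hi => ?_
  split_ifs with hi'
  · subst hi'
    exact isTop_single _ _
  · rw [Finset.mem_range] at hi
    exact (isTop_single _ _).of_lt (Or.inr ⟨rfl, by simp only; omega⟩)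

theorem isTop_s (h : IsDanielewski n e d m f x s y z ρ) : IsTop (1, 0) 1 (ρ s) :=
  h.map_s ▸ isTop_single _ _

theorem isTop_x (h : IsDanielewski n e d m f x s y z ρ) : IsTop (0, 1) 1 (ρ x) :=
  h.map_x ▸ isTop_single _ _

theorem single_mul_map_x_pow (h : IsDanielewski n e d m f x s y z ρ) (l : ℕ) :
    AddMonoidAlgebra.single (0, -(l : ℤ)) 1 * ρ x ^ l = 1 := by
  rw [h.map_x, AddMonoidAlgebra.single_pow, AddMonoidAlgebra.single_mul_single]
  simp [AddMonoidAlgebra.one_def]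
  rfl

theorem isTop_of_pow_mul (h : IsDanielewski n e d m f x s y z ρ) {l : ℕ} {r : A} {v : ℤ × ℤ}
    (hr : IsTop v 1 (ρ (x ^ l * r))) : IsTop (v.1, v.2 - l) 1 (ρ r) := by
  have h1 := (isTop_single (0, -(l : ℤ)) (1 : k)).mul hr
  rw [map_mul, map_pow, ← mul_assoc, h.single_mul_map_x_pow, one_mul, one_mul] at h1
  convert h1 using 1
  ext <;> simp
  ring

theorem isTop_y (h : IsDanielewski n e d m f x s y z ρ) : IsTop (d, -n) 1 (ρ y) := by
  have h1 : IsTop ((d : ℤ), (0 : ℤ)) 1 (ρ (x ^ n * y)) := by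
    have h2 : (1 : k) = 1 + ∑ i ∈ Finset.range d, 0 := by simp
    rw [h.rel_y, h2, map_add, map_sum]
    refine IsTop.add ?_ (IsTop.sum fun i hi => ?_)
    · simpa using h.isTop_s.pow d
    · rw [map_mul, map_pow]
      refine ((h.isTop_aeval (f i)).mul (h.isTop_s.pow i)).of_lt (Or.inl ?_)
      simpa using hi
  simpa using h.isTop_of_pow_mul h1

theorem isTop_z (h : IsDanielewski n e d m f x s y z ρ) (hd : 2 ≤ d) (hm : 1 ≤ m) :
    IsTop (m * d, -(n * m) - e) 1 (ρ z) := by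
  have h1 : IsTop ((m * d : ℤ), (-(n * m) : ℤ)) 1 (ρ (x ^ e * z)) := by
    rw [eq_sub_of_add_eq h.rel_z.symm, sub_eq_add_neg, ← neg_one_smul k s, ← add_zero (1 : k),
      map_add, map_pow, map_smul]
    refine IsTop.add ?_ ?_
    · convert h.isTop_y.pow m using 2 <;> simp
      ring
    · have h2 := (isTop_single (0 : ℤ × ℤ) (-1 : k)).mul h.isTop_s
      have hmd : 1 < (m : ℤ) * d := by nlinarith
      convert h2.of_lt (w := ((m * d : ℤ), (-(n * m) : ℤ))) (Or.inl (by simpa using hmd)) using 1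
      rw [h.map_s, AddMonoidAlgebra.single_mul_single]
      simp
  exact h.isTop_of_pow_mul h1

theorem isTop_normalMonomial (h : IsDanielewski n e d m f x s y z ρ) (hd : 2 ≤ d) (hm : 1 ≤ m)
    (q : ℕ) : IsTop (q, -leadBound n e d m q) 1 (ρ (normalMonomial d m s y z q)) := by
  have h1 := ((h.isTop_s.pow (q % d)).mul (h.isTop_y.pow (q / d % m))).mul
    ((h.isTop_z hd hm).pow (q / d / m))
  rw [normalMonomial, map_mul, map_mul, map_pow, map_pow, map_pow]
  rw [one_mul, one_mul] at h1
  convert h1 using 1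
  have e1 := Int.emod_add_mul_ediv q d
  have e2 := Int.emod_add_mul_ediv (q / d) m
  ext
  · simp only [Prod.smul_mk, Prod.mk_add_mk]
    simp only [nsmul_eq_mul]
    push_cast
    linear_combination -e1 - d * e2
  · simp only [Prod.smul_mk, Prod.mk_add_mk]
    simp only [nsmul_eq_mul, leadBound]
    push_cast
    linear_combination n * e2

theorem exists_isTop_of_le (h : IsDanielewski n e d m f x s y z ρ) (hd : 2 ≤ d) (hm : 1 ≤ m)
    {q p : ℤ} (hq : 0 ≤ q) (hp : 0 ≤ p + leadBound n e d m q) :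
    ∃ r, IsTop (q, p) 1 (ρ r) := by
  refine ⟨x ^ (p + leadBound n e d m q).toNat * normalMonomial d m s y z q.toNat, ?_⟩
  have h1 := (h.isTop_x.pow (p + leadBound n e d m q).toNat).mul
    (h.isTop_normalMonomial hd hm q.toNat)
  rw [one_mul, Int.toNat_of_nonneg hq] at h1
  rw [map_mul, map_pow]
  convert h1 using 1
  ext <;> simp [Int.toNat_of_nonneg hp]

theorem exists_isTop (h : IsDanielewski n e d m f x s y z ρ) (hd : 2 ≤ d) (hm : 1 ≤ m) {r : A}
    (hr : r ≠ 0) : ∃ (q : ℕ) (p : ℤ) (c : k), c ≠ 0 ∧ 0 ≤ p + leadBound n e d m q ∧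
      IsTop ((q : ℤ), p) c (ρ r) ∧
      r ∈ Submodule.span (Algebra.adjoin k {x}) (normalMonomial d m s y z '' Set.Iic q) := by
  have hmem : r ∈ normalForms k d m x s y z :=
    h.span_normalMonomial hd hm ▸ Submodule.mem_top
  obtain ⟨C, rfl⟩ := (Finsupp.mem_span_range_iff_exists_finsupp).1 hmem
  have hC : C.support.Nonempty := by
    rw [Finsupp.support_nonempty_iff]
    rintro rfl
    simp at hr
  obtain ⟨q, hq, hmax⟩ := C.support.exists_max_image id hC
  simp only [id] at hmax
  choose F hF using fun i => (Algebra.adjoin_singleton_eq_range_aeval k x ▸ (C i).2 :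
    (C i : A) ∈ (Polynomial.aeval x : Polynomial k →ₐ[k] A).range)
  have hF0 : F q ≠ 0 := by
    intro h0
    have := hF q
    rw [h0] at this
    exact Finsupp.mem_support_iff.1 hq (Subtype.ext (by simpa using this.symm))
  refine ⟨q, (F q).natDegree - leadBound n e d m q, (F q).leadingCoeff,
    Polynomial.leadingCoeff_ne_zero.2 hF0, by simp, ?_, ?_⟩
  · have hs : (F q).leadingCoeff = ∑ i ∈ C.support, if i = q then (F q).leadingCoeff else 0 := by
      rw [Finset.sum_ite_eq' C.support q, if_pos hq]
    rw [hs, Finsupp.sum, map_sum]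
    refine IsTop.sum fun i hi => ?_
    have h1 := (h.isTop_aeval (F i)).mul (h.isTop_normalMonomial hd hm i)
    rw [mul_one, ← map_mul, show Polynomial.aeval x (F i) = C i from hF i] at h1
    rw [Subalgebra.smul_def, smul_eq_mul]
    split_ifs with hiq
    · subst hiq
      convert h1 using 1
      ext <;> simp [sub_eq_add_neg]
    · refine h1.of_lt (Or.inl ?_)
      have := hmax i hi
      simp
      omega
  · exact sum_mem fun i hi => Submodule.smul_mem _ _
      (Submodule.subset_span ⟨i, hmax i hi, rfl⟩)

theorem injective (h : IsDanielewski n e d m f x s y z ρ) (hd : 2 ≤ d) (hm : 1 ≤ m) :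
    Function.Injective ρ := by
  refine (injective_iff_map_eq_zero ρ).2 fun r hr => ?_
  by_contra hr0
  obtain ⟨q, p, c, hc, -, ht, -⟩ := h.exists_isTop hd hm hr0
  exact ht.ne_zero hc hr

theorem mul_map_x_pow_cancel (h : IsDanielewski n e d m f x s y z ρ) {l : ℕ} {r t : Laurent2 k}
    (hrt : ρ x ^ l * r = ρ x ^ l * t) : r = t := by
  have := congrArg (AddMonoidAlgebra.single (0, -(l : ℤ)) 1 * ·) hrt
  simpa only [← mul_assoc, h.single_mul_map_x_pow, one_mul] using this

/-- The elements at which `ρ` intertwines the derivations `D` and `E`. -/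
def intertwined (ρ : A →ₐ[k] Laurent2 k) (D : Derivation k A A)
    (E : Derivation k (Laurent2 k) (Laurent2 k)) : Subalgebra k A where
  carrier := {r | ρ (D r) = E (ρ r)}
  mul_mem' {a b} ha hb := by
    simp only [Set.mem_ofPred_eq] at ha hb ⊢
    simp only [Derivation.leibniz, smul_eq_mul, map_add, map_mul, ha, hb]
  add_mem' {a b} ha hb := by
    simp only [Set.mem_ofPred_eq] at ha hb ⊢
    simp only [map_add, ha, hb]
  algebraMap_mem' c := by
    simp only [Set.mem_ofPred_eq, AlgHom.commutes, Derivation.map_algebraMap, map_zero]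

theorem mem_intertwined_of_pow_mul (h : IsDanielewski n e d m f x s y z ρ) {D : Derivation k A A}
    {E : Derivation k (Laurent2 k) (Laurent2 k)} (hx : x ∈ intertwined ρ D E) {l : ℕ} {r : A}
    (hr : x ^ l * r ∈ intertwined ρ D E) : r ∈ intertwined ρ D E := by
  have hxl : ρ (D (x ^ l)) = E (ρ (x ^ l)) := pow_mem hx l
  have hr' : ρ (D (x ^ l * r)) = E (ρ (x ^ l * r)) := hr
  simp only [Derivation.leibniz, smul_eq_mul, map_add, map_mul, hxl, map_pow] at hr'
  exact h.mul_map_x_pow_cancel (add_right_cancel hr')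

theorem intertwined_eq_top (h : IsDanielewski n e d m f x s y z ρ) {D : Derivation k A A}
    {E : Derivation k (Laurent2 k) (Laurent2 k)} (hx : x ∈ intertwined ρ D E)
    (hs : s ∈ intertwined ρ D E) : intertwined ρ D E = ⊤ := by
  have hF : ∀ F : Polynomial k, Polynomial.aeval x F ∈ intertwined ρ D E := fun F =>
    Algebra.adjoin_le (Set.singleton_subset_iff.2 hx) (Polynomial.aeval_mem_adjoin_singleton k x)
  have hy : y ∈ intertwined ρ D E := by
    refine h.mem_intertwined_of_pow_mul hx (l := n) ?_
    rw [h.rel_y]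
    exact add_mem (pow_mem hs d) (sum_mem fun i _ => mul_mem (hF _) (pow_mem hs i))
  have hz : z ∈ intertwined ρ D E := by
    refine h.mem_intertwined_of_pow_mul hx (l := e) ?_
    rw [eq_sub_of_add_eq h.rel_z.symm]
    exact sub_mem (pow_mem hy m) hs
  rw [← top_le_iff, ← h.adjoin_eq_top]
  refine Algebra.adjoin_le ?_
  rintro t (rfl | rfl | rfl | rfl) <;> assumption

/-- Every derivation of `A` extends to the vector field on Laurent polynomials that is determined by
its values at `x` and `s`. -/
theorem map_derivation (h : IsDanielewski n e d m f x s y z ρ) (D : Derivation k A A) (r : A) :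
    ρ (D r) = vectorField (AddMonoidAlgebra.single (0, -1) 1 * ρ (D x))
      (AddMonoidAlgebra.single (-1, 0) 1 * ρ (D s)) (ρ r) := by
  have key : intertwined ρ D (vectorField (AddMonoidAlgebra.single (0, -1) 1 * ρ (D x))
      (AddMonoidAlgebra.single (-1, 0) 1 * ρ (D s))) = ⊤ := by
    refine h.intertwined_eq_top ?_ ?_
    · change ρ (D x) = vectorField _ _ (ρ x)
      rw [vectorField_apply, h.map_x, weightDerivation_single, weightDerivation_single,
        mul_right_comm, AddMonoidAlgebra.single_mul_single]
      simp
      exact (one_mul _).symm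
    · change ρ (D s) = vectorField _ _ (ρ s)
      rw [vectorField_apply, h.map_s, weightDerivation_single, weightDerivation_single,
        mul_right_comm _ (ρ (D s)), AddMonoidAlgebra.single_mul_single]
      simp
      exact (one_mul _).symm
  exact (key ▸ Algebra.mem_top : r ∈ intertwined ρ D _)

theorem pow_succ_apply (D : Derivation k A A) (l : ℕ) (r : A) :
    ((D.toLinearMap : Module.End k A) ^ (l + 1)) r =
      D (((D.toLinearMap : Module.End k A) ^ l) r) := by
  rw [pow_succ']
  rfl

theorem isTop_iterate {D : Derivation k A A} {a b : Laurent2 k}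
    (hD : ∀ r, ρ (D r) = vectorField a b (ρ r)) {w : ℤ × ℤ} {α β : k} (ha : IsTop w α a)
    (hb : IsTop w β b) {v : ℤ × ℤ} {c : k} {r : A} (hr : IsTop v c (ρ r)) (l : ℕ) :
    IsTop (v + l • w)
      ((∏ t ∈ Finset.range l, (α * (v + t • w).2 + β * (v + t • w).1 : k)) * c)
      (ρ (((D.toLinearMap : Module.End k A) ^ l) r)) := by
  induction l with
  | zero => simpa using hr
  | succ l ih =>
    rw [pow_succ_apply, hD]
    convert ha.vectorField hb ih using 1
    · rw [succ_nsmul, add_assoc]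
    · rw [Finset.prod_range_succ]
      ring

theorem nonneg_of_isTop (h : IsDanielewski n e d m f x s y z ρ) (hd : 2 ≤ d) (hm : 1 ≤ m) {r : A}
    {v : ℤ × ℤ} {c : k} (hc : c ≠ 0) (hr : IsTop v c (ρ r)) :
    0 ≤ v.1 ∧ 0 ≤ v.2 + leadBound n e d m v.1 := by
  have hr0 : r ≠ 0 := by
    rintro rfl
    exact hr.ne_zero hc (map_zero ρ)
  obtain ⟨q, p, c', hc', hp, ht, -⟩ := h.exists_isTop hd hm hr0
  rw [hr.unique ht hc hc']
  exact ⟨Int.natCast_nonneg q, hp⟩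

theorem exists_orbit (h : IsDanielewski n e d m f x s y z ρ) (hd : 2 ≤ d) (hm : 1 ≤ m)
    {D : Derivation k A A} (hL : IsLND D) {a b : Laurent2 k}
    (hD : ∀ r, ρ (D r) = vectorField a b (ρ r)) {w : ℤ × ℤ} {α β : k} (ha : IsTop w α a)
    (hb : IsTop w β b) {v : ℤ × ℤ} {r : A} (hr : IsTop v 1 (ρ r)) :
    ∃ t : ℕ, (α * (v + t • w).2 + β * (v + t • w).1 : k) = 0 ∧ ∀ l ≤ t,
      0 ≤ (v + l • w).1 ∧ 0 ≤ (v + l • w).2 + leadBound n e d m (v + l • w).1 := by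
  classical
  have hex : ∃ t : ℕ, (α * (v + t • w).2 + β * (v + t • w).1 : k) = 0 := by
    obtain ⟨N, hN⟩ := hL r
    have h1 := isTop_iterate hD ha hb hr N
    rw [hN, map_zero, mul_one] at h1
    obtain ⟨t, -, ht⟩ := Finset.prod_eq_zero_iff.1 (h1.1.symm.trans (by simp))
    exact ⟨t, ht⟩
  refine ⟨Nat.find hex, Nat.find_spec hex, fun l hl => ?_⟩
  refine h.nonneg_of_isTop hd hm ?_ (isTop_iterate hD ha hb hr l)
  rw [mul_one]
  exact Finset.prod_ne_zero_iff.2 fun t ht =>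
    Nat.find_min hex (lt_of_lt_of_le (Finset.mem_range.1 ht) hl)

theorem derivation_x_eq_zero [CharZero k] (h : IsDanielewski n e d m f x s y z ρ) (hn : 1 ≤ n)
    (hne : ¬(n = 1 ∧ e = 0)) (hd : 2 ≤ d) (hm : 2 ≤ m) {D : Derivation k A A} (hL : IsLND D) :
    D x = 0 := by
  have hm1 : 1 ≤ m := by omega
  by_contra hx
  have hD := h.map_derivation D
  obtain ⟨q, p, c, hc, -, hq, -⟩ := h.exists_isTop hd hm1 hx
  have ha := (isTop_single ((0, -1) : ℤ × ℤ) (1 : k)).mul hq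
  rw [one_mul] at ha
  obtain ⟨⟨j, i⟩, α, β, hne0, hj, ha', hb'⟩ : ∃ (w : ℤ × ℤ) (α β : k), (α ≠ 0 ∨ β ≠ 0) ∧ 0 ≤ w.1 ∧
      IsTop w α (AddMonoidAlgebra.single (0, -1) 1 * ρ (D x)) ∧
      IsTop w β (AddMonoidAlgebra.single (-1, 0) 1 * ρ (D s)) := by
    by_cases hs : D s = 0
    · refine ⟨_, c, 0, Or.inl hc, ?_, ha, ?_⟩
      · simp
      · rw [hs, map_zero, mul_zero]
        exact ⟨rfl, fun _ _ => rfl⟩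
    · obtain ⟨q', p', c', hc', -, hq', -⟩ := h.exists_isTop hd hm1 hs
      have hb := (isTop_single ((-1, 0) : ℤ × ℤ) (1 : k)).mul hq'
      rw [one_mul] at hb
      obtain ⟨w, α, β, h0, hw, h1, h2⟩ := ha.exists_common hb hc hc'
      exact ⟨w, α, β, h0, le_trans (by simp) hw, h1, h2⟩
  obtain ⟨a, hax, -⟩ := h.exists_orbit hd hm1 hL hD ha' hb' h.isTop_x
  obtain ⟨b, hbs, -⟩ := h.exists_orbit hd hm1 hL hD ha' hb' h.isTop_s
  simp only [Prod.smul_mk, Prod.mk_add_mk] at hax hbs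
  simp only [nsmul_eq_mul] at hax hbs
  push_cast at hax hbs
  have hα : α = -a * (α * i + β * j) := by linear_combination hax
  have hβ : β = -b * (α * i + β * j) := by linear_combination hbs
  have hχ : α * i + β * j ≠ 0 := by
    intro h0
    rw [h0, mul_zero] at hα hβ
    exact hne0.elim (· hα) (· hβ)
  refine no_negative_weight (α := a) (β := b) hn hne hd hm hj (i := i) ?_ fun q p hq hp => ?_
  · have : ((a * i + b * j + 1 : ℤ) : k) * (α * i + β * j) = 0 := by
      push_cast
      linear_combination (i : k) * hα + j * hβ
    have := Int.cast_eq_zero.1 ((mul_eq_zero.1 this).resolve_right hχ)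
    linarith
  · obtain ⟨r, hr⟩ := h.exists_isTop_of_le hd hm1 hq hp
    obtain ⟨t, ht, hl⟩ := h.exists_orbit hd hm1 hL hD ha' hb' hr
    simp only [Prod.smul_mk, Prod.mk_add_mk] at ht
    simp only [nsmul_eq_mul] at ht
    push_cast at ht
    have h1 : (t : ℤ) = a * p + b * q := by
      have : ((t - (a * p + b * q) : ℤ) : k) * (α * i + β * j) = 0 := by
        push_cast
        linear_combination ht - p * hα - q * hβ
      have := Int.cast_eq_zero.1 ((mul_eq_zero.1 this).resolve_right hχ)
      linarith
    rw [← h1]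
    refine ⟨Int.natCast_nonneg t, fun hpos => ?_⟩
    simpa using (hl 1 (by omega)).2

theorem exists_vectorField [CharZero k] (h : IsDanielewski n e d m f x s y z ρ) (hn : 1 ≤ n)
    (hne : ¬(n = 1 ∧ e = 0)) (hd : 2 ≤ d) (hm : 2 ≤ m) {D : Derivation k A A} (hL : IsLND D)
    (h0 : D ≠ 0) : ∃ (b : Laurent2 k) (i : ℤ) (β : k), β ≠ 0 ∧ IsTop (-1, i) β b ∧
      ∀ r, ρ (D r) = vectorField 0 b (ρ r) := by
  have hm1 : 1 ≤ m := by omega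
  have hD := h.map_derivation D
  rw [h.derivation_x_eq_zero hn hne hd hm hL, map_zero, mul_zero] at hD
  have hs : D s ≠ 0 := by
    intro hs
    refine h0 (Derivation.ext fun r => h.injective hd hm1 ?_)
    rw [hD, hs, map_zero, mul_zero, vectorField_apply, zero_mul, zero_mul, zero_add,
      Derivation.zero_apply, map_zero]
  obtain ⟨q, p, c, hc, -, hq, -⟩ := h.exists_isTop hd hm1 hs
  have hb := (isTop_single ((-1, 0) : ℤ × ℤ) (1 : k)).mul hq
  rw [one_mul] at hb
  obtain ⟨t, ht, -⟩ := h.exists_orbit hd hm1 hL hD ⟨rfl, fun _ _ => rfl⟩ hb h.isTop_s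
  simp only [Prod.smul_mk, Prod.mk_add_mk] at ht
  simp only [nsmul_eq_mul] at ht
  have ht' : (1 : ℤ) + t * (-1 + q) = 0 := by
    rw [AddMonoidAlgebra.coeff_zero, Finsupp.zero_apply, zero_mul, zero_add] at ht
    exact Int.cast_eq_zero.1 ((mul_eq_zero.1 ht).resolve_left hc)
  obtain rfl : q = 0 := by
    by_contra hq0
    have : 0 ≤ (t : ℤ) * (-1 + q) := mul_nonneg (by omega) (by omega)
    omega
  exact ⟨_, 0 + p, c, hc, by simpa using hb, hD⟩

theorem eq_zero_of_degLT (h : IsDanielewski n e d m f x s y z ρ) (hd : 2 ≤ d) (hm : 1 ≤ m) {r : A}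
    (hr : DegLT 0 (ρ r)) : r = 0 := by
  by_contra h0
  obtain ⟨q, p, c, hc, -, hq, -⟩ := h.exists_isTop hd hm h0
  exact hc (hq.1.symm.trans (hr _ (Int.natCast_nonneg q)))

theorem pow_eq_zero_of_degLT (h : IsDanielewski n e d m f x s y z ρ) (hd : 2 ≤ d) (hm : 1 ≤ m)
    {D : Derivation k A A} {b : Laurent2 k} (hb : DegLT 0 b)
    (hD : ∀ r, ρ (D r) = vectorField 0 b (ρ r)) {l : ℕ} {r : A} (hr : DegLT l (ρ r)) :
    ((D.toLinearMap : Module.End k A) ^ l) r = 0 := by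
  induction l generalizing r with
  | zero => exact h.eq_zero_of_degLT hd hm hr
  | succ l ih =>
    rw [pow_succ]
    refine ih ?_
    change DegLT _ (ρ (D r))
    rw [hD]
    simpa using hb.vectorField hr

theorem pow_eq_zero_iff_degLT [CharZero k] (h : IsDanielewski n e d m f x s y z ρ) (hn : 1 ≤ n)
    (hne : ¬(n = 1 ∧ e = 0)) (hd : 2 ≤ d) (hm : 2 ≤ m) {D : Derivation k A A} (hL : IsLND D)
    (h0 : D ≠ 0) (l : ℕ) (r : A) :
    ((D.toLinearMap : Module.End k A) ^ l) r = 0 ↔ DegLT l (ρ r) := by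
  have hm1 : 1 ≤ m := by omega
  obtain ⟨b, i, β, hβ, hb, hD⟩ := h.exists_vectorField hn hne hd hm hL h0
  refine ⟨fun hr => ?_, h.pow_eq_zero_of_degLT hd hm1 (fun u hu => hb.2 u (Or.inl ?_)) hD⟩
  · rcases eq_or_ne r 0 with rfl | hr0
    · intro u _
      simp
    obtain ⟨q, p, c, hc, -, hq, -⟩ := h.exists_isTop hd hm1 hr0
    have h1 := isTop_iterate hD ⟨rfl, fun _ _ => rfl⟩ hb hq l
    rw [hr, map_zero] at h1
    obtain ⟨t, ht, ht0⟩ := Finset.prod_eq_zero_iff.1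
      ((mul_eq_zero.1 (h1.1.symm.trans (by simp))).resolve_right hc)
    simp only [AddMonoidAlgebra.coeff_zero, Finsupp.zero_apply, zero_mul, zero_add, Prod.smul_mk,
      Prod.mk_add_mk] at ht0
    have ht1 := Int.cast_eq_zero.1 ((mul_eq_zero.1 ht0).resolve_left hβ)
    rw [nsmul_eq_mul] at ht1
    rw [Finset.mem_range] at ht
    exact fun u hu => hq.2 u (Or.inl (by simp only; omega))
  · omega

theorem mem_of_degLT (h : IsDanielewski n e d m f x s y z ρ) (hd : 2 ≤ d) (hm : 1 ≤ m) {l : ℕ}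
    {W : Subalgebra k A} (hx : x ∈ W) (hW : ∀ q < l, normalMonomial d m s y z q ∈ W) {r : A}
    (hr : DegLT l (ρ r)) : r ∈ W := by
  rcases eq_or_ne r 0 with rfl | hr0
  · exact zero_mem W
  obtain ⟨q, p, c, hc, -, hq, hspan⟩ := h.exists_isTop hd hm hr0
  have hql : q < l := by
    by_contra hql
    exact hc (hq.1.symm.trans (hr _ (by simp only; omega)))
  clear hq hr0 hr
  induction hspan using Submodule.span_induction with
  | mem r hr =>
    obtain ⟨i, hi, rfl⟩ := hr
    exact hW i (lt_of_le_of_lt hi hql)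
  | zero => exact zero_mem W
  | add a b _ _ ha hb => exact add_mem ha hb
  | smul c a _ ha =>
    exact mul_mem (Algebra.adjoin_le (Set.singleton_subset_iff.2 hx) c.2) ha

end IsDanielewski

/-- The elements annihilated by the `l`-th power of every locally nilpotent derivation. -/
def lndKer (k B : Type*) [CommRing k] [CommRing B] [Algebra k B] (l : ℕ) : Set B :=
  {r | ∀ D : Derivation k B B, IsLND D → ((D.toLinearMap : Module.End k B) ^ l) r = 0}

section Conj

variable {k B : Type*} [CommRing k] [CommRing B] [Algebra k B]

/-- The conjugate of a derivation by an automorphism. -/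
def conjDerivation (α : B ≃ₐ[k] B) (D : Derivation k B B) : Derivation k B B :=
  Derivation.mk' (α.symm.toLinearMap ∘ₗ D.toLinearMap ∘ₗ α.toLinearMap) fun a b => by
    simp

theorem conjDerivation_pow_apply (α : B ≃ₐ[k] B) (D : Derivation k B B) (l : ℕ) (r : B) :
    (((conjDerivation α D).toLinearMap : Module.End k B) ^ l) r =
      α.symm (((D.toLinearMap : Module.End k B) ^ l) (α r)) := by
  induction l with
  | zero => simp
  | succ l ih =>
    rw [pow_succ', pow_succ', Module.End.mul_apply, ih]
    change α.symm (D (α (α.symm _))) = _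
    rw [AlgEquiv.apply_symm_apply]
    rfl

theorem map_mem_lndKer (α : B ≃ₐ[k] B) {l : ℕ} {r : B} (hr : r ∈ lndKer k B l) :
    α r ∈ lndKer k B l := by
  intro D hD
  have h := hr (conjDerivation α D) fun a => by
    obtain ⟨N, hN⟩ := hD (α a)
    exact ⟨N, by rw [conjDerivation_pow_apply, hN, map_zero]⟩
  rw [conjDerivation_pow_apply] at h
  exact (EmbeddingLike.map_eq_zero_iff (f := α.symm)).1 h

theorem map_adjoin_lndKer (α : B ≃ₐ[k] B) (l : ℕ) :
    (Algebra.adjoin k (lndKer k B l)).map α.toAlgHom = Algebra.adjoin k (lndKer k B l) := by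
  rw [AlgHom.map_adjoin]
  congr 1
  refine Set.Subset.antisymm ?_ fun r hr => ⟨α.symm r, map_mem_lndKer α.symm hr, ?_⟩
  · rintro _ ⟨r, hr, rfl⟩
    exact map_mem_lndKer α hr
  · exact α.apply_symm_apply r

end Conj

namespace IsDanielewski

variable {k A : Type*} [Field k] [CommRing A] [Algebra k A] {n e d m : ℕ}
  {f : ℕ → Polynomial k} {x s y z : A} {ρ : A →ₐ[k] Laurent2 k}

/-- The elements that `E ∘ ρ` maps into the image of the ideal generated by `x ^ l`. -/
def preservedBy (ρ : A →ₐ[k] Laurent2 k) (E : Derivation k (Laurent2 k) (Laurent2 k)) (x : A)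
    (l : ℕ) : Subalgebra k A where
  carrier := {r | ∃ t, E (ρ r) = ρ (x ^ l * t)}
  mul_mem' := by
    rintro a b ⟨t, ht⟩ ⟨u, hu⟩
    refine ⟨a * u + b * t, ?_⟩
    rw [map_mul, Derivation.leibniz, ht, hu, smul_eq_mul, smul_eq_mul, ← map_mul, ← map_mul,
      ← map_add]
    congr 1
    ring
  add_mem' := by
    rintro a b ⟨t, ht⟩ ⟨u, hu⟩
    exact ⟨t + u, by rw [map_add, map_add, ht, hu, mul_add, map_add]⟩
  algebraMap_mem' c := ⟨0, by rw [AlgHom.commutes, Derivation.map_algebraMap, mul_zero, map_zero]⟩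

theorem preservedBy_anti {E : Derivation k (Laurent2 k) (Laurent2 k)} {l l' : ℕ} (hl : l ≤ l') :
    preservedBy ρ E x l' ≤ preservedBy ρ E x l := by
  rintro r ⟨t, ht⟩
  refine ⟨x ^ (l' - l) * t, ?_⟩
  rw [ht, ← mul_assoc, ← pow_add, Nat.add_sub_cancel' hl]

theorem mem_preservedBy_of_pow_mul (h : IsDanielewski n e d m f x s y z ρ)
    {E : Derivation k (Laurent2 k) (Laurent2 k)} (hx : E (ρ x) = 0) {j l : ℕ} {r : A}
    (hr : x ^ j * r ∈ preservedBy ρ E x (j + l)) : r ∈ preservedBy ρ E x l := by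
  obtain ⟨t, ht⟩ := hr
  refine ⟨t, h.mul_map_x_pow_cancel (l := j) ?_⟩
  rw [map_mul, Derivation.leibniz, map_pow, Derivation.leibniz_pow, hx, smul_zero, smul_zero,
    smul_zero, add_zero, smul_eq_mul] at ht
  rw [ht, ← map_pow, ← map_mul, pow_add, mul_assoc]

theorem preservedBy_eq_top (h : IsDanielewski n e d m f x s y z ρ)
    {E : Derivation k (Laurent2 k) (Laurent2 k)} (hx : E (ρ x) = 0)
    (hs : s ∈ preservedBy ρ E x (n + e)) : preservedBy ρ E x 0 = ⊤ := by
  have hx' : ∀ l, x ∈ preservedBy ρ E x l := fun l => ⟨0, by rw [hx, mul_zero, map_zero]⟩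
  have hF : ∀ (l : ℕ) (F : Polynomial k), Polynomial.aeval x F ∈ preservedBy ρ E x l := fun l F =>
    Algebra.adjoin_le (Set.singleton_subset_iff.2 (hx' l))
      (Polynomial.aeval_mem_adjoin_singleton k x)
  have hy : y ∈ preservedBy ρ E x e := by
    refine h.mem_preservedBy_of_pow_mul hx (j := n) ?_
    rw [h.rel_y]
    exact add_mem (pow_mem hs d) (sum_mem fun i _ => mul_mem (hF _ _) (pow_mem hs i))
  have hz : z ∈ preservedBy ρ E x 0 := by
    refine h.mem_preservedBy_of_pow_mul hx (j := e) ?_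
    rw [eq_sub_of_add_eq h.rel_z.symm]
    exact sub_mem (pow_mem hy m) (preservedBy_anti (Nat.le_add_left e n) hs)
  rw [← top_le_iff, ← h.adjoin_eq_top]
  refine Algebra.adjoin_le ?_
  rintro t (rfl | rfl | rfl | rfl)
  exacts [hx' 0, preservedBy_anti (Nat.zero_le _) hs, preservedBy_anti (Nat.zero_le _) hy, hz]

theorem exists_derivation (h : IsDanielewski n e d m f x s y z ρ) (hd : 2 ≤ d) (hm : 1 ≤ m)
    {E : Derivation k (Laurent2 k) (Laurent2 k)} (hE : preservedBy ρ E x 0 = ⊤) :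
    ∃ D : Derivation k A A, ∀ r, ρ (D r) = E (ρ r) := by
  have hex : ∀ r, ∃ t, ρ t = E (ρ r) := by
    intro r
    obtain ⟨t, ht⟩ := (hE ▸ Algebra.mem_top : r ∈ preservedBy ρ E x 0)
    exact ⟨t, by rw [ht, pow_zero, one_mul]⟩
  choose T hT using hex
  have hinj := h.injective hd hm
  exact ⟨Derivation.mk'
    { toFun := T
      map_add' := fun a b => hinj (by simp only [map_add, hT])
      map_smul' := fun c a => hinj (by
        simp only [map_smul, hT, RingHom.id_apply]
        exact E.map_smul c (ρ a)) }
    fun a b => hinj (by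
      simp only [LinearMap.coe_mk, AddHom.coe_mk, smul_eq_mul, map_add, map_mul, hT,
        Derivation.leibniz]), hT⟩

theorem exists_isLND (h : IsDanielewski n e d m f x s y z ρ) (hd : 2 ≤ d) (hm : 1 ≤ m) :
    ∃ D : Derivation k A A, IsLND D ∧ D ≠ 0 := by
  set b : Laurent2 k := AddMonoidAlgebra.single (-1, ((n + e : ℕ) : ℤ)) 1 with hb
  have hx : vectorField 0 b (ρ x) = 0 := by
    rw [h.map_x, vectorField_apply, weightDerivation_single, weightDerivation_single]
    simp
  have hs : vectorField 0 b (ρ s) = ρ (x ^ (n + e)) := by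
    rw [h.map_s, vectorField_apply, weightDerivation_single, weightDerivation_single, map_pow,
      h.map_x, AddMonoidAlgebra.single_pow, hb, zero_mul, zero_add,
      AddMonoidAlgebra.single_mul_single]
    simp
  obtain ⟨D, hD⟩ := h.exists_derivation hd hm
    (h.preservedBy_eq_top hx ⟨1, by rw [hs, mul_one]⟩)
  have hb0 : DegLT 0 b := by
    intro u hu
    rw [hb, AddMonoidAlgebra.coeff_single, Finsupp.single_apply, if_neg]
    rintro rfl
    simp at hu
  refine ⟨D, fun r => ?_, ?_⟩
  · rcases eq_or_ne r 0 with rfl | hr0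
    · exact ⟨0, rfl⟩
    obtain ⟨q, p, c, hc, -, hq, -⟩ := h.exists_isTop hd hm hr0
    exact ⟨q + 1, h.pow_eq_zero_of_degLT hd hm hb0 hD fun u hu =>
      hq.2 u (Or.inl (by push_cast at hu; simp only; omega))⟩
  · rintro rfl
    have h1 := h.isTop_x.pow (n + e)
    rw [← map_pow, ← hs, ← hD, Derivation.zero_apply, map_zero] at h1
    exact h1.ne_zero one_ne_zero rfl

section Invariants

variable [CharZero k]

theorem mem_lndKer_iff (h : IsDanielewski n e d m f x s y z ρ) (hn : 1 ≤ n)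
    (hne : ¬(n = 1 ∧ e = 0)) (hd : 2 ≤ d) (hm : 2 ≤ m) {l : ℕ} (hl : 1 ≤ l) (r : A) :
    r ∈ lndKer k A l ↔ DegLT l (ρ r) := by
  refine ⟨fun hr => ?_, fun hr D hL => ?_⟩
  · obtain ⟨D, hL, h0⟩ := h.exists_isLND hd (by omega)
    exact (h.pow_eq_zero_iff_degLT hn hne hd hm hL h0 l r).1 (hr D hL)
  · rcases eq_or_ne D 0 with rfl | h0
    · change ((0 : Module.End k A) ^ l) r = 0
      rw [zero_pow (by omega)]
      rfl
    · exact (h.pow_eq_zero_iff_degLT hn hne hd hm hL h0 l r).2 hr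

theorem adjoin_lndKer (h : IsDanielewski n e d m f x s y z ρ) (hn : 1 ≤ n)
    (hne : ¬(n = 1 ∧ e = 0)) (hd : 2 ≤ d) (hm : 2 ≤ m) {l : ℕ} (hl : 1 ≤ l) {G : Set A}
    (hG : ∀ r ∈ G, DegLT l (ρ r)) (hx : x ∈ G)
    (hmon : ∀ q < l, normalMonomial d m s y z q ∈ Algebra.adjoin k G) :
    Algebra.adjoin k (lndKer k A l) = Algebra.adjoin k G := by
  refine le_antisymm (Algebra.adjoin_le fun r hr => ?_) (Algebra.adjoin_mono fun r hr => ?_)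
  · exact h.mem_of_degLT hd (by omega) (Algebra.subset_adjoin hx) hmon
      ((h.mem_lndKer_iff hn hne hd hm hl r).1 hr)
  · exact (h.mem_lndKer_iff hn hne hd hm hl r).2 (hG r hr)

theorem adjoin_lndKer_one (h : IsDanielewski n e d m f x s y z ρ) (hn : 1 ≤ n)
    (hne : ¬(n = 1 ∧ e = 0)) (hd : 2 ≤ d) (hm : 2 ≤ m) :
    Algebra.adjoin k (lndKer k A 1) = Algebra.adjoin k {x} := by
  refine h.adjoin_lndKer hn hne hd hm le_rfl ?_ rfl fun q hq => ?_
  · rintro _ rfl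
    exact h.isTop_x.degLT (by simp)
  · rw [normalMonomial_of_lt (by omega), Nat.lt_one_iff.1 hq, pow_zero]
    exact one_mem _

theorem adjoin_lndKer_two (h : IsDanielewski n e d m f x s y z ρ) (hn : 1 ≤ n)
    (hne : ¬(n = 1 ∧ e = 0)) (hd : 2 ≤ d) (hm : 2 ≤ m) :
    Algebra.adjoin k (lndKer k A 2) = Algebra.adjoin k {x, s} := by
  refine h.adjoin_lndKer hn hne hd hm one_le_two ?_ (Set.mem_insert _ _) fun q hq => ?_
  · rintro _ (rfl | rfl)
    · exact h.isTop_x.degLT (by simp)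
    · exact h.isTop_s.degLT (by simp)
  · rw [normalMonomial_of_lt (by omega)]
    exact pow_mem (Algebra.subset_adjoin (by simp)) q

theorem adjoin_lndKer_succ (h : IsDanielewski n e d m f x s y z ρ) (hn : 1 ≤ n)
    (hne : ¬(n = 1 ∧ e = 0)) (hd : 2 ≤ d) (hm : 2 ≤ m) :
    Algebra.adjoin k (lndKer k A (d + 1)) = Algebra.adjoin k {x, s, y} := by
  refine h.adjoin_lndKer hn hne hd hm (by omega) ?_ (Set.mem_insert _ _) fun q hq => ?_
  · rintro _ (rfl | rfl | rfl)
    · exact h.isTop_x.degLT (by simp only; omega)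
    · exact h.isTop_s.degLT (by simp only; omega)
    · exact h.isTop_y.degLT (by simp)
  · rcases (Nat.lt_succ_iff.1 hq).lt_or_eq with hq | rfl
    · rw [normalMonomial_of_lt hq]
      exact pow_mem (Algebra.subset_adjoin (by simp)) q
    · rw [normalMonomial_self (by omega) hm]
      exact Algebra.subset_adjoin (by simp)

theorem ML_eq (h : IsDanielewski n e d m f x s y z ρ) (hn : 1 ≤ n)
    (hne : ¬(n = 1 ∧ e = 0)) (hd : 2 ≤ d) (hm : 2 ≤ m) :
    ML k A = (Algebra.adjoin k {x} : Subalgebra k A) := by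
  refine Set.Subset.antisymm (fun r hr => ?_) fun r hr D hL => ?_
  · rw [← h.adjoin_lndKer_one hn hne hd hm]
    exact Algebra.subset_adjoin fun D hL => by simpa using hr D hL
  · have hx : Set.EqOn D (0 : Derivation k A A) {x} := by
      rintro _ rfl
      exact h.derivation_x_eq_zero hn hne hd hm hL
    exact Derivation.eqOn_adjoin hx hr

theorem ALinv_eq (h : IsDanielewski n e d m f x s y z ρ) (hn : 1 ≤ n)
    (hne : ¬(n = 1 ∧ e = 0)) (hd : 2 ≤ d) (hm : 2 ≤ m) :
    ALinv k A = Algebra.adjoin k {x, s} := by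
  rw [← h.adjoin_lndKer_two hn hne hd hm, ALinv]
  congr 1
  ext r
  rw [h.mem_lndKer_iff hn hne hd hm one_le_two]
  constructor
  · rintro ⟨D, hL, h0, hr⟩
    exact (h.pow_eq_zero_iff_degLT hn hne hd hm hL h0 2 r).1 hr
  · intro hr
    obtain ⟨D, hL, h0⟩ := h.exists_isLND hd (by omega)
    exact ⟨D, hL, h0, (h.pow_eq_zero_iff_degLT hn hne hd hm hL h0 2 r).2 hr⟩

end Invariants

end IsDanielewski

section Presentation

variable {k : Type*} [Field k] {A : Type*} [CommRing A] [Algebra k A]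

theorem adjoin_of_surjective {φ : MvPolynomial (Fin 3) k →ₐ[k] A} (hφ : Function.Surjective φ) :
    Algebra.adjoin k {φ (X 0), φ (X 1), φ (X 2)} = ⊤ := by
  rw [← (AlgHom.range_eq_top φ).2 hφ, ← Algebra.map_top, ← MvPolynomial.adjoin_range_X,
    AlgHom.map_adjoin]
  congr 1
  ext r
  simp [Fin.exists_fin_succ, eq_comm]

theorem map_Pat (φ : MvPolynomial (Fin 3) k →ₐ[k] A) (d : ℕ) (f : ℕ → Polynomial k)
    (T : MvPolynomial (Fin 3) k) :
    φ (Pat k d f T) =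
      φ T ^ d + ∑ i ∈ Finset.range d, Polynomial.aeval (φ (X 0)) (f i) * φ T ^ i := by
  simp only [Pat, map_add, map_pow, map_sum, map_mul, Polynomial.aeval_algHom_apply]

theorem exists_isDanielewski_RRing (n e d m : ℕ) (f g : ℕ → Polynomial k) (hg : ∀ j, g j = 0) :
    ∃ ρ : RRing k n e d m f g →ₐ[k] Laurent2 k,
      IsDanielewski n e d m f (xel k n e d m f g) (sel k n e d m f g) (yel k n e d m f g)
        (zel k n e d m f g) ρ := by
  have hQ : Qpoly k m g = X 1 ^ m := by simp [Qpoly, hg]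
  let π : MvPolynomial (Fin 3) k →ₐ[k] RRing k n e d m f g :=
    Ideal.Quotient.mkₐ k (RIdeal k n e d m f g)
  have hπ : Function.Surjective π := Ideal.Quotient.mkₐ_surjective k _
  have hrel : π (X 0 ^ n * X 1 - Pat k d f (Qpoly k m g - X 0 ^ e * X 2)) = 0 :=
    Ideal.Quotient.eq_zero_iff_mem.2 (Ideal.subset_span rfl)
  let xL : Laurent2 k := AddMonoidAlgebra.single (0, 1) 1
  let sL : Laurent2 k := AddMonoidAlgebra.single (1, 0) 1
  have hinv : ∀ l : ℕ, xL ^ l * AddMonoidAlgebra.single (0, -(l : ℤ)) 1 = 1 := by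
    intro l
    rw [AddMonoidAlgebra.single_pow, AddMonoidAlgebra.single_mul_single]
    simp
    rfl
  let yL : Laurent2 k := AddMonoidAlgebra.single (0, -(n : ℤ)) 1 *
    (sL ^ d + ∑ i ∈ Finset.range d, Polynomial.aeval xL (f i) * sL ^ i)
  let φ : MvPolynomial (Fin 3) k →ₐ[k] Laurent2 k :=
    MvPolynomial.aeval ![xL, yL, AddMonoidAlgebra.single (0, -(e : ℤ)) 1 * (yL ^ m - sL)]
  have hX0 : φ (X 0) = xL := by simp [φ]
  have hX1 : φ (X 1) = yL := by simp [φ]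
  have hX2 : φ (X 2) = AddMonoidAlgebra.single (0, -(e : ℤ)) 1 * (yL ^ m - sL) := by simp [φ]
  have hS : φ (Qpoly k m g - X 0 ^ e * X 2) = sL := by
    rw [hQ, map_sub, map_mul, map_pow, map_pow, hX0, hX1, hX2, ← mul_assoc, hinv]
    ring
  have hφ : ∀ a ∈ RIdeal k n e d m f g, φ a = 0 := by
    intro a ha
    refine (Ideal.span_le (I := RingHom.ker φ)).2 ?_ ha
    rintro _ rfl
    change φ _ = 0
    rw [map_sub, map_Pat, hS, map_mul, map_pow, hX0, hX1, ← mul_assoc, hinv, one_mul, sub_self]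
  refine ⟨(Ideal.Quotient.liftₐ (RIdeal k n e d m f g) φ hφ :
    (MvPolynomial (Fin 3) k ⧸ RIdeal k n e d m f g) →ₐ[k] Laurent2 k), ?_, ?_, ?_, hX0, hS⟩
  · rw [← top_le_iff, ← adjoin_of_surjective hπ]
    refine Algebra.adjoin_mono ?_
    rintro _ (rfl | rfl | rfl)
    exacts [Or.inl rfl, Or.inr (Or.inr (Or.inl rfl)), Or.inr (Or.inr (Or.inr rfl))]
  · rw [map_sub, map_Pat, map_mul, map_pow] at hrel
    exact sub_eq_zero.1 hrel
  · change π (X 1) ^ m = π (X 0) ^ e * π (X 2) + π (Qpoly k m g - X 0 ^ e * X 2)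
    rw [hQ, map_sub, map_mul, map_pow, map_pow]
    ring

theorem IsDanielewski.nonempty_algEquiv_DanRing {n e d m : ℕ} {f : ℕ → Polynomial k} {x s y z : A}
    {ρ : A →ₐ[k] Laurent2 k} (h : IsDanielewski n e d m f x s y z ρ) (hd : 2 ≤ d) :
    Nonempty (Algebra.adjoin k {x, s, y} ≃ₐ[k] DanRing k n d f) := by
  let π : MvPolynomial (Fin 3) k →ₐ[k] DanRing k n d f := Ideal.Quotient.mkₐ k (DanIdeal k n d f)
  have hπ : Function.Surjective π := Ideal.Quotient.mkₐ_surjective k _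
  have hrel : π (X 0 ^ n * X 2 - Pat k d f (X 1)) = 0 :=
    Ideal.Quotient.eq_zero_iff_mem.2 (Ideal.subset_span rfl)
  let φ : MvPolynomial (Fin 3) k →ₐ[k] A := MvPolynomial.aeval ![x, s, y]
  have hX0 : φ (X 0) = x := by simp [φ]
  have hX1 : φ (X 1) = s := by simp [φ]
  have hX2 : φ (X 2) = y := by simp [φ]
  have hφ : ∀ a ∈ DanIdeal k n d f, φ a = 0 := by
    intro a ha
    refine (Ideal.span_le (I := RingHom.ker φ)).2 ?_ ha
    rintro _ rfl
    change φ _ = 0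
    rw [map_sub, map_Pat, map_mul, map_pow, hX0, hX1, hX2, h.rel_y, sub_self]
  let ψ : DanRing k n d f →ₐ[k] A := (Ideal.Quotient.liftₐ (DanIdeal k n d f) φ hφ :
    (MvPolynomial (Fin 3) k ⧸ DanIdeal k n d f) →ₐ[k] A)
  have hψ : ∀ p, ψ (π p) = φ p := fun _ => rfl
  have hDan : IsDanielewski n 0 d 1 f (π (X 0)) (π (X 1)) (π (X 2)) (π (X 2) - π (X 1))
      (ρ.comp ψ) := by
    refine ⟨?_, ?_, ?_, ?_, ?_⟩
    · rw [← top_le_iff, ← adjoin_of_surjective hπ]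
      refine Algebra.adjoin_mono ?_
      rintro _ (rfl | rfl | rfl)
      exacts [Or.inl rfl, Or.inr (Or.inl rfl), Or.inr (Or.inr (Or.inl rfl))]
    · rw [map_sub, map_Pat, map_mul, map_pow] at hrel
      exact sub_eq_zero.1 hrel
    · ring
    · rw [AlgHom.comp_apply, hψ, hX0, h.map_x]
    · rw [AlgHom.comp_apply, hψ, hX1, h.map_s]
  have hinj : Function.Injective ψ := fun a b hab =>
    hDan.injective hd le_rfl (congrArg ρ hab)
  have hrange : ψ.range = Algebra.adjoin k {x, s, y} := by
    rw [← Algebra.map_top, ← adjoin_of_surjective hπ, AlgHom.map_adjoin]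
    simp only [Set.image_insert_eq, Set.image_singleton, hψ, hX0, hX1, hX2]
  exact ⟨(Subalgebra.equivOfEq _ _ hrange.symm).trans (AlgEquiv.ofInjective ψ hinj).symm⟩

end Presentation

theorem stmt14 {k : Type*} [Field k] [CharZero k]
    (n e d m : ℕ) (hn : 1 ≤ n) (hne : ¬(n = 1 ∧ e = 0)) (hd : 2 ≤ d) (hm : 2 ≤ m)
    (f : ℕ → Polynomial k)
    -- the coefficient of `S^{d-1}` in `P` vanishes
    (hf : f (d - 1) = 0)
    -- `R_{n,e,P} = R_{n,e,P,Y^m}`, i.e. `Q(X,Y) = Y^m`: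
    (g : ℕ → Polynomial k) (hg : ∀ j, g j = 0) :
    -- identification of the invariant subalgebras
    ML k (RRing k n e d m f g) =
      ((Algebra.adjoin k {xel k n e d m f g} : Subalgebra k (RRing k n e d m f g)) :
        Set (RRing k n e d m f g)) ∧
    ALinv k (RRing k n e d m f g) =
      Algebra.adjoin k {xel k n e d m f g, sel k n e d m f g} ∧
    Nonempty ((Algebra.adjoin k
        {xel k n e d m f g, sel k n e d m f g, yel k n e d m f g}) ≃ₐ[k] DanRing k n d f) ∧
    -- every `k`-automorphism of `R` restricts to automorphisms of `k[x,s,y]`,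
    -- `k[x,s]` and `k[x]`
    ∀ α : RRing k n e d m f g ≃ₐ[k] RRing k n e d m f g,
      (Algebra.adjoin k {xel k n e d m f g, sel k n e d m f g, yel k n e d m f g}).map
          α.toAlgHom =
        Algebra.adjoin k {xel k n e d m f g, sel k n e d m f g, yel k n e d m f g} ∧
      (Algebra.adjoin k {xel k n e d m f g, sel k n e d m f g}).map α.toAlgHom =
        Algebra.adjoin k {xel k n e d m f g, sel k n e d m f g} ∧
      (Algebra.adjoin k {xel k n e d m f g}).map α.toAlgHom =
        Algebra.adjoin k {xel k n e d m f g} := by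
  obtain ⟨ρ, h⟩ := exists_isDanielewski_RRing n e d m f g hg
  refine ⟨h.ML_eq hn hne hd hm, h.ALinv_eq hn hne hd hm, h.nonempty_algEquiv_DanRing hd,
    fun α => ⟨?_, ?_, ?_⟩⟩
  · rw [← h.adjoin_lndKer_succ hn hne hd hm]
    exact map_adjoin_lndKer α _
  · rw [← h.adjoin_lndKer_two hn hne hd hm]
    exact map_adjoin_lndKer α _
  · rw [← h.adjoin_lndKer_one hn hne hd hm]
    exact map_adjoin_lndKer α _
end

section
/- For j ∈ {1,2} let R_{n_j,e_j,P_j} := k[X,Y,Z]/⟨X^{n_j}Y − P_j(X, Y^m − X^{e_j}Z)⟩, where n_j, e_j ≥ 1, P_1(X,S) = S^{d_1} + f_{d_1−2}(X)S^{d_1−2} + ⋯ + f_0(X) and P_2(X,S) = S^{d_2} + g_{d_2−2}(X)S^{d_2−2} + ⋯ + g_0(X) with d_1, d_2, m ≥ 2. Then R_{n_1,e_1,P_1} and R_{n_2,e_2,P_2} are isomorphic as k-algebras if and only if n_1 = n_2 =: n, e_1 = e_2 =: e, d_1 = d_2 =: d, and there exist λ, μ ∈ k* such that μ^{dm} = λ^{nm}·μ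 and f_{d−i}(λX) ≡ μ^i g_{d−i}(X) (mod X^{n+e}) for every i ∈ {2,…,d}. -/
open MvPolynomial

noncomputable section

/-- The exponent of the monomial `x ^ i * s ^ j`, arranged so that a larger power of `s` comes
first, and for equal powers of `s` a smaller power of `x` comes first. -/
def expo (i j : ℤ) : ℤ ×ₗ ℤ := toLex (-j, i)

theorem expo_add (i j i' j' : ℤ) : expo i j + expo i' j' = expo (i + i') (j + j') := by
  simp only [expo, neg_add]; rfl

theorem expo_inj {i j i' j' : ℤ} : expo i j = expo i' j' ↔ i = i' ∧ j = j' := by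
  simp [expo, and_comm]

theorem expo_lt {i j i' j' : ℤ} : expo i j < expo i' j' ↔ j' < j ∨ j = j' ∧ i < i' := by
  simp [expo, Prod.Lex.toLex_lt_toLex]

theorem expo_le {i j i' j' : ℤ} : expo i j ≤ expo i' j' ↔ j' < j ∨ j = j' ∧ i ≤ i' := by
  simp [expo, Prod.Lex.toLex_le_toLex]

theorem exists_expo (v : ℤ ×ₗ ℤ) : ∃ i j, v = expo i j :=
  ⟨(ofLex v).2, -(ofLex v).1, by simp [expo]⟩

/-- Hahn series with exponents in `ℤ ×ₗ ℤ`; this field contains `k[x, x⁻¹, s, s⁻¹]`. -/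
abbrev LexSeries (k : Type*) [Zero k] := HahnSeries (ℤ ×ₗ ℤ) k

namespace LexSeries

variable {k : Type*} [Field k]

/-- The monomial `x`. -/
def x : LexSeries k := HahnSeries.single (expo 1 0) 1

/-- The monomial `s`. -/
def s : LexSeries k := HahnSeries.single (expo 0 1) 1

/-- The leading monomial of `F` is `x ^ i * s ^ j`. -/
def HasLead (F : LexSeries k) (i j : ℤ) : Prop := F.orderTop = (expo i j : ℤ ×ₗ ℤ)

/-- Every monomial of `F` is at most `x ^ i * s ^ j`. -/
def LeadLE (F : LexSeries k) (i j : ℤ) : Prop :=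
  ((expo i j : ℤ ×ₗ ℤ) : WithTop (ℤ ×ₗ ℤ)) ≤ F.orderTop

/-- Every monomial of `F` is smaller than `x ^ i * s ^ j`. -/
def LeadLT (F : LexSeries k) (i j : ℤ) : Prop :=
  ((expo i j : ℤ ×ₗ ℤ) : WithTop (ℤ ×ₗ ℤ)) < F.orderTop

variable {F G : LexSeries k} {i j i' j' : ℤ}

theorem hasLead_x : HasLead (x : LexSeries k) 1 0 := HahnSeries.orderTop_single one_ne_zero

theorem hasLead_s : HasLead (s : LexSeries k) 0 1 := HahnSeries.orderTop_single one_ne_zero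

theorem x_ne_zero : (x : LexSeries k) ≠ 0 := HahnSeries.single_ne_zero one_ne_zero

theorem s_ne_zero : (s : LexSeries k) ≠ 0 := HahnSeries.single_ne_zero one_ne_zero

theorem hasLead_algebraMap {c : k} (hc : c ≠ 0) : HasLead (algebraMap k (LexSeries k) c) 0 0 := by
  rw [HahnSeries.algebraMap_apply]
  exact HahnSeries.orderTop_single hc

theorem hasLead_one : HasLead (1 : LexSeries k) 0 0 := HahnSeries.orderTop_one

theorem HasLead.ne_zero (h : HasLead F i j) : F ≠ 0 := by
  rintro rfl
  simp [HasLead] at h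

theorem HasLead.unique (h : HasLead F i j) (h' : HasLead F i' j') : i = i' ∧ j = j' := by
  have := h.symm.trans h'
  exact expo_inj.1 (by exact_mod_cast this)

theorem exists_hasLead (h : F ≠ 0) : ∃ i j, HasLead F i j := by
  obtain ⟨i, j, hij⟩ := exists_expo (F.order)
  exact ⟨i, j, by rw [HasLead, ← hij, HahnSeries.order_eq_orderTop_of_ne_zero h]⟩

theorem HasLead.mul (h : HasLead F i j) (h' : HasLead G i' j') :
    HasLead (F * G) (i + i') (j + j') := by
  rw [HasLead, HahnSeries.orderTop_mul, h, h', ← expo_add]; rfl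

theorem HasLead.pow (h : HasLead F i j) (a : ℕ) : HasLead (F ^ a) (a * i) (a * j) := by
  induction a with
  | zero => simpa using hasLead_one
  | succ a ih =>
    rw [pow_succ]
    convert ih.mul h using 1 <;> push_cast <;> ring

theorem HasLead.of_mul (h : HasLead (F * G) (i + i') (j + j')) (h' : HasLead F i j) :
    HasLead G i' j' := by
  have hG : G ≠ 0 := fun hG => h.ne_zero (by simp [hG])
  obtain ⟨a, b, hab⟩ := exists_hasLead hG
  have := h.unique (h'.mul hab)
  obtain ⟨rfl, rfl⟩ : a = i' ∧ b = j' := by omega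
  exact hab

theorem HasLead.le (h : HasLead F i j) : LeadLE F i j := by
  rw [LeadLE, h]

theorem HasLead.lt_iff (h : HasLead F i j) : LeadLT F i' j' ↔ j < j' ∨ j' = j ∧ i' < i := by
  rw [LeadLT, h, WithTop.coe_lt_coe, expo_lt]

theorem HasLead.le_iff (h : HasLead F i j) : LeadLE F i' j' ↔ j < j' ∨ j' = j ∧ i' ≤ i := by
  rw [LeadLE, h, WithTop.coe_le_coe, expo_le]

theorem leadLE_zero : LeadLE (0 : LexSeries k) i j := by simp [LeadLE]

theorem leadLT_zero : LeadLT (0 : LexSeries k) i j := by simp [LeadLT]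

theorem LeadLE.mono (h : LeadLE F i j) (h' : j < j' ∨ j' = j ∧ i' ≤ i) : LeadLE F i' j' :=
  le_trans (WithTop.coe_le_coe.2 (expo_le.2 h')) h

theorem LeadLE.lt (h : LeadLE F i j) (h' : j < j' ∨ j' = j ∧ i' < i) : LeadLT F i' j' :=
  lt_of_lt_of_le (WithTop.coe_lt_coe.2 (expo_lt.2 h')) h

theorem LeadLE.add (h : LeadLE F i j) (h' : LeadLE G i j) : LeadLE (F + G) i j :=
  le_trans (le_min h h') HahnSeries.min_orderTop_le_orderTop_add

theorem LeadLT.add (h : LeadLT F i j) (h' : LeadLT G i j) : LeadLT (F + G) i j :=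
  lt_of_lt_of_le (lt_min h h') HahnSeries.min_orderTop_le_orderTop_add

theorem LeadLE.sum {ι : Type*} {t : Finset ι} {Φ : ι → LexSeries k}
    (h : ∀ a ∈ t, LeadLE (Φ a) i j) : LeadLE (∑ a ∈ t, Φ a) i j :=
  Finset.sum_induction _ (fun F => LeadLE F i j) (fun _ _ => LeadLE.add) leadLE_zero h

theorem LeadLT.sum {ι : Type*} {t : Finset ι} {Φ : ι → LexSeries k}
    (h : ∀ a ∈ t, LeadLT (Φ a) i j) : LeadLT (∑ a ∈ t, Φ a) i j :=
  Finset.sum_induction _ (fun F => LeadLT F i j) (fun _ _ => LeadLT.add) leadLT_zero h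

theorem LeadLE.mul (h : LeadLE F i j) (h' : LeadLE G i' j') :
    LeadLE (F * G) (i + i') (j + j') := by
  rw [LeadLE, HahnSeries.orderTop_mul, ← expo_add, WithTop.coe_add]
  exact add_le_add h h'

theorem LeadLE.pow (h : LeadLE F i j) (a : ℕ) : LeadLE (F ^ a) (a * i) (a * j) := by
  induction a with
  | zero => simpa using hasLead_one.le
  | succ a ih =>
    rw [pow_succ]
    convert ih.mul h using 1 <;> push_cast <;> ring

theorem HasLead.add_of_lt (h : HasLead F i j) (h' : LeadLT G i j) : HasLead (F + G) i j := by
  rw [HasLead, HahnSeries.orderTop_add_eq_left, h]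
  rw [h]; exact h'

theorem LeadLT.neg (h : LeadLT F i j) : LeadLT (-F) i j := by
  rw [LeadLT, HahnSeries.orderTop_neg]; exact h

theorem HasLead.sub_of_lt (h : HasLead F i j) (h' : LeadLT G i j) : HasLead (F - G) i j := by
  rw [sub_eq_add_neg]; exact h.add_of_lt h'.neg

theorem leadLE_algebraMap (c : k) : LeadLE (algebraMap k (LexSeries k) c) 0 0 := by
  rw [HahnSeries.algebraMap_apply]
  exact HahnSeries.orderTop_single_le

theorem HasLead.of_coeff_ne_zero (h : LeadLE F i j) (h' : F.coeff (expo i j) ≠ 0) :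
    HasLead F i j :=
  le_antisymm (HahnSeries.orderTop_le_of_coeff_ne_zero h') h

theorem HasLead.coeff_ne_zero (h : HasLead F i j) : F.coeff (expo i j) ≠ 0 :=
  HahnSeries.coeff_orderTop_ne h

theorem LeadLE.coeff_mul (hF : LeadLE F i j) (hG : LeadLE G i' j') :
    (F * G).coeff (expo (i + i') (j + j')) = F.coeff (expo i j) * G.coeff (expo i' j') := by
  rw [← expo_add, HahnSeries.coeff_mul, Finset.sum_eq_single (expo i j, expo i' j')]
  · rintro ⟨a, b⟩ hab hne
    simp only [Finset.mem_antidiagonal, HahnSeries.mem_support] at hab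
    have ha : expo i j ≤ a := by
      exact_mod_cast le_trans hF (HahnSeries.orderTop_le_of_coeff_ne_zero hab.1)
    have hb : expo i' j' ≤ b := by
      exact_mod_cast le_trans hG (HahnSeries.orderTop_le_of_coeff_ne_zero hab.2.1)
    exact absurd (by
      obtain ⟨h1, h2⟩ := (add_eq_add_iff_eq_and_eq ha hb).1 hab.2.2.symm
      rw [h1, h2]) hne
  · intro h
    by_cases h1 : F.coeff (expo i j) = 0
    · simp [h1]
    by_cases h2 : G.coeff (expo i' j') = 0
    · simp [h2]
    refine absurd ?_ h
    simp [h1, h2]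

/-- The derivation multiplying each monomial by an additive function of its exponent. -/
def euler (δ : ℤ ×ₗ ℤ →+ k) : Derivation k (LexSeries k) (LexSeries k) :=
  Derivation.mk'
    { toFun := fun F =>
        { coeff := fun v => δ v * F.coeff v
          isPWO_support' := F.isPWO_support.mono fun v hv hF => hv (by
            simp only [hF, mul_zero]) }
      map_add' := fun F G => by ext v; simp [mul_add]
      map_smul' := fun c F => by ext v; simp [mul_left_comm] }
    (fun F G => by
      ext v
      simp only [LinearMap.coe_mk, AddHom.coe_mk, smul_eq_mul, HahnSeries.coeff_add']
      rw [HahnSeries.coeff_mul, Pi.add_apply,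
        HahnSeries.coeff_mul_right' (s := G.support) G.isPWO_support
          (fun w hw hG => hw (by simp only [hG, mul_zero])),
        mul_comm G,
        HahnSeries.coeff_mul_left' (s := F.support) F.isPWO_support
          (fun w hw hG => hw (by simp only [hG, mul_zero])), Finset.mul_sum,
        ← Finset.sum_add_distrib]
      refine Finset.sum_congr rfl fun w hw => ?_
      rw [← (Finset.mem_antidiagonal.1 hw).2.2, map_add]
      ring)

theorem coeff_euler (δ : ℤ ×ₗ ℤ →+ k) (F : LexSeries k) (v : ℤ ×ₗ ℤ) :
    (euler δ F).coeff v = δ v * F.coeff v := rfl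

theorem LeadLE.euler (h : LeadLE F i j) (δ : ℤ ×ₗ ℤ →+ k) : LeadLE (euler δ F) i j := by
  rw [LeadLE, HahnSeries.le_orderTop_iff_forall]
  intro v hv
  rw [coeff_euler, HahnSeries.coeff_eq_zero_of_lt_orderTop (lt_of_lt_of_le hv h), mul_zero]

/-- The exponent of `x`. -/
def xExp : ℤ ×ₗ ℤ →+ k :=
  { toFun := fun v => ((ofLex v).2 : k), map_zero' := by simp, map_add' := by simp }

/-- The exponent of `s`. -/
def sExp : ℤ ×ₗ ℤ →+ k :=
  { toFun := fun v => -((ofLex v).1 : k), map_zero' := by simp,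
    map_add' := by intros; simp; ring }

@[simp] theorem xExp_expo : (xExp (expo i j) : k) = i := rfl

@[simp] theorem sExp_expo : (sExp (expo i j) : k) = j := by simp [sExp, expo]

/-- The derivation of `LexSeries k` with logarithmic derivatives `A` at `x` and `B` at `s`. -/
def logDer (A B : LexSeries k) : Derivation k (LexSeries k) (LexSeries k) :=
  A • euler xExp + B • euler sExp

theorem logDer_apply (A B F : LexSeries k) :
    logDer A B F = A * euler xExp F + B * euler sExp F := rfl

theorem euler_single (δ : ℤ ×ₗ ℤ →+ k) (v : ℤ ×ₗ ℤ) (c : k) :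
    euler δ (HahnSeries.single v c) = δ v • HahnSeries.single v c := by
  ext w
  rw [coeff_euler, HahnSeries.coeff_smul]
  by_cases h : w = v
  · rw [h]; rfl
  · simp [HahnSeries.coeff_single_of_ne h]

theorem logDer_x (A B : LexSeries k) : logDer A B x = A * x := by
  simp [logDer_apply, x, euler_single]

theorem logDer_s (A B : LexSeries k) : logDer A B s = B * s := by
  simp [logDer_apply, s, euler_single]

section

variable {A B : LexSeries k} {r₁ r₂ : ℤ}

theorem LeadLE.logDer (hA : LeadLE A r₁ r₂) (hB : LeadLE B r₁ r₂) (hF : LeadLE F i j) :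
    LeadLE (logDer A B F) (r₁ + i) (r₂ + j) :=
  (hA.mul (hF.euler _)).add (hB.mul (hF.euler _))

theorem LeadLE.coeff_logDer (hA : LeadLE A r₁ r₂) (hB : LeadLE B r₁ r₂) (hF : LeadLE F i j) :
    (LexSeries.logDer A B F).coeff (expo (r₁ + i) (r₂ + j)) =
      (A.coeff (expo r₁ r₂) * i + B.coeff (expo r₁ r₂) * j) * F.coeff (expo i j) := by
  rw [logDer_apply, HahnSeries.coeff_add, hA.coeff_mul (hF.euler _), hB.coeff_mul (hF.euler _),
    coeff_euler, coeff_euler, xExp_expo, sExp_expo]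
  ring

end

end LexSeries

theorem aevalAeval_eq_sum {k A : Type*} [CommRing k] [CommRing A] [Algebra k A] (x t : A)
    (h : Polynomial (Polynomial k)) {N : ℕ} (hN : h.natDegree < N) :
    Polynomial.aevalAeval x t h =
      ∑ i ∈ Finset.range N, Polynomial.aeval x (h.coeff i) * t ^ i := by
  conv_lhs => rw [h.as_sum_range_C_mul_X_pow' hN]
  simp

theorem map_aevalAeval {k A B : Type*} [CommRing k] [CommRing A] [CommRing B] [Algebra k A]
    [Algebra k B] (φ : A →ₐ[k] B) (x t : A) (h : Polynomial (Polynomial k)) :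
    φ (Polynomial.aevalAeval x t h) = Polynomial.aevalAeval (φ x) (φ t) h := by
  rw [aevalAeval_eq_sum _ _ _ h.natDegree.lt_succ_self,
    aevalAeval_eq_sum _ _ _ h.natDegree.lt_succ_self, map_sum]
  exact Finset.sum_congr rfl fun i _ => by
    rw [map_mul, map_pow, Polynomial.aeval_algHom_apply]

/-- The polynomial `S ^ d + f_{d-1}(X) S ^ (d-1) + ⋯ + f_0(X)` in `k[X][S]`. -/
def monicPoly {k : Type*} [Field k] (d : ℕ) (f : ℕ → Polynomial k) :
    Polynomial (Polynomial k) :=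
  Polynomial.X ^ d + ∑ i ∈ Finset.range d, Polynomial.C (f i) * Polynomial.X ^ i

theorem aevalAeval_monicPoly {k A : Type*} [Field k] [CommRing A] [Algebra k A] (x t : A)
    (d : ℕ) (f : ℕ → Polynomial k) :
    Polynomial.aevalAeval x t (monicPoly d f) =
      t ^ d + ∑ i ∈ Finset.range d, Polynomial.aeval x (f i) * t ^ i := by
  simp only [monicPoly, map_add, map_sum, map_mul, map_pow, Polynomial.aevalAeval_C,
    Polynomial.aevalAeval_Y]

theorem coeff_monicPoly {k : Type*} [Field k] (d : ℕ) (f : ℕ → Polynomial k) (i : ℕ) :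
    (monicPoly d f).coeff i = if i < d then f i else if i = d then 1 else 0 := by
  simp only [monicPoly, Polynomial.coeff_add, Polynomial.coeff_X_pow, Polynomial.finsetSum_coeff,
    Polynomial.coeff_C_mul, mul_ite, mul_one, mul_zero, Finset.sum_ite_eq, Finset.mem_range]
  split_ifs <;> first | omega | simp

namespace LexSeries

variable {k : Type*} [Field k] {ξ T : LexSeries k}

theorem leadLE_aeval (hξ : LeadLE ξ 0 0) (p : Polynomial k) :
    LeadLE (Polynomial.aeval ξ p) 0 0 := by
  rw [Polynomial.aeval_eq_sum_range]
  refine LeadLE.sum fun i _ => ?_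
  rw [Algebra.smul_def]
  simpa using (leadLE_algebraMap (p.coeff i)).mul (hξ.pow i)

theorem exists_hasLead_aeval {p : Polynomial k} (hp : p ≠ 0) :
    ∃ v : ℕ, HasLead (Polynomial.aeval (x : LexSeries k) p) v 0 ∧
      Polynomial.X ^ v ∣ p ∧ ¬ Polynomial.X ^ (v + 1) ∣ p := by
  obtain ⟨q, hpq, hq⟩ := Polynomial.exists_eq_pow_rootMultiplicity_mul_and_not_dvd p hp 0
  set v := p.rootMultiplicity 0
  simp only [map_zero, sub_zero] at hpq hq
  refine ⟨v, ?_, ⟨q, hpq⟩, ?_⟩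
  · obtain ⟨q', hq'⟩ : Polynomial.X ∣ q - Polynomial.C (q.coeff 0) := by
      simp [Polynomial.X_dvd_iff]
    have h0 : q.coeff 0 ≠ 0 := fun h => hq (Polynomial.X_dvd_iff.2 h)
    rw [sub_eq_iff_eq_add'] at hq'
    have h1 : HasLead (Polynomial.aeval (x : LexSeries k) q) 0 0 := by
      rw [hq', map_add, Polynomial.aeval_C, map_mul, Polynomial.aeval_X]
      exact (hasLead_algebraMap h0).add_of_lt ((hasLead_x.le.mul
        (leadLE_aeval (hasLead_x.le.mono (by simp)) q')).lt (by simp))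
    rw [hpq, map_mul, map_pow, Polynomial.aeval_X]
    simpa using (hasLead_x.pow v).mul h1
  · rw [hpq, pow_succ, mul_dvd_mul_iff_left (pow_ne_zero _ Polynomial.X_ne_zero)]
    exact hq

theorem leadLE_aevalAeval (hξ : LeadLE ξ 0 0) (hT : LeadLE T 0 1)
    (h : Polynomial (Polynomial k)) :
    LeadLE (Polynomial.aevalAeval ξ T h) 0 h.natDegree := by
  rw [aevalAeval_eq_sum _ _ _ h.natDegree.lt_succ_self]
  refine LeadLE.sum fun i hi => ((leadLE_aeval hξ _).mul (hT.pow i)).mono ?_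
  have := Finset.mem_range.1 hi
  simp
  omega

theorem hasLead_monicPoly (hξ : LeadLE ξ 0 0) (hT : HasLead T 0 1) (d : ℕ)
    (f : ℕ → Polynomial k) : HasLead (Polynomial.aevalAeval ξ T (monicPoly d f)) 0 d := by
  rw [aevalAeval_monicPoly]
  refine HasLead.add_of_lt (by simpa using hT.pow d) (LeadLT.sum fun i hi => ?_)
  have := Finset.mem_range.1 hi
  exact ((leadLE_aeval hξ _).mul (hT.le.pow i)).lt (by simp; omega)

theorem hasLead_aevalAeval {h : Polynomial (Polynomial k)} {v : ℤ}
    (hv : HasLead (Polynomial.aeval (x : LexSeries k) h.leadingCoeff) v 0) :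
    HasLead (Polynomial.aevalAeval (x : LexSeries k) s h) v h.natDegree := by
  rw [aevalAeval_eq_sum _ _ _ h.natDegree.lt_succ_self, Finset.sum_range_succ, add_comm]
  refine HasLead.add_of_lt (by simpa using hv.mul (hasLead_s.pow h.natDegree))
    (LeadLT.sum fun i hi => ?_)
  have := Finset.mem_range.1 hi
  exact ((leadLE_aeval (hasLead_x.le.mono (by simp)) _).mul (hasLead_s.le.pow i)).lt
    (by simp; omega)

theorem hasLead_add_pow_sub_pow [CharZero k] {F G : LexSeries k} {i j i' j' : ℤ}
    (hF : HasLead F i j) (hG : HasLead G i' j') (hj : j' < j) {m : ℕ} (hm : m ≠ 0) :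
    HasLead ((F + G) ^ m - F ^ m) ((m - 1) * i + i') ((m - 1) * j + j') := by
  have key : ∀ a : ℕ, LeadLT ((F + G) ^ a - F ^ a) (a * i) (a * j) := by
    intro a
    induction a with
    | zero => simpa using leadLT_zero
    | succ a ih =>
      have h1 : (F + G) ^ (a + 1) - F ^ (a + 1) = ((F + G) ^ a - F ^ a) * (F + G) + F ^ a * G := by
        ring
      rw [h1]
      have h2 : LeadLE (F + G) i j := (hF.add_of_lt (hG.le.lt (by omega))).le
      refine LeadLT.add ?_ ?_
      · by_cases h3 : (F + G) ^ a - F ^ a = 0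
        · rw [h3, zero_mul]; exact leadLT_zero
        obtain ⟨u, v, huv⟩ := exists_hasLead h3
        rw [huv.lt_iff] at ih
        refine (huv.le.mul h2).lt ?_
        push_cast
        rw [add_mul, add_mul, one_mul, one_mul]
        omega
      · refine ((hF.pow a).mul hG).le.lt ?_
        push_cast
        rw [add_mul, add_mul, one_mul, one_mul]
        omega
  obtain ⟨b, rfl⟩ := Nat.exists_eq_succ_of_ne_zero hm
  have hsum : (F + G) ^ (b + 1) - F ^ (b + 1) =
      (((b + 1 : ℕ) : LexSeries k) * F ^ b +
        ∑ a ∈ Finset.range (b + 1), ((F + G) ^ a - F ^ a) * F ^ (b - a)) * G := by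
    have h1 := (Commute.all (F + G) F).mul_geom_sum₂ (b + 1)
    rw [← h1, add_sub_cancel_left, mul_comm G]
    congr 1
    simp only [sub_mul, Finset.sum_sub_distrib]
    have : ∑ a ∈ Finset.range (b + 1), F ^ a * F ^ (b - a) =
        ((b + 1 : ℕ) : LexSeries k) * F ^ b := by
      rw [Finset.sum_congr rfl (g := fun _ => F ^ b), Finset.sum_const, Finset.card_range,
        nsmul_eq_mul]
      intro a ha
      rw [← pow_add]
      congr 1
      have := Finset.mem_range.1 ha
      omega
    rw [this]
    simp
  have hb : HasLead (((b + 1 : ℕ) : LexSeries k)) 0 0 := by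
    rw [← map_natCast (algebraMap k (LexSeries k))]
    exact hasLead_algebraMap (Nat.cast_ne_zero.2 (Nat.succ_ne_zero b))
  rw [Nat.succ_eq_add_one, hsum]
  refine HasLead.mul (HasLead.add_of_lt ?_ (LeadLT.sum fun a ha => ?_)) hG
  · simpa using hb.mul (hF.pow b)
  · by_cases h3 : (F + G) ^ a - F ^ a = 0
    · rw [h3, zero_mul]; exact leadLT_zero
    obtain ⟨u, v, huv⟩ := exists_hasLead h3
    have := key a
    rw [huv.lt_iff] at this
    refine (huv.mul (hF.pow (b - a))).le.lt ?_
    have hab : a ≤ b := Nat.lt_succ_iff.1 (Finset.mem_range.1 ha)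
    push_cast [hab]
    rw [add_sub_cancel_right, sub_mul, sub_mul]
    omega

end LexSeries

section Derivation

variable {k A : Type*} [CommRing k] [CommRing A] [Algebra k A]

theorem derivation_aevalAeval (D : Derivation k A A) {x : A} (hx : D x = 0) (t : A)
    (h : Polynomial (Polynomial k)) :
    D (Polynomial.aevalAeval x t h) = Polynomial.aevalAeval x t h.derivative * D t := by
  induction h using Polynomial.induction_on' with
  | add p q hp hq => simp only [map_add, hp, hq, add_mul]
  | monomial a p =>
    simp only [← Polynomial.C_mul_X_pow_eq_monomial, Polynomial.derivative_C_mul_X_pow, map_mul,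
      map_pow, Polynomial.aevalAeval_C, Polynomial.aevalAeval_Y, Derivation.leibniz,
      Derivation.map_aeval, hx, Derivation.leibniz_pow, smul_eq_mul, nsmul_eq_mul, map_natCast]
    ring

theorem isLND_iff {D : Derivation k A A} : IsLND D ↔ ∀ a, ∃ N : ℕ, D^[N] a = 0 := by
  simp only [IsLND, Module.End.pow_apply]
  rfl

theorem Derivation.iterate_eq_zero_of_le {D : Derivation k A A} {a : A} {N M : ℕ} (h : N ≤ M)
    (ha : D^[N] a = 0) : D^[M] a = 0 := by
  obtain ⟨c, rfl⟩ := Nat.exists_eq_add_of_le' h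
  rw [Function.iterate_add_apply, ha, iterate_map_zero]

theorem Derivation.iterate_mul_eq_zero (D : Derivation k A A) {N M : ℕ} {a b : A}
    (ha : D^[N] a = 0) (hb : D^[M] b = 0) : D^[N + M] (a * b) = 0 := by
  induction hL : N + M generalizing N M a b with
  | zero =>
    obtain rfl : N = 0 := by omega
    simp only [Function.iterate_zero, id_eq] at ha
    simp [ha]
  | succ L ih =>
    rcases N with _ | N
    · simp only [Function.iterate_zero, id_eq] at ha
      rw [ha, zero_mul, iterate_map_zero]
    rcases M with _ | M
    · simp only [Function.iterate_zero, id_eq] at hb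
      rw [hb, mul_zero, iterate_map_zero]
    rw [Function.iterate_succ_apply, D.leibniz, smul_eq_mul, smul_eq_mul, iterate_map_add,
      ih ha (by rwa [← Function.iterate_succ_apply]) (by omega),
      mul_comm b, ih (by rwa [← Function.iterate_succ_apply]) hb (by omega), add_zero]

/-- The elements killed by some iterate of `D`. -/
def Derivation.nilSubalgebra (D : Derivation k A A) : Subalgebra k A where
  carrier := {a | ∃ N : ℕ, D^[N] a = 0}
  mul_mem' := fun ⟨_, ha⟩ ⟨_, hb⟩ => ⟨_, D.iterate_mul_eq_zero ha hb⟩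
  add_mem' := fun ⟨N, ha⟩ ⟨M, hb⟩ => ⟨N + M, by
    rw [iterate_map_add, iterate_eq_zero_of_le (by omega) ha,
      iterate_eq_zero_of_le (by omega) hb, add_zero]⟩
  algebraMap_mem' := fun c => ⟨1, D.map_algebraMap c⟩

theorem Derivation.mem_nilSubalgebra_of_apply {D : Derivation k A A} {a : A}
    (h : D a ∈ D.nilSubalgebra) : a ∈ D.nilSubalgebra := by
  obtain ⟨N, hN⟩ := h
  exact ⟨N + 1, hN⟩

theorem aevalAeval_mem {x t : A} {S : Subalgebra k A} (hx : x ∈ S) (ht : t ∈ S)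
    (h : Polynomial (Polynomial k)) : Polynomial.aevalAeval x t h ∈ S := by
  have := map_aevalAeval S.val ⟨x, hx⟩ ⟨t, ht⟩ h
  exact this ▸ Subtype.property _

end Derivation

namespace RRing

variable {k : Type*} [Field k] {n e d m : ℕ} {f : ℕ → Polynomial k}

theorem Qpoly_zero : Qpoly k m 0 = X 1 ^ m := by simp [Qpoly]

theorem Pat_eq (T : MvPolynomial (Fin 3) k) :
    Pat k d f T = Polynomial.aevalAeval (X 0) T (monicPoly d f) :=
  (aevalAeval_monicPoly _ _ _ _).symm

/-- The quotient map `k[X,Y,Z] → R`. -/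
def mk (k : Type*) [Field k] (n e d m : ℕ) (f : ℕ → Polynomial k) :
    MvPolynomial (Fin 3) k →ₐ[k] RRing k n e d m f 0 :=
  Ideal.Quotient.mkₐ k (RIdeal k n e d m f 0)

theorem mk_surjective : Function.Surjective (mk k n e d m f) :=
  Ideal.Quotient.mk_surjective

theorem mk_eq_zero_iff {p : MvPolynomial (Fin 3) k} :
    mk k n e d m f p = 0 ↔
      X 0 ^ n * X 1 -
        Polynomial.aevalAeval (X 0) (X 1 ^ m - X 0 ^ e * X 2) (monicPoly d f) ∣ p := by
  rw [← Ideal.mem_span_singleton, ← Pat_eq, ← Qpoly_zero]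
  exact Ideal.Quotient.eq_zero_iff_mem

@[simp] theorem mk_X_zero : mk k n e d m f (X 0) = xel k n e d m f 0 := rfl

@[simp] theorem mk_X_one : mk k n e d m f (X 1) = yel k n e d m f 0 := rfl

@[simp] theorem mk_X_two : mk k n e d m f (X 2) = zel k n e d m f 0 := rfl

theorem sel_eq : sel k n e d m f 0 =
    yel k n e d m f 0 ^ m - xel k n e d m f 0 ^ e * zel k n e d m f 0 := by
  rw [sel, Qpoly_zero]
  rfl

theorem xel_pow_mul_zel : xel k n e d m f 0 ^ e * zel k n e d m f 0 =
    yel k n e d m f 0 ^ m - sel k n e d m f 0 := by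
  rw [sel_eq, sub_sub_cancel]

theorem xel_pow_mul_yel : xel k n e d m f 0 ^ n * yel k n e d m f 0 =
    Polynomial.aevalAeval (xel k n e d m f 0) (sel k n e d m f 0) (monicPoly d f) := by
  have := (mk_eq_zero_iff (k := k) (n := n) (e := e) (d := d) (m := m) (f := f)).2 dvd_rfl
  rw [map_sub, sub_eq_zero, map_aevalAeval] at this
  simpa [sel_eq] using this

theorem induction {p : RRing k n e d m f 0 → Prop} (halg : ∀ c, p (algebraMap k _ c))
    (hadd : ∀ a b, p a → p b → p (a + b)) (hmul : ∀ a b, p a → p b → p (a * b))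
    (hx : p (xel k n e d m f 0)) (hy : p (yel k n e d m f 0)) (hz : p (zel k n e d m f 0))
    (r : RRing k n e d m f 0) : p r := by
  obtain ⟨r, rfl⟩ := mk_surjective r
  induction r using MvPolynomial.induction_on with
  | C c => exact (mk k n e d m f).commutes c ▸ halg c
  | add a b ha hb => rw [map_add]; exact hadd _ _ ha hb
  | mul_X a i ha =>
    rw [map_mul]
    refine hmul _ _ ha ?_
    fin_cases i
    exacts [hx, hy, hz]

/-- The universal property of `R`. -/
def lift {A : Type*} [CommRing A] [Algebra k A] (x y z : A)
    (h : x ^ n * y = Polynomial.aevalAeval x (y ^ m - x ^ e * z) (monicPoly d f)) :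
    RRing k n e d m f 0 →ₐ[k] A :=
  Ideal.Quotient.liftₐ (RIdeal k n e d m f 0) (MvPolynomial.aeval ![x, y, z]) fun p hp => by
    rw [RIdeal, Ideal.mem_span_singleton, Pat_eq, Qpoly_zero] at hp
    obtain ⟨q, rfl⟩ := hp
    rw [map_mul, map_sub, map_aevalAeval]
    simp [h]

section lift

variable {A : Type*} [CommRing A] [Algebra k A] {x y z : A}
  (h : x ^ n * y = Polynomial.aevalAeval x (y ^ m - x ^ e * z) (monicPoly d f))

theorem lift_mk (p : MvPolynomial (Fin 3) k) :
    lift x y z h (mk k n e d m f p) = MvPolynomial.aeval ![x, y, z] p := rfl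

@[simp] theorem lift_xel : lift x y z h (xel k n e d m f 0) = x := by
  rw [← mk_X_zero, lift_mk]; simp

@[simp] theorem lift_yel : lift x y z h (yel k n e d m f 0) = y := by
  rw [← mk_X_one, lift_mk]; simp

@[simp] theorem lift_zel : lift x y z h (zel k n e d m f 0) = z := by
  rw [← mk_X_two, lift_mk]; simp

end lift

/-- There is a locally nilpotent derivation with `x ↦ 0` and `s ↦ x ^ (n + e)`. -/
theorem exists_isLND (n e d m : ℕ) (f : ℕ → Polynomial k) :
    ∃ D : Derivation k (RRing k n e d m f 0) (RRing k n e d m f 0), IsLND D ∧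
      D (xel k n e d m f 0) = 0 ∧ D (sel k n e d m f 0) = xel k n e d m f 0 ^ (n + e) := by
  set S : MvPolynomial (Fin 3) k := X 1 ^ m - X 0 ^ e * X 2 with hS
  set P' := Polynomial.aevalAeval (X 0 : MvPolynomial (Fin 3) k) S (monicPoly d f).derivative
    with hP'
  set D := mkDerivation k
    ![0, X 0 ^ e * P', (m : MvPolynomial (Fin 3) k) * X 1 ^ (m - 1) * P' - X 0 ^ n] with hD
  have h0 : D (X 0) = 0 := by rw [hD, mkDerivation_X]; rfl
  have h1 : D (X 1) = X 0 ^ e * P' := by rw [hD, mkDerivation_X]; rfl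
  have h2 : D (X 2) = (m : MvPolynomial (Fin 3) k) * X 1 ^ (m - 1) * P' - X 0 ^ n := by
    rw [hD, mkDerivation_X]; rfl
  have hDS : D S = X 0 ^ (n + e) := by
    simp only [hS, map_sub, Derivation.leibniz, Derivation.leibniz_pow, h0, h1, h2, smul_eq_mul,
      nsmul_eq_mul]
    ring
  have hDF : D (X 0 ^ n * X 1 - Polynomial.aevalAeval (X 0) S (monicPoly d f)) = 0 := by
    rw [map_sub, derivation_aevalAeval D h0, ← hP', hDS]
    simp only [Derivation.leibniz, Derivation.leibniz_pow, h0, h1, smul_eq_mul, nsmul_eq_mul]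
    ring
  have hker : ∀ p, mk k n e d m f p = 0 → mk k n e d m f (D p) = 0 := by
    intro p hp
    rw [mk_eq_zero_iff] at hp ⊢
    obtain ⟨q, rfl⟩ := hp
    rw [D.leibniz, hDF, smul_zero, add_zero]
    exact dvd_mul_right _ _
  set E := Derivation.liftOfSurjective mk_surjective hker with hE
  have hmk : ∀ p, E (mk k n e d m f p) = mk k n e d m f (D p) := fun p =>
    Derivation.liftOfSurjective_apply _ _ _
  have hEx : E (xel k n e d m f 0) = 0 := by rw [← mk_X_zero, hmk, h0, map_zero]
  have hs : mk k n e d m f S = sel k n e d m f 0 := by simp [hS, sel_eq]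
  have hEs : E (sel k n e d m f 0) = xel k n e d m f 0 ^ (n + e) := by
    rw [← hs, hmk, hDS, map_pow, mk_X_zero]
  refine ⟨E, isLND_iff.2 ?_, hEx, hEs⟩
  have hx : xel k n e d m f 0 ∈ E.nilSubalgebra := ⟨1, hEx⟩
  have hs' : sel k n e d m f 0 ∈ E.nilSubalgebra :=
    E.mem_nilSubalgebra_of_apply (hEs ▸ pow_mem hx _)
  have hP : mk k n e d m f P' ∈ E.nilSubalgebra := by
    rw [hP', map_aevalAeval, hs]
    exact aevalAeval_mem hx hs' _
  have hy : yel k n e d m f 0 ∈ E.nilSubalgebra := by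
    refine E.mem_nilSubalgebra_of_apply ?_
    rw [← mk_X_one, hmk, h1, map_mul, map_pow]
    exact mul_mem (pow_mem hx _) hP
  have hz : zel k n e d m f 0 ∈ E.nilSubalgebra := by
    refine E.mem_nilSubalgebra_of_apply ?_
    rw [← mk_X_two, hmk, h2, map_sub, map_mul, map_mul, map_pow, map_pow, map_natCast]
    exact sub_mem (mul_mem (mul_mem (natCast_mem _ _) (pow_mem hy _)) hP) (pow_mem hx _)
  exact fun r => induction (p := fun r => r ∈ E.nilSubalgebra) (fun c => algebraMap_mem _ c)
    (fun _ _ => add_mem) (fun _ _ => mul_mem) hx hy hz r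

end RRing

section

variable {k A : Type*} [Field k] [CommRing A] [Algebra k A]

theorem aeval_mul_mem {M : Submodule k A} {x : A} (hx : ∀ r ∈ M, x * r ∈ M) (p : Polynomial k)
    {r : A} (hr : r ∈ M) : Polynomial.aeval x p * r ∈ M := by
  induction p using Polynomial.induction_on generalizing r with
  | C a => simpa [← Algebra.smul_def] using M.smul_mem a hr
  | add p q hp hq => rw [map_add, add_mul]; exact M.add_mem (hp hr) (hq hr)
  | monomial j a ih =>
    rw [pow_succ, ← mul_assoc, map_mul, Polynomial.aeval_X, mul_assoc]
    exact ih (hx r hr)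

theorem mul_pow_eq_sub_sum (u ξ T : A) (d : ℕ) (f : ℕ → Polynomial k) :
    u * T ^ d = u * Polynomial.aevalAeval ξ T (monicPoly d f) -
      ∑ j ∈ Finset.range d, Polynomial.aeval ξ (f j) * (u * T ^ j) := by
  rw [aevalAeval_monicPoly, mul_add, Finset.mul_sum, eq_sub_iff_add_eq]
  congr 1
  exact Finset.sum_congr rfl fun j _ => by ring

end

namespace RRing

variable {k : Type*} [Field k] {n e d m : ℕ} {f : ℕ → Polynomial k}

/-- The elements `x ^ i * z ^ c * s ^ a * y ^ b` of `R`; those with `a < d` and `b < m` form a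
basis. -/
def monom (k : Type*) [Field k] (n e d m : ℕ) (f : ℕ → Polynomial k) (v : ℕ × ℕ × ℕ × ℕ) :
    RRing k n e d m f 0 :=
  xel k n e d m f 0 ^ v.1 * zel k n e d m f 0 ^ v.2.1 * sel k n e d m f 0 ^ v.2.2.1 *
    yel k n e d m f 0 ^ v.2.2.2

/-- The index set of the basis of `R`. -/
def basisIndex (d m : ℕ) : Set (ℕ × ℕ × ℕ × ℕ) := {v | v.2.2.1 < d ∧ v.2.2.2 < m}

theorem span_monom_eq_top (hd : 1 ≤ d) (hm : 2 ≤ m) :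
    Submodule.span k (monom k n e d m f '' basisIndex d m) = ⊤ := by
  set M := Submodule.span k (monom k n e d m f '' basisIndex d m) with hM
  have hmem : ∀ i c a b, a < d → b < m → monom k n e d m f (i, c, a, b) ∈ M :=
    fun i c a b ha hb => Submodule.subset_span ⟨_, ⟨ha, hb⟩, rfl⟩
  have step : ∀ t, (∀ i c a b, a < d → b < m → t * monom k n e d m f (i, c, a, b) ∈ M) →
      ∀ r ∈ M, t * r ∈ M := by
    intro t ht r hr
    induction hr using Submodule.span_induction with
    | mem r hr =>
      obtain ⟨⟨i, c, a, b⟩, ⟨ha, hb⟩, rfl⟩ := hr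
      exact ht i c a b ha hb
    | zero => rw [mul_zero]; exact M.zero_mem
    | add _ _ _ _ h1 h2 => rw [mul_add]; exact M.add_mem h1 h2
    | smul c _ _ h => rw [mul_smul_comm]; exact M.smul_mem c h
  have hx : ∀ r ∈ M, xel k n e d m f 0 * r ∈ M := step _ fun i c a b ha hb => by
    convert hmem (i + 1) c a b ha hb using 1
    simp only [monom]; ring
  have hz : ∀ r ∈ M, zel k n e d m f 0 * r ∈ M := step _ fun i c a b ha hb => by
    convert hmem i (c + 1) a b ha hb using 1
    simp only [monom]; ring
  have hs0 : ∀ i c a, a ≤ d → monom k n e d m f (i, c, a, 0) ∈ M := by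
    intro i c a ha
    rcases ha.lt_or_eq with ha | rfl
    · exact hmem _ _ _ _ ha (by omega)
    have h1 : monom k n e a m f (i, c, a, 0) =
        monom k n e a m f (i + n, c, 0, 1) - ∑ j ∈ Finset.range a,
          Polynomial.aeval (xel k n e a m f 0) (f j) * monom k n e a m f (i, c, j, 0) := by
      have h3 : monom k n e a m f (i + n, c, 0, 1) = xel k n e a m f 0 ^ i *
          zel k n e a m f 0 ^ c * (xel k n e a m f 0 ^ n * yel k n e a m f 0) := by
        simp only [monom]; ring
      rw [h3, xel_pow_mul_yel]
      simp only [monom, pow_zero, mul_one]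
      exact mul_pow_eq_sub_sum _ _ _ _ _
    rw [h1]
    exact M.sub_mem (hmem _ _ _ _ (by omega) (by omega)) (M.sum_mem fun j hj =>
      aeval_mul_mem hx _ (hmem _ _ _ _ (Finset.mem_range.1 hj) (by omega)))
  have hy : ∀ r ∈ M, yel k n e d m f 0 * r ∈ M := step _ fun i c a b ha hb => by
    by_cases hb' : b + 1 < m
    · convert hmem i c a (b + 1) ha hb' using 1
      simp only [monom]; ring
    obtain rfl : m = b + 1 := by omega
    have h1 : yel k n e d (b + 1) f 0 * monom k n e d (b + 1) f (i, c, a, b) =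
        monom k n e d (b + 1) f (i, c, a + 1, 0) +
          monom k n e d (b + 1) f (i + e, c + 1, a, 0) := by
      have h2 := xel_pow_mul_zel (k := k) (n := n) (e := e) (d := d) (m := b + 1) (f := f)
      rw [eq_sub_iff_add_eq] at h2
      calc _ = xel k n e d (b + 1) f 0 ^ i * zel k n e d (b + 1) f 0 ^ c *
            sel k n e d (b + 1) f 0 ^ a * yel k n e d (b + 1) f 0 ^ (b + 1) := by
              simp only [monom]; ring
        _ = _ := by rw [← h2]; simp only [monom]; ring
    rw [h1]
    exact M.add_mem (hs0 _ _ _ ha) (hs0 _ _ _ ha.le)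
  have h1 : (1 : RRing k n e d m f 0) ∈ M := by
    convert hmem 0 0 0 0 (by omega) (by omega) using 1
    simp [monom]
  rw [eq_top_iff]
  intro r _
  have key : ∀ r : RRing k n e d m f 0, ∀ r' ∈ M, r * r' ∈ M := by
    intro r
    refine induction (p := fun r => ∀ r' ∈ M, r * r' ∈ M) ?_ ?_ ?_ hx hy hz r
    · intro c r' hr'
      rw [← Algebra.smul_def]
      exact M.smul_mem c hr'
    · intro a b ha hb r' hr'
      rw [add_mul]
      exact M.add_mem (ha _ hr') (hb _ hr')
    · intro a b ha hb r' hr'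
      rw [mul_assoc]
      exact ha _ (hb _ hr')
  simpa using key r 1 h1

theorem embed_rel (n e d m : ℕ) (f : ℕ → Polynomial k) (y : LexSeries k)
    (hy : y = (LexSeries.x ^ n)⁻¹ * Polynomial.aevalAeval LexSeries.x LexSeries.s (monicPoly d f)) :
    LexSeries.x ^ n * y = Polynomial.aevalAeval LexSeries.x
      (y ^ m - LexSeries.x ^ e * ((LexSeries.x ^ e)⁻¹ * (y ^ m - LexSeries.s)))
      (monicPoly d f) := by
  have hx := LexSeries.x_ne_zero (k := k)
  rw [mul_inv_cancel_left₀ (pow_ne_zero _ hx), sub_sub_cancel, hy,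
    mul_inv_cancel_left₀ (pow_ne_zero _ hx)]

/-- The embedding of `R` into `k[x, x⁻¹, s]`, viewed in the field of Hahn series. -/
def embed (k : Type*) [Field k] (n e d m : ℕ) (f : ℕ → Polynomial k) :
    RRing k n e d m f 0 →ₐ[k] LexSeries k :=
  lift _ _ _ (embed_rel n e d m f _ rfl)

@[simp] theorem embed_xel : embed k n e d m f (xel k n e d m f 0) = LexSeries.x :=
  lift_xel _

@[simp] theorem embed_sel : embed k n e d m f (sel k n e d m f 0) = LexSeries.s := by
  have hx := LexSeries.x_ne_zero (k := k)
  rw [sel_eq, map_sub, map_mul, map_pow, map_pow, embed, lift_xel, lift_yel, lift_zel,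
    mul_inv_cancel_left₀ (pow_ne_zero _ hx), sub_sub_cancel]

open LexSeries

theorem hasLead_x_pow (j : ℕ) : HasLead (x ^ j : LexSeries k) j 0 := by
  convert hasLead_x.pow j using 1 <;> ring

theorem hasLead_yel : HasLead (embed k n e d m f (yel k n e d m f 0)) (-n) d := by
  have h := congrArg (embed k n e d m f) (xel_pow_mul_yel (k := k) (n := n) (e := e) (d := d)
    (m := m) (f := f))
  rw [map_mul, map_pow, map_aevalAeval, embed_xel, embed_sel] at h
  refine HasLead.of_mul (F := x ^ n) (i := n) (j := 0) ?_ (hasLead_x_pow _)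
  rw [h]
  simpa using hasLead_monicPoly (hasLead_x.le.mono (by simp)) hasLead_s d f

theorem hasLead_zel (hd : 1 ≤ d) (hm : 2 ≤ m) :
    HasLead (embed k n e d m f (zel k n e d m f 0)) (-(n * m + e)) (d * m) := by
  have h := congrArg (embed k n e d m f) (xel_pow_mul_zel (k := k) (n := n) (e := e) (d := d)
    (m := m) (f := f))
  rw [map_mul, map_pow, map_sub, map_pow, embed_xel, embed_sel] at h
  refine HasLead.of_mul (F := x ^ e) (i := e) (j := 0) ?_ (hasLead_x_pow _)
  rw [h]
  refine HasLead.sub_of_lt ?_ (hasLead_s.le.lt (Or.inl ?_))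
  · convert hasLead_yel.pow m using 1 <;> ring
  · have : ((1 * 2 : ℕ) : ℤ) ≤ (d * m : ℕ) := by exact_mod_cast Nat.mul_le_mul hd hm
    push_cast at this
    omega

theorem hasLead_monom (hd : 1 ≤ d) (hm : 2 ≤ m) (i c a b : ℕ) :
    HasLead (embed k n e d m f (monom k n e d m f (i, c, a, b)))
      (i - (n * m + e) * c - n * b) (d * m * c + a + d * b) := by
  simp only [monom, map_mul, map_pow, embed_xel, embed_sel]
  convert (((hasLead_x.pow i).mul ((hasLead_zel hd hm).pow c)).mul (hasLead_s.pow a)).mul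
    (hasLead_yel.pow b) using 1 <;> ring

theorem monom_lead_injOn (hd : 1 ≤ d) (hm : 2 ≤ m) {v w : ℕ × ℕ × ℕ × ℕ}
    (hv : v ∈ basisIndex d m) (hw : w ∈ basisIndex d m) {i j : ℤ}
    (h : HasLead (embed k n e d m f (monom k n e d m f v)) i j)
    (h' : HasLead (embed k n e d m f (monom k n e d m f w)) i j) : v = w := by
  obtain ⟨i₁, c₁, a₁, b₁⟩ := v
  obtain ⟨i₂, c₂, a₂, b₂⟩ := w
  obtain ⟨ha₁, hb₁⟩ := hv
  obtain ⟨ha₂, hb₂⟩ := hw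
  simp only at ha₁ hb₁ ha₂ hb₂
  obtain ⟨rfl, rfl⟩ := h.unique (hasLead_monom hd hm _ _ _ _)
  obtain ⟨h1, h2⟩ := h'.unique (hasLead_monom hd hm _ _ _ _)
  have h3 : d * (m * c₂ + b₂) + a₂ = d * (m * c₁ + b₁) + a₁ := by
    zify; linear_combination -h2
  have h4 : a₂ = a₁ := by
    have := congrArg (· % d) h3
    simpa [Nat.mul_add_mod, Nat.mod_eq_of_lt ha₁, Nat.mod_eq_of_lt ha₂] using this
  have h5 : m * c₂ + b₂ = m * c₁ + b₁ := Nat.eq_of_mul_eq_mul_left hd (by omega)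
  have h6 : b₂ = b₁ := by
    have := congrArg (· % m) h5
    simpa [Nat.mul_add_mod, Nat.mod_eq_of_lt hb₁, Nat.mod_eq_of_lt hb₂] using this
  have h7 : c₂ = c₁ := Nat.eq_of_mul_eq_mul_left (by omega : 0 < m) (by omega)
  subst h4 h6 h7
  have h8 : i₁ = i₂ := by omega
  rw [h8]

/-- Every nonzero element of `R` is a combination of basis elements whose leading monomials do
not exceed its own, and one of them has the same leading monomial. -/
theorem exists_expansion (hd : 1 ≤ d) (hm : 2 ≤ m) {r : RRing k n e d m f 0} (hr : r ≠ 0) :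
    ∃ (c : ℕ × ℕ × ℕ × ℕ →₀ k) (i j : ℤ), (c.support : Set _) ⊆ basisIndex d m ∧
      r = ∑ v ∈ c.support, c v • monom k n e d m f v ∧
      HasLead (embed k n e d m f r) i j ∧
      (∀ v ∈ c.support, LeadLE (embed k n e d m f (monom k n e d m f v)) i j) ∧
      ∃ v ∈ c.support, HasLead (embed k n e d m f (monom k n e d m f v)) i j := by
  have h1 : r ∈ Submodule.span k (monom k n e d m f '' basisIndex d m) := by
    rw [span_monom_eq_top hd hm]; trivial
  rw [Finsupp.mem_span_image_iff_linearCombination] at h1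
  obtain ⟨c, hc, rfl⟩ := h1
  rw [Finsupp.mem_supported] at hc
  have hsum : Finsupp.linearCombination k (monom k n e d m f) c =
      ∑ v ∈ c.support, c v • monom k n e d m f v := Finsupp.linearCombination_apply _ _
  have hne : c.support.Nonempty := by
    rw [Finsupp.support_nonempty_iff]
    rintro rfl
    exact hr (map_zero _)
  obtain ⟨v₀, hv₀, hmin⟩ := c.support.exists_min_image
    (fun v => (embed k n e d m f (monom k n e d m f v)).orderTop) hne
  have hlead : ∀ v, ∃ i j, HasLead (embed k n e d m f (monom k n e d m f v)) i j :=
    fun ⟨i, a, b, c⟩ => ⟨_, _, hasLead_monom hd hm i a b c⟩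
  obtain ⟨i, j, hij⟩ := hlead v₀
  have hmin' : ∀ v ∈ c.support, LeadLE (embed k n e d m f (monom k n e d m f v)) i j := by
    intro v hv
    rw [LeadLE, ← hij]
    exact hmin v hv
  refine ⟨c, i, j, hc, hsum, ?_, hmin', v₀, hv₀, hij⟩
  rw [hsum, ← Finset.add_sum_erase _ _ hv₀, map_add, map_sum]
  refine HasLead.add_of_lt ?_ (LeadLT.sum fun v hv => ?_)
  · rw [Algebra.smul_def, map_mul, AlgHom.commutes]
    simpa using (hasLead_algebraMap (Finsupp.mem_support_iff.1 hv₀)).mul hij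
  · obtain ⟨hne, hv⟩ := Finset.mem_erase.1 hv
    obtain ⟨i', j', hij'⟩ := hlead v
    rw [Algebra.smul_def, map_mul, AlgHom.commutes]
    refine (((leadLE_algebraMap (c v)).mul hij'.le).lt ?_)
    have h2 := hij'.le_iff.1 (hmin' v hv)
    by_contra h3
    obtain ⟨rfl, rfl⟩ : i' = i ∧ j' = j := by omega
    exact hne (monom_lead_injOn hd hm (hc hv) (hc hv₀) hij' hij)

theorem embed_injective (hd : 1 ≤ d) (hm : 2 ≤ m) :
    Function.Injective (embed k n e d m f) := by
  rw [injective_iff_map_eq_zero]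
  intro r h
  by_contra hr
  obtain ⟨-, i, j, -, -, hij, -⟩ := exists_expansion hd hm hr
  exact hij.ne_zero h

theorem isDomain (hd : 1 ≤ d) (hm : 2 ≤ m) : IsDomain (RRing k n e d m f 0) :=
  (embed_injective hd hm).isDomain (embed k n e d m f).toRingHom

theorem exists_exponents (hd : 1 ≤ d) (hm : 2 ≤ m) {r : RRing k n e d m f 0} {i j : ℤ}
    (h : HasLead (embed k n e d m f r) i j) :
    ∃ i' c a b : ℕ, a < d ∧ b < m ∧ i = i' - (n * m + e) * c - n * b ∧
      j = d * m * c + a + d * b := by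
  have hr : r ≠ 0 := by
    rintro rfl
    exact h.ne_zero (map_zero _)
  obtain ⟨c, i₁, j₁, hc, -, hij, -, ⟨i', c', a, b⟩, hv, hvl⟩ := exists_expansion hd hm hr
  obtain ⟨rfl, rfl⟩ := h.unique hij
  obtain ⟨h1, h2⟩ := hvl.unique (hasLead_monom hd hm _ _ _ _)
  exact ⟨i', c', a, b, (hc hv).1, (hc hv).2, h1, h2⟩

/-- Elements of low degree in `s` are polynomials in `x` and `s`. -/
theorem exists_eq_aevalAeval (hd : 1 ≤ d) (hm : 2 ≤ m) {r : RRing k n e d m f 0} {I : ℤ} {j : ℕ}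
    (h : LeadLE (embed k n e d m f r) I j) (hj : j < d) :
    ∃ p : Polynomial (Polynomial k), p.natDegree ≤ j ∧
      r = Polynomial.aevalAeval (xel k n e d m f 0) (sel k n e d m f 0) p := by
  by_cases hr : r = 0
  · exact ⟨0, by simp, by simp [hr]⟩
  obtain ⟨c, i₁, j₁, hc, hsum, hij, hle, -⟩ := exists_expansion hd hm hr
  rw [hij.le_iff] at h
  rw [hsum]
  refine Finset.sum_induction _ (fun r => ∃ p : Polynomial (Polynomial k), p.natDegree ≤ j ∧
    r = Polynomial.aevalAeval (xel k n e d m f 0) (sel k n e d m f 0) p) ?_ ⟨0, by simp, by simp⟩ ?_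
  · rintro _ _ ⟨p, hp, rfl⟩ ⟨q, hq, rfl⟩
    exact ⟨p + q, Polynomial.natDegree_add_le_of_degree_le hp hq, (map_add _ _ _).symm⟩
  · rintro ⟨i', c', a, b⟩ hv
    have h1 := (hasLead_monom hd hm i' c' a b).le_iff.1 (hle _ hv)
    have h2 : ((d * (m * c') + a + d * b : ℕ) : ℤ) ≤ j := by
      push_cast
      rw [← mul_assoc]
      omega
    have h3 : d * (m * c') + a + d * b < d := by omega
    have h4 : d * (m * c') < d * 1 := by omega
    have h5 : m * c' < 1 := Nat.lt_of_mul_lt_mul_left h4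
    have h6 : d * b < d * 1 := by omega
    have h7 : b < 1 := Nat.lt_of_mul_lt_mul_left h6
    obtain rfl : b = 0 := by omega
    obtain rfl : c' = 0 := by
      rcases Nat.eq_zero_or_pos c' with h | h
      · exact h
      · nlinarith
    refine ⟨Polynomial.C (c (i', 0, a, 0) • Polynomial.X ^ i') * Polynomial.X ^ a,
      (Polynomial.natDegree_C_mul_X_pow_le _ _).trans (by omega), ?_⟩
    simp [monom, Algebra.smul_def, mul_assoc]

end RRing

namespace LexSeries

theorem exists_leadLE {k : Type*} [Field k] {F G : LexSeries k} (h : F ≠ 0 ∨ G ≠ 0) :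
    ∃ i j, LeadLE F i j ∧ LeadLE G i j ∧
      (F.coeff (expo i j) ≠ 0 ∨ G.coeff (expo i j) ≠ 0) := by
  rcases le_total F.orderTop G.orderTop with hle | hle
  · have hF : F ≠ 0 := by
      rintro rfl
      simp_all
    obtain ⟨i, j, hij⟩ := exists_hasLead hF
    exact ⟨i, j, hij.le, hij.le.trans hle, Or.inl hij.coeff_ne_zero⟩
  · have hG : G ≠ 0 := by
      rintro rfl
      simp_all
    obtain ⟨i, j, hij⟩ := exists_hasLead hG
    exact ⟨i, j, hij.le.trans hle, hij.le, Or.inr hij.coeff_ne_zero⟩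

end LexSeries

namespace RRing

open LexSeries

variable {k : Type*} [Field k] {n e d m : ℕ} {f : ℕ → Polynomial k}
  {D : Derivation k (RRing k n e d m f 0) (RRing k n e d m f 0)}

theorem embed_derivation (D : Derivation k (RRing k n e d m f 0) (RRing k n e d m f 0))
    {A B : LexSeries k} (hA : A * x = embed k n e d m f (D (xel k n e d m f 0)))
    (hB : B * s = embed k n e d m f (D (sel k n e d m f 0))) (r : RRing k n e d m f 0) :
    embed k n e d m f (D r) = logDer A B (embed k n e d m f r) := by
  let S : Subalgebra k (RRing k n e d m f 0) :=
    { carrier := {r | embed k n e d m f (D r) = logDer A B (embed k n e d m f r)}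
      mul_mem' := fun {a b} (ha : _ = _) (hb : _ = _) => by
        change _ = _
        simp only [Derivation.leibniz, smul_eq_mul, map_add, map_mul, ha, hb]
      add_mem' := fun {a b} (ha : _ = _) (hb : _ = _) => by
        change _ = _
        simp only [map_add, ha, hb]
      algebraMap_mem' := fun c => by
        change _ = _
        rw [AlgHom.commutes, Derivation.map_algebraMap, Derivation.map_algebraMap, map_zero] }
  have hx : xel k n e d m f 0 ∈ S := by
    change _ = _
    rw [← hA, embed_xel, logDer_x]
  have hs : sel k n e d m f 0 ∈ S := by
    change _ = _
    rw [← hB, embed_sel, logDer_s]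
  have hcancel : ∀ j r, xel k n e d m f 0 ^ j * r ∈ S → r ∈ S := by
    intro j r h
    have h1 : _ = _ := pow_mem hx j
    have h2 : _ = _ := h
    simp only [Derivation.leibniz, smul_eq_mul, map_add, map_mul, h1, embed_xel, map_pow] at h2
    have h3 := add_right_cancel h2
    exact mul_left_cancel₀ (pow_ne_zero j x_ne_zero) h3
  have hy : yel k n e d m f 0 ∈ S := hcancel n _ <| by
    rw [xel_pow_mul_yel]
    exact aevalAeval_mem hx hs _
  have hz : zel k n e d m f 0 ∈ S := hcancel e _ <| by
    rw [xel_pow_mul_zel]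
    exact sub_mem (pow_mem hy _) hs
  exact induction (p := fun r => r ∈ S) (fun c => S.algebraMap_mem c) (fun _ _ => S.add_mem)
    (fun _ _ => S.mul_mem) hx hy hz r

/-- A nonzero locally nilpotent derivation acts on leading monomials as a shift, and the number of
shifts needed to kill a leading monomial is a linear function of its exponents. -/
theorem exists_nilpotency_weight [CharZero k] (hD : IsLND D) (hD0 : D ≠ 0) (hd : 1 ≤ d)
    (hm : 2 ≤ m) :
    ∃ (a b : ℕ) (r₁ r₂ : ℤ), a * r₁ + b * r₂ = -1 ∧
      ∀ r i j, HasLead (embed k n e d m f r) i j → 0 ≤ a * i + b * j ∧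
        (D r = 0 → a * i + b * j = 0) ∧
        (a * i + b * j ≠ 0 → HasLead (embed k n e d m f (D r)) (r₁ + i) (r₂ + j)) := by
  have hA := div_mul_cancel₀ (embed k n e d m f (D (xel k n e d m f 0))) (x_ne_zero (k := k))
  have hB := div_mul_cancel₀ (embed k n e d m f (D (sel k n e d m f 0))) (s_ne_zero (k := k))
  have hAB := embed_derivation D hA hB
  generalize embed k n e d m f (D (xel k n e d m f 0)) / x = A at hA hAB
  generalize embed k n e d m f (D (sel k n e d m f 0)) / s = B at hB hAB
  have hne : A ≠ 0 ∨ B ≠ 0 := by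
    by_contra! h
    refine hD0 (Derivation.ext fun r => embed_injective hd hm ?_)
    rw [hAB, logDer_apply, h.1, h.2]
    simp
  obtain ⟨r₁, r₂, hA', hB', hne⟩ := exists_leadLE hne
  have hcoeff : ∀ r i j, HasLead (embed k n e d m f r) i j →
      (embed k n e d m f (D r)).coeff (expo (r₁ + i) (r₂ + j)) =
        (A.coeff (expo r₁ r₂) * i + B.coeff (expo r₁ r₂) * j) *
          (embed k n e d m f r).coeff (expo i j) := fun r i j h => by
    rw [hAB, hA'.coeff_logDer hB' h.le]
  generalize A.coeff (expo r₁ r₂) = α at hne hcoeff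
  generalize B.coeff (expo r₁ r₂) = β at hne hcoeff
  have hzero : ∀ r i j, HasLead (embed k n e d m f r) i j → D r = 0 → α * i + β * j = 0 := by
    intro r i j h h0
    have h1 := hcoeff r i j h
    rw [h0, map_zero, HahnSeries.coeff_zero] at h1
    exact (mul_eq_zero.1 h1.symm).resolve_right h.coeff_ne_zero
  have hshift : ∀ r i j, HasLead (embed k n e d m f r) i j → α * i + β * j ≠ 0 →
      HasLead (embed k n e d m f (D r)) (r₁ + i) (r₂ + j) := by
    intro r i j h h0
    refine HasLead.of_coeff_ne_zero ?_ ?_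
    · rw [hAB]
      exact hA'.logDer hB' h.le
    · rw [hcoeff r i j h]
      exact mul_ne_zero h0 h.coeff_ne_zero
  have hnil : ∀ r i j, HasLead (embed k n e d m f r) i j →
      ∃ N : ℕ, α * i + β * j + N * (α * r₁ + β * r₂) = 0 := by
    intro r
    obtain ⟨M, hM⟩ := isLND_iff.1 hD r
    induction M generalizing r with
    | zero =>
      intro i j h
      exact absurd (by rw [show r = 0 from hM, map_zero]) h.ne_zero
    | succ M ih =>
      intro i j h
      by_cases h0 : α * i + β * j = 0
      · exact ⟨0, by simpa using h0⟩
      · obtain ⟨N, hN⟩ := ih (D r) hM _ _ (hshift r i j h h0)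
        refine ⟨N + 1, ?_⟩
        push_cast at hN ⊢
        linear_combination hN
  obtain ⟨a, ha⟩ := hnil (xel k n e d m f 0) 1 0 (by rw [embed_xel]; exact hasLead_x)
  obtain ⟨b, hb⟩ := hnil (sel k n e d m f 0) 0 1 (by rw [embed_sel]; exact hasLead_s)
  generalize hρ : α * r₁ + β * r₂ = ρ at ha hb hnil
  push_cast at ha hb
  have hα : α = -(a * ρ) := by linear_combination ha
  have hβ : β = -(b * ρ) := by linear_combination hb
  have hρ0 : ρ ≠ 0 := by
    rintro rfl
    simp [hα, hβ] at hne
  have hval : ∀ i j : ℤ, α * i + β * j = -(((a * i + b * j : ℤ) : k) * ρ) := by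
    intro i j
    rw [hα, hβ]
    push_cast
    ring
  refine ⟨a, b, r₁, r₂, ?_, fun r i j h => ⟨?_, fun h0 => ?_, fun h0 => ?_⟩⟩
  · have h1 := hval r₁ r₂
    rw [hρ] at h1
    have h2 : ((a * r₁ + b * r₂ + 1 : ℤ) : k) * ρ = 0 := by
      push_cast at h1 ⊢
      linear_combination h1
    have h3 := (mul_eq_zero.1 h2).resolve_right hρ0
    have h4 : (a * r₁ + b * r₂ + 1 : ℤ) = 0 := by exact_mod_cast h3
    omega
  · obtain ⟨N, hN⟩ := hnil r i j h
    rw [hval] at hN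
    have h2 : ((N - (a * i + b * j) : ℤ) : k) * ρ = 0 := by
      push_cast at hN ⊢
      linear_combination hN
    have h3 := (mul_eq_zero.1 h2).resolve_right hρ0
    have h4 : (N - (a * i + b * j) : ℤ) = 0 := by exact_mod_cast h3
    omega
  · have h1 := hzero r i j h h0
    rw [hval, neg_eq_zero] at h1
    exact_mod_cast (mul_eq_zero.1 h1).resolve_right hρ0
  · refine hshift r i j h ?_
    rw [hval]
    exact neg_ne_zero.2 (mul_ne_zero (by exact_mod_cast h0) hρ0)

/-- If the leading monomial `x ^ i * z ^ c * s ^ a * y ^ b` of an element of the kernel is not a power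
of `x`, then no weight as in `exists_nilpotency_weight` is compatible with the leading monomials of
`R`. -/
theorem no_weight {n e d m α β ly lz a b c : ℕ} {r₁ r₂ : ℤ} (hn : 1 ≤ n) (he : 1 ≤ e)
    (hd : 2 ≤ d) (hm : 2 ≤ m)
    (hcab : c ≠ 0 ∨ a ≠ 0 ∨ b ≠ 0) (hc : c * lz = 0) (ha : a * β = 0) (hb : b * ly = 0)
    (hy : ly + n * α = d * β) (hz : lz + (n * m + e) * α = d * m * β)
    (hr : α * r₁ + β * r₂ = -1)
    (hs : (α * 0 + β * 1 : ℤ) ≠ 0 → ∃ i c a b : ℕ, a < d ∧ b < m ∧ r₂ + 1 = d * m * c + a + d * b ∧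
        (α * 0 + β * 1 : ℤ) = (i * α + c * lz + a * β + b * ly : ℕ) + 1)
    (hx : (α * 1 + β * 0 : ℤ) ≠ 0 → ∃ i c a b : ℕ, a < d ∧ b < m ∧ r₂ + 0 = d * m * c + a + d * b ∧
        (α * 1 + β * 0 : ℤ) = (i * α + c * lz + a * β + b * ly : ℕ) + 1)
    (hy' : (α * -n + β * d : ℤ) ≠ 0 → ∃ i c a b : ℕ, a < d ∧ b < m ∧
      r₂ + d = d * m * c + a + d * b ∧
        (α * -n + β * d : ℤ) = (i * α + c * lz + a * β + b * ly : ℕ) + 1) : False := by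
  have hα : 0 < α := by
    rcases Nat.eq_zero_or_pos α with rfl | hα
    · have hβ : 0 < β := Nat.pos_of_ne_zero fun h => by simp [h] at hr
      have h1 : 0 < d * β := by positivity
      have h2 : 0 < d * m * β := by positivity
      simp only [mul_zero, add_zero] at hy hz
      rw [hy] at hb
      rw [hz] at hc
      simp only [mul_eq_zero] at ha hb hc
      clear hs hx hy'
      omega
    · exact hα
  have hβ : 0 < β := Nat.pos_of_ne_zero fun h => by
    have : 0 < n * α := by positivity
    rw [h, mul_zero] at hy
    clear hs hx hy'
    omega
  obtain rfl : a = 0 := (Nat.mul_eq_zero.1 ha).resolve_right hβ.ne'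
  have hyz : m * ly = e * α + lz := by
    zify at hy hz ⊢
    linear_combination (m : ℤ) * hy - hz
  have hly : 0 < ly := Nat.pos_of_ne_zero fun h => by
    have : 0 < e * α := by positivity
    rw [h, mul_zero] at hyz
    clear hs hx hy'
    omega
  obtain rfl : b = 0 := (Nat.mul_eq_zero.1 hb).resolve_right hly.ne'
  obtain rfl : lz = 0 := (Nat.mul_eq_zero.1 hc).resolve_left (by simpa using hcab)
  obtain ⟨i₁, c₁, a₁, b₁, -, -, hr₁, hw₁⟩ := hs (by omega)
  obtain ⟨i₂, c₂, a₂, b₂, -, -, hr₂, hw₂⟩ := hx (by omega)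
  obtain ⟨i₃, c₃, a₃, b₃, -, -, hr₃, hw₃⟩ := hy' (by zify at hy; linarith)
  obtain rfl : a₁ = 0 := by
    by_contra h
    have := Nat.le_mul_of_pos_left β (Nat.pos_of_ne_zero h)
    omega
  obtain rfl : i₂ = 0 := by
    by_contra h
    have := Nat.le_mul_of_pos_left α (Nat.pos_of_ne_zero h)
    omega
  obtain rfl : b₃ = 0 := by
    by_contra h
    have := Nat.le_mul_of_pos_left ly (Nat.pos_of_ne_zero h)
    zify at hy this
    push_cast at hw₃
    have : (0 : ℤ) ≤ i₃ * α := by positivity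
    have : (0 : ℤ) ≤ a₃ * β := by positivity
    linarith
  have h₂ : d ≤ a₂ + 1 := by
    have : (d : ℤ) ∣ (a₂ + 1 : ℕ) := ⟨m * c₁ + b₁ - m * c₂ - b₂, by
      push_cast at *; linear_combination hr₁ - hr₂⟩
    exact Nat.le_of_dvd (by omega) (by exact_mod_cast this)
  have h₃ : d ≤ a₃ + 1 := by
    have : (d : ℤ) ∣ (a₃ + 1 : ℕ) := ⟨m * c₁ + b₁ + 1 - m * c₃, by
      push_cast at *; linear_combination hr₁ - hr₃⟩
    exact Nat.le_of_dvd (by omega) (by exact_mod_cast this)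
  obtain ⟨D, rfl⟩ : ∃ D, d = D + 1 := ⟨d - 1, by omega⟩
  have hα' : D * β < α := by
    have := Nat.mul_le_mul_right β (show D ≤ a₂ by omega)
    omega
  have hly' : D * β < ly := by
    have := Nat.mul_le_mul_right β (show D ≤ a₃ by omega)
    zify at hy this ⊢
    push_cast at hw₃ hy
    have : (0 : ℤ) ≤ i₃ * α := by positivity
    linarith
  have h4 : m * (D * β) < m * ly := by gcongr
  have h5 : m * (n * α) < m * β := by linarith
  have h6 : n * α < β := Nat.lt_of_mul_lt_mul_left h5
  have h7 : 1 * α ≤ n * α := Nat.mul_le_mul_right _ hn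
  have h8 : 1 * β ≤ D * β := Nat.mul_le_mul_right _ (by omega)
  omega

/-- The kernel of a nonzero locally nilpotent derivation is contained in `k[x]`. -/
theorem exists_eq_aeval_of_isLND [CharZero k] (hn : 1 ≤ n) (he : 1 ≤ e) (hd : 2 ≤ d) (hm : 2 ≤ m)
    (hD : IsLND D) (hD0 : D ≠ 0) {r : RRing k n e d m f 0} (hr : D r = 0) :
    ∃ p : Polynomial k, r = Polynomial.aeval (xel k n e d m f 0) p := by
  by_cases hr0 : r = 0
  · exact ⟨0, by rw [hr0, map_zero]⟩
  have hd' : 1 ≤ d := by omega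
  have hexp := fun {r i j} => exists_exponents (n := n) (e := e) (f := f) hd' hm (r := r) (i := i)
    (j := j)
  obtain ⟨i, j, hij⟩ := exists_hasLead
    (F := embed k n e d m f r) fun h => hr0 (embed_injective hd' hm (h.trans (map_zero _).symm))
  rcases le_or_gt j 0 with hj | hj
  · obtain ⟨p, hp, rfl⟩ := exists_eq_aevalAeval (j := 0) hd' hm
      (hij.le.mono (i' := i) (j' := (0 : ℕ)) (by omega)) (by omega)
    rw [Polynomial.eq_C_of_natDegree_le_zero hp, Polynomial.aevalAeval_C]
    exact ⟨_, rfl⟩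
  exfalso
  obtain ⟨α, β, r₁, r₂, hr12, h⟩ := exists_nilpotency_weight hD hD0 hd' hm
  obtain ⟨ly, hy⟩ := Int.eq_ofNat_of_zero_le (h _ _ _ hasLead_yel).1
  obtain ⟨lz, hz⟩ := Int.eq_ofNat_of_zero_le (h _ _ _ (hasLead_zel hd' hm)).1
  have hweight : ∀ i c a b : ℕ, (α * (i - (n * m + e) * c - n * b) +
      β * (d * m * c + a + d * b) : ℤ) = (i * α + c * lz + a * β + b * ly : ℕ) := by
    intro i c a b
    push_cast
    rw [← hy, ← hz]
    ring
  have hy' : ly + n * α = d * β := by zify; rw [← hy]; ring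
  have hz' : lz + (n * m + e) * α = d * m * β := by zify; rw [← hz]; ring
  have hw0 := (h _ _ _ hij).2.1 hr
  obtain ⟨i', c, a, b, -, -, rfl, rfl⟩ := hexp hij
  rw [hweight] at hw0
  obtain ⟨⟨⟨hc0, ha0⟩, hb0⟩, hcab⟩ : ((c * lz = 0 ∧ a * β = 0) ∧ b * ly = 0) ∧
      (c ≠ 0 ∨ a ≠ 0 ∨ b ≠ 0) := by
    refine ⟨by omega, ?_⟩
    by_contra! h0
    simp [h0] at hj
  have hshift : ∀ t i j, HasLead (embed k n e d m f t) i j → α * i + β * j ≠ 0 →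
      ∃ i' c a b : ℕ, a < d ∧ b < m ∧ r₂ + j = d * m * c + a + d * b ∧
        α * i + β * j = (i' * α + c * lz + a * β + b * ly : ℕ) + 1 := by
    intro t i j ht h0
    obtain ⟨i', c, a, b, ha, hb, h1, h2⟩ := hexp ((h t i j ht).2.2 h0)
    refine ⟨i', c, a, b, ha, hb, h2, ?_⟩
    rw [← hweight, ← h1, ← h2]
    linear_combination -hr12
  exact no_weight hn he hd hm hcab hc0 ha0 hb0 hy' hz' hr12
    (fun h0 => hshift _ _ _ (by rw [embed_sel]; exact hasLead_s) h0)
    (fun h0 => hshift _ _ _ (by rw [embed_xel]; exact hasLead_x) h0)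
    (fun h0 => hshift _ _ _ hasLead_yel h0)

end RRing

namespace LexSeries

variable {k : Type*} [Field k]

theorem aeval_x_injective : Function.Injective (Polynomial.aeval (R := k) (x : LexSeries k)) := by
  rw [injective_iff_map_eq_zero]
  intro p hp
  by_contra h
  obtain ⟨v, hv, -⟩ := exists_hasLead_aeval h
  exact hv.ne_zero hp

theorem aevalAeval_injective :
    Function.Injective (Polynomial.aevalAeval (R := k) (x : LexSeries k) (s : LexSeries k)) := by
  rw [injective_iff_map_eq_zero]
  intro p hp
  by_contra h
  obtain ⟨v, hv, -⟩ := exists_hasLead_aeval (Polynomial.leadingCoeff_ne_zero.2 h)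
  exact (hasLead_aevalAeval hv).ne_zero hp

end LexSeries

section

variable {k A B : Type*} [CommRing k] [CommRing A] [CommRing B] [Algebra k A] [Algebra k B]

theorem IsLND.exists_conj {D : Derivation k A A} (hD : IsLND D) (φ : A ≃ₐ[k] B) :
    ∃ E : Derivation k B B, IsLND E ∧ ∀ a, E (φ a) = φ (D a) := by
  have hker : ∀ a, (φ : A →ₐ[k] B) a = 0 → (φ : A →ₐ[k] B) (D a) = 0 := by
    intro a ha
    rw [show a = 0 from (map_eq_zero_iff φ φ.injective).1 ha, map_zero, map_zero]
  have hφ : Function.Surjective (φ : A →ₐ[k] B) := φ.surjective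
  have hE : ∀ a, Derivation.liftOfSurjective hφ hker (φ a) = φ (D a) :=
    fun a => Derivation.liftOfSurjective_apply _ _ _
  refine ⟨_, isLND_iff.2 fun b => ?_, hE⟩
  obtain ⟨a, rfl⟩ := φ.surjective b
  obtain ⟨N, hN⟩ := isLND_iff.1 hD a
  refine ⟨N, ?_⟩
  have := Function.Semiconj.iterate_right (f := φ) (ga := D) (fun a => (hE a).symm) N a
  rw [← this, hN, map_zero]

end

namespace RRing

open LexSeries

section

variable {k : Type*} [Field k] {n e d m : ℕ} {f : ℕ → Polynomial k}

theorem aeval_xel_injective :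
    Function.Injective (Polynomial.aeval (R := k) (xel k n e d m f 0)) := by
  refine Function.Injective.of_comp (f := embed k n e d m f) ?_
  convert aeval_x_injective (k := k) using 1
  ext p
  simp [← Polynomial.aeval_algHom_apply]

theorem aevalAeval_xel_sel_injective :
    Function.Injective
      (Polynomial.aevalAeval (R := k) (xel k n e d m f 0) (sel k n e d m f 0)) := by
  refine Function.Injective.of_comp (f := embed k n e d m f) ?_
  convert aevalAeval_injective (k := k) using 1
  funext p
  rw [Function.comp_apply, map_aevalAeval, embed_xel, embed_sel]

theorem exists_hasLead_embed (hd : 1 ≤ d) (hm : 2 ≤ m) {r : RRing k n e d m f 0} (hr : r ≠ 0) :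
    ∃ i j, HasLead (embed k n e d m f r) i j :=
  exists_hasLead fun h => hr (embed_injective hd hm (h.trans (map_zero _).symm))

theorem hasLead_nonneg (hd : 1 ≤ d) (hm : 2 ≤ m) {r : RRing k n e d m f 0} {i j : ℤ}
    (h : HasLead (embed k n e d m f r) i j) : 0 ≤ j := by
  obtain ⟨_, c, a, b, -, -, -, rfl⟩ := exists_exponents hd hm h
  positivity

theorem exists_eq_aeval (hd : 1 ≤ d) (hm : 2 ≤ m) {r : RRing k n e d m f 0} {i : ℤ}
    (h : LeadLE (embed k n e d m f r) i 0) :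
    ∃ p : Polynomial k, r = Polynomial.aeval (xel k n e d m f 0) p := by
  obtain ⟨p, hp, rfl⟩ := exists_eq_aevalAeval (j := 0) hd hm h hd
  rw [Polynomial.eq_C_of_natDegree_le_zero hp, Polynomial.aevalAeval_C]
  exact ⟨_, rfl⟩

theorem exists_eq_aeval_mul_sel_add (hd : 2 ≤ d) (hm : 2 ≤ m) {r : RRing k n e d m f 0} {i : ℤ}
    (h : LeadLE (embed k n e d m f r) i 1) :
    ∃ p q : Polynomial k, r = Polynomial.aeval (xel k n e d m f 0) p * sel k n e d m f 0 +
      Polynomial.aeval (xel k n e d m f 0) q := by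
  obtain ⟨p, hp, rfl⟩ := exists_eq_aevalAeval (j := 1) (by omega) hm h hd
  rw [Polynomial.eq_X_add_C_of_natDegree_le_one hp]
  simp only [map_add, map_mul, Polynomial.aevalAeval_C, Polynomial.aevalAeval_Y]
  exact ⟨_, _, rfl⟩

end

variable {k : Type*} [Field k] {n₁ n₂ e₁ e₂ d₁ d₂ m : ℕ} {f g : ℕ → Polynomial k}

theorem exists_conj_isLND (φ : RRing k n₁ e₁ d₁ m f 0 ≃ₐ[k] RRing k n₂ e₂ d₂ m g 0) :
    ∃ E : Derivation k (RRing k n₂ e₂ d₂ m g 0) (RRing k n₂ e₂ d₂ m g 0), IsLND E ∧ E ≠ 0 ∧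
      E (φ (xel k n₁ e₁ d₁ m f 0)) = 0 ∧ E (φ (sel k n₁ e₁ d₁ m f 0)) =
        φ (xel k n₁ e₁ d₁ m f 0) ^ (n₁ + e₁) := by
  obtain ⟨D, hD, hDx, hDs⟩ := exists_isLND n₁ e₁ d₁ m f
  obtain ⟨E, hE, hEφ⟩ := hD.exists_conj φ
  have hEs := (hEφ (sel k n₁ e₁ d₁ m f 0)).trans (by rw [hDs, map_pow])
  refine ⟨E, hE, ?_, by rw [hEφ, hDx, map_zero], hEs⟩
  rintro rfl
  rw [← map_pow, Derivation.zero_apply, eq_comm, map_eq_zero_iff φ φ.injective] at hEs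
  have h := congrArg (embed k n₁ e₁ d₁ m f) hEs
  rw [map_pow, embed_xel, map_zero] at h
  exact pow_ne_zero _ x_ne_zero h

variable [CharZero k]

theorem exists_map_xel (φ : RRing k n₁ e₁ d₁ m f 0 ≃ₐ[k] RRing k n₂ e₂ d₂ m g 0)
    (hn₁ : 1 ≤ n₁) (hn₂ : 1 ≤ n₂) (he₁ : 1 ≤ e₁) (he₂ : 1 ≤ e₂)
    (hd₁ : 2 ≤ d₁) (hd₂ : 2 ≤ d₂) (hm : 2 ≤ m) :
    ∃ l c : k, l ≠ 0 ∧ φ (xel k n₁ e₁ d₁ m f 0) = Polynomial.aeval (xel k n₂ e₂ d₂ m g 0)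
      (Polynomial.C l * Polynomial.X + Polynomial.C c) := by
  obtain ⟨E, hE, hE0, hEx, -⟩ := exists_conj_isLND φ
  obtain ⟨p, hp⟩ := exists_eq_aeval_of_isLND hn₂ he₂ hd₂ hm hE hE0 hEx
  obtain ⟨E, hE, hE0, hEx, -⟩ := exists_conj_isLND φ.symm
  obtain ⟨q, hq⟩ := exists_eq_aeval_of_isLND hn₁ he₁ hd₁ hm hE hE0 hEx
  have h1 : p.comp q = Polynomial.X := by
    apply aeval_xel_injective (n := n₁) (e := e₁) (d := d₁) (m := m) (f := f)
    rw [Polynomial.aeval_comp, ← hq, Polynomial.aeval_algHom_apply, ← hp, Polynomial.aeval_X,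
      AlgEquiv.symm_apply_apply]
  have h2 : p.natDegree * q.natDegree = 1 := by
    rw [← Polynomial.natDegree_comp, h1, Polynomial.natDegree_X]
  have h3 : p.natDegree = 1 := Nat.eq_one_of_mul_eq_one_right h2
  refine ⟨p.coeff 1, p.coeff 0, ?_, ?_⟩
  · rw [← h3]
    exact Polynomial.leadingCoeff_ne_zero.2 (by rintro rfl; simp at h3)
  · rw [← Polynomial.eq_X_add_C_of_natDegree_le_one h3.le, hp]

/-- An isomorphism maps `x` to a multiple of `x` and `s` to an element of degree one in `s`. -/
theorem exists_map_sel (φ : RRing k n₁ e₁ d₁ m f 0 ≃ₐ[k] RRing k n₂ e₂ d₂ m g 0)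
    (hn₁ : 1 ≤ n₁) (hn₂ : 1 ≤ n₂) (he₁ : 1 ≤ e₁) (he₂ : 1 ≤ e₂)
    (hd₁ : 2 ≤ d₁) (hd₂ : 2 ≤ d₂) (hm : 2 ≤ m) :
    ∃ (l : k) (p q : Polynomial k), l ≠ 0 ∧ φ (xel k n₁ e₁ d₁ m f 0) = l • xel k n₂ e₂ d₂ m g 0 ∧
      φ (sel k n₁ e₁ d₁ m f 0) = Polynomial.aeval (xel k n₂ e₂ d₂ m g 0) p * sel k n₂ e₂ d₂ m g 0 +
        Polynomial.aeval (xel k n₂ e₂ d₂ m g 0) q ∧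
      Polynomial.X ^ (n₂ + e₂) * p ∣ (Polynomial.C l * Polynomial.X) ^ (n₁ + e₁) := by
  have hd₂' : 1 ≤ d₂ := by omega
  obtain ⟨l, c, hl, hx⟩ := exists_map_xel φ hn₁ hn₂ he₁ he₂ hd₁ hd₂ hm
  obtain ⟨E, hE, hE0, hEx, hEs⟩ := exists_conj_isLND φ
  have := isDomain (k := k) (n := n₂) (e := e₂) (f := g) hd₂' hm
  have hEx' : E (xel k n₂ e₂ d₂ m g 0) = 0 := by
    rw [hx] at hEx
    simpa [← Algebra.smul_def, hl] using hEx
  have hB := div_mul_cancel₀ (embed k n₂ e₂ d₂ m g (E (sel k n₂ e₂ d₂ m g 0))) (s_ne_zero (k := k))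
  have hAB := embed_derivation (A := 0) E (by rw [hEx', zero_mul, map_zero]) hB
  have hEs0 : E (sel k n₂ e₂ d₂ m g 0) ≠ 0 := by
    intro h
    refine hE0 (Derivation.ext fun r => embed_injective hd₂' hm ?_)
    rw [hAB, h, logDer_apply]
    simp
  obtain ⟨b₁, b₂, hb⟩ := exists_hasLead_embed hd₂' hm hEs0
  have hb₂ := hasLead_nonneg hd₂' hm hb
  have hBlead : HasLead (embed k n₂ e₂ d₂ m g (E (sel k n₂ e₂ d₂ m g 0)) / s) b₁ (b₂ - 1) := by
    refine HasLead.of_mul (F := s) (i := 0) (j := 1) ?_ hasLead_s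
    rw [mul_comm, hB]
    convert hb using 1 <;> ring
  have hshift : ∀ r i j, HasLead (embed k n₂ e₂ d₂ m g r) i j → j ≠ 0 →
      HasLead (embed k n₂ e₂ d₂ m g (E r)) (b₁ + i) (b₂ - 1 + j) := by
    intro r i j h hj
    have hA : LeadLE (0 : LexSeries k) b₁ (b₂ - 1) := leadLE_zero
    rw [hAB]
    refine HasLead.of_coeff_ne_zero (hA.logDer hBlead.le h.le) ?_
    rw [hA.coeff_logDer hBlead.le h.le, HahnSeries.coeff_zero, zero_mul, zero_add]
    exact mul_ne_zero (mul_ne_zero hBlead.coeff_ne_zero (by exact_mod_cast hj)) h.coeff_ne_zero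
  set L : Polynomial k := Polynomial.C l * Polynomial.X + Polynomial.C c with hL
  have hL0 : L ^ (n₁ + e₁) ≠ 0 := pow_ne_zero _ fun h => by
    have := congrArg (Polynomial.coeff · 1) h
    simp [hL, hl] at this
  obtain ⟨v, hv, -⟩ := exists_hasLead_aeval hL0
  have hEs' : embed k n₂ e₂ d₂ m g (E (φ (sel k n₁ e₁ d₁ m f 0))) =
      Polynomial.aeval x (L ^ (n₁ + e₁)) := by
    rw [hEs, hx, ← map_pow, ← Polynomial.aeval_algHom_apply, embed_xel]
  rw [← hEs'] at hv
  have hσ0 : φ (sel k n₁ e₁ d₁ m f 0) ≠ 0 := by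
    intro h
    rw [h, map_zero, map_zero] at hv
    exact hv.ne_zero rfl
  obtain ⟨i, j, hσ⟩ := exists_hasLead_embed hd₂' hm hσ0
  have hj := hasLead_nonneg hd₂' hm hσ
  have hj0 : j ≠ 0 := by
    rintro rfl
    obtain ⟨p, hp⟩ := exists_eq_aeval hd₂' hm hσ.le
    rw [hp, Derivation.map_aeval, hEx', smul_zero, map_zero] at hv
    exact hv.ne_zero rfl
  obtain ⟨-, h1⟩ := hv.unique (hshift _ _ _ hσ hj0)
  obtain rfl : j = 1 := by omega
  obtain rfl : b₂ = 0 := by omega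
  obtain ⟨p, q, hpq⟩ := exists_eq_aeval_mul_sel_add hd₂ hm hσ.le
  obtain ⟨b, hb'⟩ := exists_eq_aeval hd₂' hm hb.le
  have hpb : p * b = L ^ (n₁ + e₁) := by
    apply aeval_xel_injective (n := n₂) (e := e₂) (d := d₂) (m := m) (f := g)
    rw [map_mul, ← hb', map_pow, ← hx, ← hEs, hpq]
    simp [Derivation.map_aeval, hEx']
  obtain ⟨w, hw, hwb, -⟩ := exists_hasLead_aeval (k := k) (p := b) (by
    rintro rfl
    exact hL0 (by rw [← hpb, mul_zero]))
  have hbw : b₁ = w := by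
    rw [hb', ← Polynomial.aeval_algHom_apply, embed_xel] at hb
    exact (hb.unique hw).1
  have hdm : 1 ≤ d₂ * m := Nat.mul_pos (by omega) (by omega)
  obtain ⟨i', c', a, b', ha, hb'', h1, h2⟩ := exists_exponents hd₂' hm
    (hshift _ _ _ (hasLead_zel hd₂' hm) (by exact_mod_cast (by omega : d₂ * m ≠ 0)))
  have hw' : n₂ + e₂ ≤ w := by
    have hc' : c' = 0 := by
      by_contra h
      have : d₂ * m * 1 ≤ d₂ * m * c' := Nat.mul_le_mul_left _ (Nat.pos_of_ne_zero h)
      zify at this hdm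
      have : (0 : ℤ) ≤ d₂ * b' := by positivity
      linarith
    have h3 : n₂ * (b' + 1) ≤ n₂ * m := Nat.mul_le_mul_left _ hb''
    subst hc'
    rw [hbw] at h1
    zify at h3 ⊢
    push_cast at h1
    linarith
  have hXb : Polynomial.X ^ (n₂ + e₂) ∣ b := (pow_dvd_pow _ hw').trans hwb
  have hc : c = 0 := by
    have h3 : (Polynomial.X : Polynomial k) ∣ L ^ (n₁ + e₁) :=
      (dvd_pow_self _ (by omega)).trans (hXb.trans ⟨p, by rw [← hpb, mul_comm]⟩)
    simpa [hL, Polynomial.X_dvd_iff] using Polynomial.prime_X.dvd_of_dvd_pow h3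
  refine ⟨l, p, q, hl, ?_, hpq, ?_⟩
  · rw [hx, hL, hc]
    simp [Algebra.smul_def]
  · rw [hc, Polynomial.C_0, add_zero] at hL
    rw [← hL, ← hpb, mul_comm]
    exact mul_dvd_mul_left _ hXb

end RRing

namespace LexSeries

variable {k : Type*} [Field k]

theorem hasLead_smul_s_add {u : k} (hu : u ≠ 0) (q : Polynomial k) :
    HasLead (u • s + Polynomial.aeval (x : LexSeries k) q) 0 1 := by
  refine HasLead.add_of_lt ?_ ((leadLE_aeval (hasLead_x.le.mono (by simp)) q).lt (by simp))
  rw [Algebra.smul_def]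
  simpa using (hasLead_algebraMap hu).mul hasLead_s

theorem leadLE_smul_x (l : k) : LeadLE (l • (x : LexSeries k)) 0 0 := by
  rw [Algebra.smul_def]
  exact ((leadLE_algebraMap l).mul hasLead_x.le).mono (by simp)

end LexSeries

namespace RRing

open LexSeries

variable {k : Type*} [Field k] [CharZero k] {n₁ n₂ e₁ e₂ d₁ d₂ m : ℕ} {f g : ℕ → Polynomial k}

theorem add_le_add_of_algEquiv (φ : RRing k n₁ e₁ d₁ m f 0 ≃ₐ[k] RRing k n₂ e₂ d₂ m g 0)
    (hn₁ : 1 ≤ n₁) (hn₂ : 1 ≤ n₂) (he₁ : 1 ≤ e₁) (he₂ : 1 ≤ e₂)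
    (hd₁ : 2 ≤ d₁) (hd₂ : 2 ≤ d₂) (hm : 2 ≤ m) : n₂ + e₂ ≤ n₁ + e₁ := by
  obtain ⟨l, p, q, hl, -, -, h⟩ := exists_map_sel φ hn₁ hn₂ he₁ he₂ hd₁ hd₂ hm
  have h1 := Polynomial.natDegree_le_of_dvd ((dvd_mul_right _ _).trans h)
    (pow_ne_zero _ (mul_ne_zero (Polynomial.C_ne_zero.2 hl) Polynomial.X_ne_zero))
  simpa [Polynomial.natDegree_C_mul_X l hl] using h1

/-- An isomorphism acts on `x` and `s` by a triangular map. -/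
theorem exists_map_sel_eq_smul (φ : RRing k n₁ e₁ d₁ m f 0 ≃ₐ[k] RRing k n₂ e₂ d₂ m g 0)
    (hn₁ : 1 ≤ n₁) (hn₂ : 1 ≤ n₂) (he₁ : 1 ≤ e₁) (he₂ : 1 ≤ e₂)
    (hd₁ : 2 ≤ d₁) (hd₂ : 2 ≤ d₂) (hm : 2 ≤ m) :
    ∃ (l u : k) (q : Polynomial k), l ≠ 0 ∧ u ≠ 0 ∧
      φ (xel k n₁ e₁ d₁ m f 0) = l • xel k n₂ e₂ d₂ m g 0 ∧
      φ (sel k n₁ e₁ d₁ m f 0) = u • sel k n₂ e₂ d₂ m g 0 +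
        Polynomial.aeval (xel k n₂ e₂ d₂ m g 0) q := by
  obtain ⟨l, p, q, hl, hx, hs, h⟩ := exists_map_sel φ hn₁ hn₂ he₁ he₂ hd₁ hd₂ hm
  have hN : n₂ + e₂ = n₁ + e₁ := (add_le_add_of_algEquiv φ hn₁ hn₂ he₁ he₂ hd₁ hd₂ hm).antisymm
    (add_le_add_of_algEquiv φ.symm hn₂ hn₁ he₂ he₁ hd₂ hd₁ hm)
  rw [hN, mul_pow, mul_comm (Polynomial.C l ^ _),
    mul_dvd_mul_iff_left (pow_ne_zero _ Polynomial.X_ne_zero)] at h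
  have hp : IsUnit p :=
    isUnit_of_dvd_unit h ((Polynomial.isUnit_C.2 (isUnit_iff_ne_zero.2 hl)).pow _)
  obtain ⟨u, hu, rfl⟩ := Polynomial.isUnit_iff.1 hp
  refine ⟨l, u, q, hl, hu.ne_zero, hx, ?_⟩
  rw [hs, Polynomial.aeval_C, ← Algebra.smul_def]

theorem le_of_algEquiv (φ : RRing k n₁ e₁ d₁ m f 0 ≃ₐ[k] RRing k n₂ e₂ d₂ m g 0)
    (hn₁ : 1 ≤ n₁) (hn₂ : 1 ≤ n₂) (he₁ : 1 ≤ e₁) (he₂ : 1 ≤ e₂)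
    (hd₁ : 2 ≤ d₁) (hd₂ : 2 ≤ d₂) (hm : 2 ≤ m) : d₂ ≤ d₁ ∧ (d₁ = d₂ → n₁ ≤ n₂) := by
  obtain ⟨l, u, q, hl, hu, hx, hs⟩ := exists_map_sel_eq_smul φ hn₁ hn₂ he₁ he₂ hd₁ hd₂ hm
  have h := congrArg (fun r => embed k n₂ e₂ d₂ m g (φ r))
    (xel_pow_mul_yel (k := k) (n := n₁) (e := e₁) (d := d₁) (m := m) (f := f))
  simp only [map_mul, map_pow, hx] at h
  have h1 : embed k n₂ e₂ d₂ m g (φ (Polynomial.aevalAeval (xel k n₁ e₁ d₁ m f 0)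
      (sel k n₁ e₁ d₁ m f 0) (monicPoly d₁ f))) =
      Polynomial.aevalAeval (l • (x : LexSeries k)) (u • s + Polynomial.aeval x q)
        (monicPoly d₁ f) := by
    have h2 := map_aevalAeval (φ : RRing k n₁ e₁ d₁ m f 0 →ₐ[k] RRing k n₂ e₂ d₂ m g 0)
      (xel k n₁ e₁ d₁ m f 0) (sel k n₁ e₁ d₁ m f 0) (monicPoly d₁ f)
    simp only [AlgEquiv.coe_toAlgHom, hx, hs] at h2
    rw [h2, map_aevalAeval, map_add, map_smul, map_smul, ← Polynomial.aeval_algHom_apply,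
      embed_xel, embed_sel]
  have h3 : HasLead ((l • x) ^ n₁ * embed k n₂ e₂ d₂ m g (φ (yel k n₁ e₁ d₁ m f 0))) 0 d₁ := by
    rw [← embed_xel (n := n₂) (e := e₂) (d := d₂) (m := m) (f := g), ← map_smul, h, h1]
    exact hasLead_monicPoly (leadLE_smul_x l) (hasLead_smul_s_add hu q) _ _
  have h4 : HasLead ((l • (x : LexSeries k)) ^ n₁) n₁ 0 := by
    rw [Algebra.smul_def]
    convert ((hasLead_algebraMap hl).mul hasLead_x).pow n₁ using 1 <;> ring
  have h5 : HasLead (embed k n₂ e₂ d₂ m g (φ (yel k n₁ e₁ d₁ m f 0))) (-n₁) d₁ :=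
    HasLead.of_mul (by convert h3 using 1 <;> ring) h4
  obtain ⟨i, c, a, b, ha, hb, h6, h7⟩ := exists_exponents (by omega) hm h5
  have h8 : d₁ = d₂ * (m * c + b) + a := by zify; rw [h7]; ring
  have h9 : 0 < m * c + b := by
    rcases Nat.eq_zero_or_pos b with rfl | hb
    · rcases Nat.eq_zero_or_pos c with rfl | hc
      · push_cast at h6
        omega
      · positivity
    · positivity
  refine ⟨by nlinarith, ?_⟩
  rintro rfl
  have h10 : d₁ * (m * c + b) ≤ d₁ * 1 := by omega
  have h11 : m * c + b ≤ 1 := Nat.le_of_mul_le_mul_left h10 (by omega)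
  have h12 : c = 0 := by
    by_contra h
    have : m * 1 ≤ m * c := Nat.mul_le_mul_left _ (Nat.pos_of_ne_zero h)
    omega
  subst h12
  obtain rfl : b = 1 := by omega
  push_cast at h6
  omega

theorem eq_of_algEquiv (φ : RRing k n₁ e₁ d₁ m f 0 ≃ₐ[k] RRing k n₂ e₂ d₂ m g 0)
    (hn₁ : 1 ≤ n₁) (hn₂ : 1 ≤ n₂) (he₁ : 1 ≤ e₁) (he₂ : 1 ≤ e₂)
    (hd₁ : 2 ≤ d₁) (hd₂ : 2 ≤ d₂) (hm : 2 ≤ m) : n₁ = n₂ ∧ e₁ = e₂ ∧ d₁ = d₂ := by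
  have h1 := le_of_algEquiv φ hn₁ hn₂ he₁ he₂ hd₁ hd₂ hm
  have h2 := le_of_algEquiv φ.symm hn₂ hn₁ he₂ he₁ hd₂ hd₁ hm
  have h3 := add_le_add_of_algEquiv φ hn₁ hn₂ he₁ he₂ hd₁ hd₂ hm
  have h4 := add_le_add_of_algEquiv φ.symm hn₂ hn₁ he₂ he₁ hd₂ hd₁ hm
  have h5 := h1.2 (by omega)
  have h6 := h2.2 (by omega)
  omega

end RRing

section

variable {k : Type*} [Field k]

/-- The substitution `X ↦ l X`, `S ↦ u S + q(X)` in `k[X][S]`. -/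
def triangularSubst (l u : k) (q : Polynomial k) (F : Polynomial (Polynomial k)) :
    Polynomial (Polynomial k) :=
  Polynomial.aevalAeval (Polynomial.C (Polynomial.C l * Polynomial.X))
    (Polynomial.C (Polynomial.C u) * Polynomial.X + Polynomial.C q) F

theorem aevalAeval_triangularSubst {A : Type*} [CommRing A] [Algebra k A] (x t : A) (l u : k)
    (q : Polynomial k) (F : Polynomial (Polynomial k)) :
    Polynomial.aevalAeval x t (triangularSubst l u q F) =
      Polynomial.aevalAeval (l • x) (u • t + Polynomial.aeval x q) F := by
  rw [triangularSubst, map_aevalAeval]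
  simp only [map_add, map_mul, Polynomial.aevalAeval_C, Polynomial.aevalAeval_Y,
    Polynomial.aeval_C, Polynomial.aeval_X, Algebra.smul_def]

theorem coeff_triangularSubst (l : k) {u : k} (hu : u ≠ 0) (q : Polynomial k)
    {F : Polynomial (Polynomial k)} {N : ℕ} (hN : F.natDegree < N) (j : ℕ) :
    (triangularSubst l u q F).coeff j = ∑ i ∈ Finset.range N,
      (F.coeff i).comp (Polynomial.C l * Polynomial.X) * Polynomial.C (u ^ i) *
        ((Polynomial.C u⁻¹ * q) ^ (i - j) * (i.choose j : Polynomial k)) := by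
  have h1 : Polynomial.C (Polynomial.C u) * Polynomial.X + Polynomial.C q =
      Polynomial.C (Polynomial.C u) *
        (Polynomial.X + Polynomial.C (Polynomial.C u⁻¹ * q) : Polynomial (Polynomial k)) := by
    rw [mul_add, ← Polynomial.C_mul, ← mul_assoc, ← Polynomial.C_mul, mul_inv_cancel₀ hu,
      Polynomial.C_1, one_mul]
  have h2 : ∀ p : Polynomial k, Polynomial.aeval (R := k)
      (Polynomial.C (Polynomial.C l * Polynomial.X) : Polynomial (Polynomial k)) p =
        Polynomial.C (p.comp (Polynomial.C l * Polynomial.X)) := by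
    intro p
    have := Polynomial.aeval_algHom_apply (Polynomial.CAlgHom (R := k) (A := Polynomial k))
      (Polynomial.C l * Polynomial.X) p
    simpa [Polynomial.comp_eq_aeval] using this
  rw [triangularSubst, aevalAeval_eq_sum _ _ _ hN, Polynomial.finsetSum_coeff]
  refine Finset.sum_congr rfl fun i _ => ?_
  rw [h1, h2, mul_pow, ← Polynomial.C_pow, ← mul_assoc, ← Polynomial.C_mul, Polynomial.coeff_C_mul,
    Polynomial.coeff_X_add_C_pow, Polynomial.C_pow]

theorem natDegree_monicPoly_lt (d : ℕ) (f : ℕ → Polynomial k) :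
    (monicPoly d f).natDegree < d + 1 := by
  rw [Nat.lt_succ_iff, Polynomial.natDegree_le_iff_coeff_eq_zero]
  intro i hi
  rw [coeff_monicPoly, if_neg (by omega), if_neg (by omega)]

variable (l : k) {u : k} (q : Polynomial k) (d : ℕ) (f g : ℕ → Polynomial k)

/-- The defect of the relation between `P₁(l X, u S + q(X))` and `u ^ d * P₂(X, S)`. -/
def substDefect (u : k) : Polynomial (Polynomial k) :=
  triangularSubst l u q (monicPoly d f) -
    Polynomial.C (Polynomial.C (u ^ d)) * monicPoly d g

variable {d f g}

theorem coeff_substDefect_of_le (hu : u ≠ 0) {j : ℕ} (hj : d ≤ j) :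
    (substDefect l q d f g u).coeff j = 0 := by
  rw [substDefect, Polynomial.coeff_sub, Polynomial.coeff_C_mul, sub_eq_zero,
    coeff_triangularSubst l hu q (natDegree_monicPoly_lt d f), Finset.sum_range_succ,
    Finset.sum_eq_zero, zero_add]
  · simp only [coeff_monicPoly, lt_irrefl, if_false, if_true, hj.not_gt]
    rcases hj.eq_or_lt with rfl | hj
    · simp
    · simp [Nat.choose_eq_zero_of_lt hj, hj.ne']
  · intro i hi
    rw [Nat.choose_eq_zero_of_lt ((Finset.mem_range.1 hi).trans_le hj)]
    simp

theorem natDegree_substDefect_lt (hu : u ≠ 0) (hd : 1 ≤ d) :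
    (substDefect l q d f g u).natDegree < d := by
  refine lt_of_le_of_lt (b := d - 1) ?_ (by omega)
  rw [Polynomial.natDegree_le_iff_coeff_eq_zero]
  exact fun i hi => coeff_substDefect_of_le l q hu (by omega)

theorem dvd_of_dvd_substDefect [CharZero k] (hu : u ≠ 0) (hd : 1 ≤ d) (hf : f (d - 1) = 0)
    (hg : g (d - 1) = 0) {p : Polynomial k} (h : Polynomial.C p ∣ substDefect l q d f g u) :
    p ∣ q := by
  obtain ⟨d, rfl⟩ := Nat.exists_eq_add_of_le' hd
  rw [Nat.add_sub_cancel] at hf hg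
  have h1 := (Polynomial.C_dvd_iff_dvd_coeff _ _).1 h d
  rw [substDefect, Polynomial.coeff_sub, Polynomial.coeff_C_mul, coeff_monicPoly,
    coeff_triangularSubst l hu q (natDegree_monicPoly_lt _ f), Finset.sum_range_succ,
    Finset.sum_range_succ, Finset.sum_eq_zero] at h1
  · simp only [coeff_monicPoly, hf, hg, lt_irrefl, if_false, if_true] at h1
    have h2 : IsUnit (Polynomial.C (u ^ (d + 1) * u⁻¹ * (d + 1))) := by
      rw [Polynomial.isUnit_C, isUnit_iff_ne_zero]
      exact mul_ne_zero (by positivity) (by exact_mod_cast d.succ_ne_zero)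
    rw [← h2.dvd_mul_left]
    convert h1 using 1
    simp
    ring
  · intro i hi
    rw [Nat.choose_eq_zero_of_lt (Finset.mem_range.1 hi)]
    simp

theorem C_dvd_substDefect_iff (hu : u ≠ 0) (hf : f (d - 1) = 0)
    (hg : g (d - 1) = 0) {p : Polynomial k} (hq : p ∣ q) :
    Polynomial.C p ∣ substDefect l q d f g u ↔ ∀ i, 2 ≤ i → i ≤ d →
      p ∣ (f (d - i)).comp (Polynomial.C l * Polynomial.X) - Polynomial.C (u ^ i) * g (d - i) := by
  have hd : ∀ j < d, Polynomial.C (u ^ d) = Polynomial.C (u ^ j) * Polynomial.C (u ^ (d - j)) := by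
    intro j hj
    rw [← Polynomial.C_mul, ← pow_add, Nat.add_sub_cancel' hj.le]
  have key : ∀ j < d, (p ∣ (substDefect l q d f g u).coeff j ↔
      p ∣ (f j).comp (Polynomial.C l * Polynomial.X) - Polynomial.C (u ^ (d - j)) * g j) := by
    intro j hj
    have h1 : p ∣ (substDefect l q d f g u).coeff j - Polynomial.C (u ^ j) *
        ((f j).comp (Polynomial.C l * Polynomial.X) - Polynomial.C (u ^ (d - j)) * g j) := by
      rw [substDefect, Polynomial.coeff_sub, Polynomial.coeff_C_mul, coeff_monicPoly, if_pos hj,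
        coeff_triangularSubst l hu q (natDegree_monicPoly_lt _ f),
        ← Finset.add_sum_erase _ _ (Finset.mem_range.2 (hj.trans d.lt_succ_self)),
        coeff_monicPoly, if_pos hj, Nat.choose_self, Nat.sub_self, pow_zero, Nat.cast_one, mul_one,
        mul_one, hd j hj]
      convert Finset.dvd_sum (s := (Finset.range (d + 1)).erase j) (a := p) ?_ using 1
      · ring
      · intro i hi
        have hi := Finset.mem_erase.1 hi
        rcases lt_or_gt_of_ne hi.1 with h | h
        · simp [Nat.choose_eq_zero_of_lt h]
        · exact ((hq.mul_left _).trans (dvd_pow_self _ (by omega))).mul_right _ |>.mul_left _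
    rw [← (Polynomial.isUnit_C.2 (isUnit_iff_ne_zero.2 (pow_ne_zero j hu))).dvd_mul_left (b :=
      (f j).comp (Polynomial.C l * Polynomial.X) - Polynomial.C (u ^ (d - j)) * g j)]
    exact dvd_iff_dvd_of_dvd_sub h1
  rw [Polynomial.C_dvd_iff_dvd_coeff]
  constructor
  · intro h i hi hid
    have := (key (d - i) (by omega)).1 (h _)
    rwa [Nat.sub_sub_self hid] at this
  · intro h j
    rcases lt_or_ge j d with hj | hj
    · rw [key j hj]
      rcases (show j + 1 ≤ d from hj).eq_or_lt with rfl | hj'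
      · rw [Nat.add_sub_cancel] at hf hg
        simp [hf, hg]
      · have := h (d - j) (by omega) (by omega)
        rwa [Nat.sub_sub_self hj.le] at this
    · rw [coeff_substDefect_of_le l q hu hj]
      exact dvd_zero _

theorem exists_natDegree_le_not_dvd_leadingCoeff {R : Type*} [CommRing R] {a : R}
    {h : Polynomial R} (ha : ¬ Polynomial.C a ∣ h) :
    ∃ h' : Polynomial R, Polynomial.C a ∣ h - h' ∧ h'.natDegree ≤ h.natDegree ∧
      ¬ a ∣ h'.leadingCoeff := by
  set π := Ideal.Quotient.mk (Ideal.span {a}) with hπ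
  have hker : ∀ r, π r = 0 ↔ a ∣ r := fun r => by
    rw [hπ, Ideal.Quotient.eq_zero_iff_mem, Ideal.mem_span_singleton]
  have hker' : ∀ p : Polynomial R, p.map π = 0 ↔ Polynomial.C a ∣ p := fun p => by
    simp [Polynomial.C_dvd_iff_dvd_coeff, Polynomial.ext_iff, hker]
  obtain ⟨h', h1, h2⟩ := Polynomial.exists_degree_eq_of_mem_lifts
    ((Polynomial.mem_lifts (h.map π)).2 ⟨h, rfl⟩)
  refine ⟨h', ?_, ?_, ?_⟩
  · rw [← hker', Polynomial.map_sub, h1, sub_self]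
  · exact Polynomial.natDegree_le_natDegree (h2.trans_le Polynomial.degree_map_le)
  · rw [← hker]
    intro h0
    rw [← hker', ← h1] at ha
    refine ha ?_
    rw [← Polynomial.leadingCoeff_eq_zero, Polynomial.leadingCoeff, Polynomial.coeff_map, ← h0, h1,
      Polynomial.natDegree_eq_of_degree_eq h2.symm]
    rfl

end

theorem aeval_dvd_aevalAeval {k A : Type*} [CommRing k] [CommRing A] [Algebra k A] (x t : A)
    {p : Polynomial k} {h : Polynomial (Polynomial k)} (hp : Polynomial.C p ∣ h) :
    Polynomial.aeval x p ∣ Polynomial.aevalAeval x t h := by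
  simpa using map_dvd (Polynomial.aevalAeval (R := k) x t) hp

namespace RRing

open LexSeries

variable {k : Type*} [Field k] {n e d m : ℕ} {f g : ℕ → Polynomial k}

theorem exists_map_yel
    (φ : RRing k n e d m f 0 ≃ₐ[k] RRing k n e d m g 0) (hd : 1 ≤ d) (hm : 2 ≤ m)
    {l u : k} {q : Polynomial k} (hl : l ≠ 0) (hu : u ≠ 0)
    (hx : φ (xel k n e d m f 0) = l • xel k n e d m g 0)
    (hs : φ (sel k n e d m f 0) = u • sel k n e d m g 0 + Polynomial.aeval (xel k n e d m g 0) q) :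
    ∃ h : Polynomial (Polynomial k), h.natDegree < d ∧
      φ (yel k n e d m f 0) = ((l ^ n)⁻¹ * u ^ d) • yel k n e d m g 0 +
        Polynomial.aevalAeval (xel k n e d m g 0) (sel k n e d m g 0) h ∧
      Polynomial.C (Polynomial.C (l ^ n) * Polynomial.X ^ n) * h = substDefect l q d f g u := by
  set w := φ (yel k n e d m f 0) - ((l ^ n)⁻¹ * u ^ d) • yel k n e d m g 0 with hw
  have h1 : l ^ n • (xel k n e d m g 0 ^ n * w) =
      Polynomial.aevalAeval (xel k n e d m g 0) (sel k n e d m g 0) (substDefect l q d f g u) := by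
    have h2 := congrArg φ (xel_pow_mul_yel (k := k) (n := n) (e := e) (d := d) (m := m) (f := f))
    have h3 := map_aevalAeval (φ : RRing k n e d m f 0 →ₐ[k] RRing k n e d m g 0)
      (xel k n e d m f 0) (sel k n e d m f 0) (monicPoly d f)
    simp only [AlgEquiv.coe_toAlgHom, hx, hs] at h3
    rw [map_mul, map_pow, h3, hx, ← aevalAeval_triangularSubst, smul_pow, smul_mul_assoc] at h2
    rw [hw, mul_sub, smul_sub, h2, substDefect, map_sub, map_mul, ← xel_pow_mul_yel, mul_smul_comm,
      smul_smul, mul_inv_cancel_left₀ (pow_ne_zero _ hl), Polynomial.aevalAeval_C,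
      Polynomial.aeval_C, Algebra.smul_def]
  obtain ⟨h, hdeg, hh⟩ : ∃ h : Polynomial (Polynomial k), h.natDegree ≤ d - 1 ∧
      w = Polynomial.aevalAeval (xel k n e d m g 0) (sel k n e d m g 0) h := by
    refine exists_eq_aevalAeval (I := -n) hd hm ?_ (by omega)
    rcases eq_or_ne w 0 with h0 | h0
    · rw [h0, map_zero]
      exact leadLE_zero
    · obtain ⟨i, j, hij⟩ := exists_hasLead_embed hd hm h0
      have h2 := congrArg (embed k n e d m g) h1
      rw [map_smul, map_mul, map_pow, map_aevalAeval, embed_xel, embed_sel, Algebra.smul_def] at h2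
      have h3 := (hasLead_algebraMap (pow_ne_zero n hl)).mul ((hasLead_x_pow n).mul hij)
      rw [h2] at h3
      have h4 := h3.le_iff.1 (leadLE_aevalAeval (hasLead_x.le.mono (by simp)) hasLead_s.le _)
      have h5 := natDegree_substDefect_lt l q hu hd (f := f) (g := g)
      exact hij.le_iff.2 (by omega)
  refine ⟨h, by omega, ?_, ?_⟩
  · rw [← hh, hw, add_sub_cancel]
  · refine aevalAeval_xel_sel_injective (n := n) (e := e) (d := d) (m := m) (f := g) ?_
    rw [← h1, hh]
    simp only [map_mul, map_pow, Polynomial.aevalAeval_C, Polynomial.aeval_C, Polynomial.aeval_X,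
      Algebra.smul_def, mul_assoc]

variable [CharZero k]

theorem dvd_and_pow_eq_of_dvd (he : 1 ≤ e) (hd : 2 ≤ d) (hm : 2 ≤ m) {c u : k} (hc : c ≠ 0)
    {q : Polynomial k} {h : Polynomial (Polynomial k)} (hh : h.natDegree < d)
    (H : xel k n e d m g 0 ^ e ∣ (c • yel k n e d m g 0 +
      Polynomial.aevalAeval (xel k n e d m g 0) (sel k n e d m g 0) h) ^ m -
        (u • sel k n e d m g 0 + Polynomial.aeval (xel k n e d m g 0) q)) :
    Polynomial.C (Polynomial.X ^ e) ∣ h ∧ c ^ m = u := by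
  set x' := xel k n e d m g 0 with hx'
  set s' := sel k n e d m g 0 with hs'
  set y := yel k n e d m g 0 with hy
  have h1 : ∀ h' : Polynomial (Polynomial k), Polynomial.C (Polynomial.X ^ e) ∣ h - h' →
      x' ^ e ∣ (c • y + Polynomial.aevalAeval x' s' h') ^ m - (c • y) ^ m -
        ((u - c ^ m) • s' + Polynomial.aeval x' q) := by
    intro h' hh'
    have h2 : x' ^ e ∣ (c • y + Polynomial.aevalAeval x' s' h) ^ m -
        (c • y + Polynomial.aevalAeval x' s' h') ^ m := by
      refine dvd_trans ?_ (sub_dvd_pow_sub_pow _ _ m)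
      rw [add_sub_add_left_eq_sub, ← map_sub]
      simpa using aeval_dvd_aevalAeval x' s' hh'
    have h3 : x' ^ e ∣ (c • y) ^ m - c ^ m • s' := by
      rw [smul_pow, ← smul_sub, ← xel_pow_mul_zel, ← mul_smul_comm]
      exact dvd_mul_right _ _
    convert (H.sub h2).sub h3 using 1
    rw [Algebra.smul_def (u - c ^ m), Algebra.smul_def u, Algebra.smul_def (c ^ m), map_sub]
    ring
  have hlow : ∀ b : k, LeadLE (embed k n e d m g (b • s' + Polynomial.aeval x' q)) 0 1 := by
    intro b
    rw [map_add, map_smul, ← Polynomial.aeval_algHom_apply, hx', hs', embed_xel, embed_sel,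
      Algebra.smul_def]
    refine LeadLE.add ?_ ((leadLE_aeval (hasLead_x.le.mono (by simp)) q).mono (by simp))
    simpa using (leadLE_algebraMap b).mul hasLead_s.le
  have hdvd : ∀ {r : RRing k n e d m g 0} {i j : ℤ}, HasLead (embed k n e d m g r) i j →
      x' ^ e ∣ r → ∃ t, HasLead (embed k n e d m g t) (i - e) j := by
    rintro _ i j hr ⟨t, rfl⟩
    refine ⟨t, HasLead.of_mul (F := x ^ e) (i := e) (j := 0) ?_ (hasLead_x_pow e)⟩
    rw [map_mul, map_pow, hx', embed_xel] at hr
    convert hr using 1 <;> ring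
  have hCh : Polynomial.C (Polynomial.X ^ e) ∣ h := by
    by_contra hCh
    obtain ⟨h', hdiv, hdeg, hlc⟩ := exists_natDegree_le_not_dvd_leadingCoeff hCh
    obtain ⟨v, hv, hv', -⟩ := exists_hasLead_aeval (p := h'.leadingCoeff)
      (fun h0 => hlc (h0 ▸ dvd_zero _))
    have hve : v < e := by
      by_contra hve
      exact hlc ((pow_dvd_pow _ (not_lt.1 hve)).trans hv')
    have hF : HasLead (embed k n e d m g (c • y)) (-n) d := by
      rw [map_smul, Algebra.smul_def]
      convert (hasLead_algebraMap hc).mul hasLead_yel using 1 <;> ring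
    have hG : HasLead (embed k n e d m g (Polynomial.aevalAeval x' s' h')) v h'.natDegree := by
      rw [map_aevalAeval, hx', hs', embed_xel, embed_sel]
      exact hasLead_aevalAeval hv
    have hW := hasLead_add_pow_sub_pow hF hG (by omega) (m := m) (by omega)
    rw [← map_add, ← map_pow, ← map_pow, ← map_sub] at hW
    have hdm : (d : ℤ) ≤ (m - 1) * d := by
      have : (2 : ℤ) ≤ m := by exact_mod_cast hm
      nlinarith
    have hW' := hW.sub_of_lt ((hlow (u - c ^ m)).lt (by omega))
    rw [← map_sub] at hW'
    obtain ⟨t, ht⟩ := hdvd hW' (h1 h' hdiv)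
    obtain ⟨i, a, a', b, ha', hb, h2, h3⟩ := exists_exponents (by omega) hm ht
    have ha : a = 0 := by
      by_contra ha
      have h4 : (1 : ℤ) ≤ a := by exact_mod_cast Nat.pos_of_ne_zero ha
      have h5 : (d * m : ℤ) * 1 ≤ d * m * a := mul_le_mul_of_nonneg_left h4 (by positivity)
      have h6 : (0 : ℤ) ≤ d * b := by positivity
      have h7 : (m - 1 : ℤ) * d = d * m - d := by ring
      omega
    subst ha
    have h4 : (n : ℤ) * b ≤ n * (m - 1) :=
      mul_le_mul_of_nonneg_left (by omega) (by positivity)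
    have h5 : (m - 1 : ℤ) * -n = -(n * (m - 1)) := by ring
    push_cast at h2
    omega
  refine ⟨hCh, ?_⟩
  by_contra hne
  have h2 := h1 0 (by simpa using hCh)
  rw [map_zero, add_zero, sub_self, zero_sub, dvd_neg] at h2
  have h3 : HasLead (embed k n e d m g ((u - c ^ m) • s' + Polynomial.aeval x' q)) 0 1 := by
    rw [map_add, map_smul, ← Polynomial.aeval_algHom_apply, hx', hs', embed_xel, embed_sel]
    exact hasLead_smul_s_add (sub_ne_zero.2 (Ne.symm hne)) q
  obtain ⟨t, ht⟩ := hdvd h3 h2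
  obtain ⟨i, a, a', b, ha', hb, h4, h5⟩ := exists_exponents (by omega) hm ht
  have ha : a = 0 := by
    by_contra ha
    have : 1 ≤ a := Nat.pos_of_ne_zero ha
    have h6 : 2 * 2 * 1 ≤ d * m * a := by gcongr
    have h7 : 0 ≤ d * b := by positivity
    zify at h6 h7
    omega
  have hb : b = 0 := by
    by_contra hb
    have : 1 ≤ b := Nat.pos_of_ne_zero hb
    have h6 : 2 * 1 ≤ d * b := by gcongr
    have h7 : 0 ≤ d * m * a := by positivity
    zify at h6 h7
    omega
  subst ha hb
  push_cast at h4
  omega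

/-- Isomorphic rings have equivalent defining polynomials. -/
theorem exists_of_algEquiv (φ : RRing k n e d m f 0 ≃ₐ[k] RRing k n e d m g 0)
    (hn : 1 ≤ n) (he : 1 ≤ e) (hd : 2 ≤ d) (hm : 2 ≤ m) (hf : f (d - 1) = 0)
    (hg : g (d - 1) = 0) :
    ∃ l u : k, l ≠ 0 ∧ u ≠ 0 ∧ u ^ (d * m) = l ^ (n * m) * u ∧ ∀ i, 2 ≤ i → i ≤ d →
      Polynomial.X ^ (n + e) ∣ (f (d - i)).comp (Polynomial.C l * Polynomial.X) -
        Polynomial.C (u ^ i) * g (d - i) := by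
  obtain ⟨l, u, q, hl, hu, hx, hs⟩ := exists_map_sel_eq_smul φ hn hn he he hd hd hm
  obtain ⟨h, hdeg, hy, hh⟩ := exists_map_yel φ (by omega) hm hl hu hx hs
  have hz := congrArg φ (xel_pow_mul_zel (k := k) (n := n) (e := e) (d := d) (m := m) (f := f))
  rw [map_mul, map_sub, map_pow, map_pow, hx, hy, hs, smul_pow, smul_mul_assoc,
    ← mul_smul_comm] at hz
  obtain ⟨h1, h2⟩ := dvd_and_pow_eq_of_dvd he hd hm
    (mul_ne_zero (inv_ne_zero (pow_ne_zero n hl)) (pow_ne_zero d hu)) hdeg ⟨_, hz.symm⟩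
  have h3 : Polynomial.C (Polynomial.X ^ (n + e)) ∣ substDefect l q d f g u := by
    rw [← hh, pow_add, Polynomial.C_mul, Polynomial.C_mul]
    exact mul_dvd_mul (dvd_mul_left _ _) h1
  refine ⟨l, u, hl, hu, ?_, (C_dvd_substDefect_iff l q hu hf hg
    (dvd_of_dvd_substDefect l q hu (by omega) hf hg h3)).1 h3⟩
  rw [mul_pow, inv_pow, ← pow_mul, ← pow_mul, inv_mul_eq_iff_eq_mul₀ (pow_ne_zero _ hl)] at h2
  exact h2

end RRing

namespace RRing

variable {k : Type*} [Field k] {n e d m : ℕ} {f g : ℕ → Polynomial k}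

theorem exists_algHom (hf : f (d - 1) = 0) (hg : g (d - 1) = 0) {l u : k} (hl : l ≠ 0) (hu : u ≠ 0)
    (hlu : u ^ (d * m) = l ^ (n * m) * u)
    (h : ∀ i, 2 ≤ i → i ≤ d → Polynomial.X ^ (n + e) ∣
      (f (d - i)).comp (Polynomial.C l * Polynomial.X) - Polynomial.C (u ^ i) * g (d - i)) :
    ∃ φ : RRing k n e d m f 0 →ₐ[k] RRing k n e d m g 0,
      φ (xel k n e d m f 0) = l • xel k n e d m g 0 ∧
      φ (sel k n e d m f 0) = u • sel k n e d m g 0 := by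
  set x' := xel k n e d m g 0
  set s' := sel k n e d m g 0
  set y := yel k n e d m g 0
  have hdvd : ∀ {r : RRing k n e d m g 0} (j : ℕ), x' ^ j ∣ r → ∃ t, (l • x') ^ j * t = r := by
    rintro _ j ⟨t, rfl⟩
    refine ⟨(l ^ j)⁻¹ • t, ?_⟩
    rw [smul_pow, smul_mul_smul_comm, mul_inv_cancel₀ (pow_ne_zero j hl), one_smul]
  obtain ⟨H, hH⟩ := (C_dvd_substDefect_iff l 0 hu hf hg (dvd_zero _)).2 h
  have h1 : Polynomial.aevalAeval (l • x') (u • s') (monicPoly d f) =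
      x' ^ n * (u ^ d • y + x' ^ e * Polynomial.aevalAeval x' s' H) := by
    rw [substDefect, sub_eq_iff_eq_add] at hH
    have h2 := aevalAeval_triangularSubst x' s' l u 0 (monicPoly d f)
    rw [map_zero, add_zero] at h2
    rw [← h2, hH]
    simp only [map_add, map_mul, map_pow, Polynomial.aevalAeval_C, Polynomial.aeval_C,
      Polynomial.aeval_X, Algebra.smul_def]
    rw [← xel_pow_mul_yel]
    ring
  set c := (l ^ n)⁻¹ * u ^ d with hc
  set y' := c • y + x' ^ e * ((l ^ n)⁻¹ • Polynomial.aevalAeval x' s' H) with hy'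
  have h2 : (l • x') ^ n * y' = Polynomial.aevalAeval (l • x') (u • s') (monicPoly d f) := by
    rw [h1, hy', hc, mul_smul, mul_smul_comm, ← smul_add, smul_pow, smul_mul_smul_comm,
      mul_inv_cancel₀ (pow_ne_zero n hl), one_smul]
  have hcm : c ^ m = u := by
    rw [hc, mul_pow, inv_pow, ← pow_mul, ← pow_mul, hlu,
      inv_mul_cancel_left₀ (pow_ne_zero _ hl)]
  obtain ⟨z', hz'⟩ : ∃ z', (l • x') ^ e * z' = y' ^ m - u • s' := by
    refine hdvd e ?_
    have h3 : x' ^ e ∣ y' ^ m - (c • y) ^ m := by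
      refine dvd_trans ?_ (sub_dvd_pow_sub_pow _ _ m)
      rw [hy', add_sub_cancel_left]
      exact dvd_mul_right _ _
    have h4 : x' ^ e ∣ (c • y) ^ m - u • s' := by
      rw [smul_pow, hcm, ← smul_sub, ← xel_pow_mul_zel, ← mul_smul_comm]
      exact dvd_mul_right _ _
    simpa using h3.add h4
  have h5 : y' ^ m - (l • x') ^ e * z' = u • s' := by rw [hz', sub_sub_cancel]
  refine ⟨lift (l • x') y' z' (by rw [h2, h5]), lift_xel _, ?_⟩
  rw [sel_eq, map_sub, map_mul, map_pow, map_pow, lift_xel, lift_yel, lift_zel, h5]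

theorem algHom_eq_id (hd : 1 ≤ d) (hm : 2 ≤ m) {θ : RRing k n e d m f 0 →ₐ[k] RRing k n e d m f 0}
    (hx : θ (xel k n e d m f 0) = xel k n e d m f 0)
    (hs : θ (sel k n e d m f 0) = sel k n e d m f 0) : θ = AlgHom.id k _ := by
  have := isDomain (n := n) (e := e) (f := f) hd hm
  have hx0 : xel k n e d m f 0 ≠ 0 := fun h0 => LexSeries.x_ne_zero (k := k) <| by
    rw [← embed_xel (n := n) (e := e) (d := d) (m := m) (f := f), h0, map_zero]
  have hy : θ (yel k n e d m f 0) = yel k n e d m f 0 := by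
    refine mul_left_cancel₀ (pow_ne_zero n hx0) ?_
    have := congrArg θ (xel_pow_mul_yel (k := k) (n := n) (e := e) (d := d) (m := m) (f := f))
    rwa [map_mul, map_pow, map_aevalAeval, hx, hs, ← xel_pow_mul_yel] at this
  have hz : θ (zel k n e d m f 0) = zel k n e d m f 0 := by
    refine mul_left_cancel₀ (pow_ne_zero e hx0) ?_
    have := congrArg θ (xel_pow_mul_zel (k := k) (n := n) (e := e) (d := d) (m := m) (f := f))
    rwa [map_mul, map_pow, map_sub, map_pow, hx, hy, hs, ← xel_pow_mul_zel] at this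
  ext r
  induction r using RRing.induction with
  | halg c => simp
  | hadd a b ha hb => rw [map_add, ha, hb, map_add]
  | hmul a b ha hb => rw [map_mul, ha, hb, map_mul]
  | hx => exact hx
  | hy => exact hy
  | hz => exact hz

/-- Rings with equivalent defining polynomials are isomorphic. -/
theorem nonempty_algEquiv (hd : 1 ≤ d) (hm : 2 ≤ m) (hf : f (d - 1) = 0) (hg : g (d - 1) = 0)
    {l u : k} (hl : l ≠ 0) (hu : u ≠ 0) (hlu : u ^ (d * m) = l ^ (n * m) * u)
    (h : ∀ i, 2 ≤ i → i ≤ d → Polynomial.X ^ (n + e) ∣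
      (f (d - i)).comp (Polynomial.C l * Polynomial.X) - Polynomial.C (u ^ i) * g (d - i)) :
    Nonempty (RRing k n e d m f 0 ≃ₐ[k] RRing k n e d m g 0) := by
  obtain ⟨φ, hφx, hφs⟩ := exists_algHom (m := m) hf hg hl hu hlu h
  have h' : ∀ i, 2 ≤ i → i ≤ d → Polynomial.X ^ (n + e) ∣
      (g (d - i)).comp (Polynomial.C l⁻¹ * Polynomial.X) -
        Polynomial.C (u⁻¹ ^ i) * f (d - i) := by
    intro i hi hid
    have h1 := map_dvd (Polynomial.compRingHom (Polynomial.C l⁻¹ * Polynomial.X)) (h i hi hid)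
    have h2 : (Polynomial.C l * Polynomial.X).comp (Polynomial.C l⁻¹ * Polynomial.X) =
        Polynomial.X := by
      rw [Polynomial.mul_comp, Polynomial.C_comp, Polynomial.X_comp, ← mul_assoc,
        ← Polynomial.C_mul, mul_inv_cancel₀ hl, Polynomial.C_1, one_mul]
    simp only [Polynomial.coe_compRingHom, Polynomial.sub_comp, Polynomial.mul_comp,
      Polynomial.C_comp, Polynomial.comp_assoc, Polynomial.pow_comp, Polynomial.X_comp, mul_pow,
      h2, Polynomial.comp_X] at h1
    have h3 := ((dvd_mul_left _ _).trans h1).mul_left (-Polynomial.C (u⁻¹ ^ i))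
    convert h3 using 1
    have h4 : Polynomial.C (u⁻¹ ^ i) * Polynomial.C (u ^ i) = 1 := by
      rw [← Polynomial.C_mul, ← mul_pow, inv_mul_cancel₀ hu, one_pow, Polynomial.C_1]
    linear_combination (-(g (d - i)).comp (Polynomial.C l⁻¹ * Polynomial.X)) * h4
  have hlu' : u⁻¹ ^ (d * m) = l⁻¹ ^ (n * m) * u⁻¹ := by
    rw [inv_pow, inv_pow, hlu, mul_inv]
  obtain ⟨ψ, hψx, hψs⟩ := exists_algHom (m := m) hg hf (inv_ne_zero hl) (inv_ne_zero hu) hlu' h'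
  refine ⟨AlgEquiv.ofAlgHom φ ψ (algHom_eq_id hd hm ?_ ?_) (algHom_eq_id hd hm ?_ ?_)⟩
  · rw [AlgHom.comp_apply, hψx, map_smul, hφx, smul_smul, inv_mul_cancel₀ hl, one_smul]
  · rw [AlgHom.comp_apply, hψs, map_smul, hφs, smul_smul, inv_mul_cancel₀ hu, one_smul]
  · rw [AlgHom.comp_apply, hφx, map_smul, hψx, smul_smul, mul_inv_cancel₀ hl, one_smul]
  · rw [AlgHom.comp_apply, hφs, map_smul, hψs, smul_smul, mul_inv_cancel₀ hu, one_smul]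

end RRing

end

theorem stmt16 {k : Type*} [Field k] [CharZero k]
    (n₁ n₂ e₁ e₂ d₁ d₂ m : ℕ)
    (hn₁ : 1 ≤ n₁) (hn₂ : 1 ≤ n₂) (he₁ : 1 ≤ e₁) (he₂ : 1 ≤ e₂)
    (hd₁ : 2 ≤ d₁) (hd₂ : 2 ≤ d₂) (hm : 2 ≤ m)
    (f g : ℕ → Polynomial k)
    -- the coefficients of `S^{d₁-1}` in `P₁` and of `S^{d₂-1}` in `P₂` vanish
    (hf : f (d₁ - 1) = 0) (hg : g (d₂ - 1) = 0)
    -- `Q(X,Y) = Y^m`: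
    (q : ℕ → Polynomial k) (hq : ∀ j, q j = 0) :
    Nonempty (RRing k n₁ e₁ d₁ m f q ≃ₐ[k] RRing k n₂ e₂ d₂ m g q) ↔
      n₁ = n₂ ∧ e₁ = e₂ ∧ d₁ = d₂ ∧
      ∃ l u : k, l ≠ 0 ∧ u ≠ 0 ∧
        u ^ (d₁ * m) = l ^ (n₁ * m) * u ∧
        ∀ i : ℕ, 2 ≤ i → i ≤ d₁ →
          (f (d₁ - i)).comp (Polynomial.C l * Polynomial.X) -
              Polynomial.C (u ^ i) * g (d₁ - i) ∈
            Ideal.span {(Polynomial.X : Polynomial k) ^ (n₁ + e₁)} := by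
  obtain rfl : q = 0 := funext hq
  simp only [Ideal.mem_span_singleton]
  constructor
  · rintro ⟨φ⟩
    obtain ⟨rfl, rfl, rfl⟩ := RRing.eq_of_algEquiv φ hn₁ hn₂ he₁ he₂ hd₁ hd₂ hm
    exact ⟨rfl, rfl, rfl, RRing.exists_of_algEquiv φ hn₁ he₁ hd₁ hm hf hg⟩
  · rintro ⟨rfl, rfl, rfl, l, u, hl, hu, hlu, h⟩
    exact RRing.nonempty_algEquiv (by omega) hm hf hg hl hu hlu h
end
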